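/- Let p be a rational prime with p ≡ 4 or 7 (mod 9) such that 3 is not a cubic residue modulo p. Then p is a cube sum and p² is a cube sum; that is, there exist nonzero rational numbers a, b with a³ + b³ = p, and nonzero rational numbers c, d with c³ + d³ = p². -/

import Mathlib

/-- A nonzero rational number is a *cube sum* if it equals `a³ + b³`
with `a, b` nonzero rationals. -/
def IsCubeSum (r : ℚ) : Prop := ∃ a b : ℚ, a ≠ 0 ∧ b ≠ 0 ∧ a ^ 3 + b ^ 3 = r

set_option autoImplicit false

namespace CubeSum

open Filter Topology PeriodPair

/-- A primitive cube root of unity. -/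
noncomputable def ω : ℂ := ⟨-1 / 2, √3 / 2⟩

lemma omega_sq : ω ^ 2 = -1 - ω := by
  have h : √3 * √3 = 3 := Real.mul_self_sqrt (by norm_num)
  apply Complex.ext
  · simp [ω, pow_two]; linarith
  · simp [ω, pow_two]; ring

lemma omega_cube : ω ^ 3 = 1 := by linear_combination (ω - 1) * omega_sq

lemma omega_ne_zero : ω ≠ 0 := by
  intro h; have := omega_cube; rw [h] at this; norm_num at this

lemma omega_ne_one : ω ≠ 1 := by
  intro h; have := omega_sq; rw [h] at this; norm_num at this

lemma omega_im_ne_zero : ω.im ≠ 0 := by simp [ω]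

lemma one_omega_indep : LinearIndependent ℝ ![(1 : ℂ), ω] := by
  rw [LinearIndependent.pair_iff]
  intro a b h
  have h1 := congrArg Complex.im h
  have h2 := congrArg Complex.re h
  simp [omega_im_ne_zero] at h1
  subst h1
  simpa using h2

/-- The pair of periods `1, ω` of the hexagonal lattice. -/
noncomputable def hexPair : PeriodPair := ⟨1, ω, one_omega_indep⟩

/-- The hexagonal lattice `ℤ[ω]`. -/
noncomputable abbrev Λ : Submodule ℤ ℂ := hexPair.lattice

lemma mem_hex {z : ℂ} : z ∈ Λ ↔ ∃ m n : ℤ, (m : ℂ) + n * ω = z := by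
  rw [PeriodPair.mem_lattice]; simp [hexPair]

lemma one_mem_hex : (1 : ℂ) ∈ Λ := mem_hex.2 ⟨1, 0, by simp⟩

lemma intCast_mem_hex (n : ℤ) : (n : ℂ) ∈ Λ := mem_hex.2 ⟨n, 0, by simp⟩

lemma mul_mem_hex {z w : ℂ} (hz : z ∈ Λ) (hw : w ∈ Λ) : z * w ∈ Λ := by
  obtain ⟨a, b, rfl⟩ := mem_hex.1 hz
  obtain ⟨c, d, rfl⟩ := mem_hex.1 hw
  refine mem_hex.2 ⟨a * c - b * d, a * d + b * c - b * d, ?_⟩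
  push_cast
  linear_combination (-(b : ℂ) * d) * omega_sq

lemma omega_mem_hex : ω ∈ Λ := mem_hex.2 ⟨0, 1, by simp⟩

lemma omega_mul_mem_hex {z : ℂ} : ω * z ∈ Λ ↔ z ∈ Λ := by
  refine ⟨fun h => ?_, mul_mem_hex omega_mem_hex⟩
  have := mul_mem_hex (mul_mem_hex omega_mem_hex omega_mem_hex) h
  rwa [show ω * ω * (ω * z) = z by linear_combination z * omega_cube] at this

/-- Multiplication by `ω` on the hexagonal lattice. -/
noncomputable def omegaEquiv : Λ ≃ Λ where
  toFun l := ⟨ω * l, omega_mul_mem_hex.2 l.2⟩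
  invFun l := ⟨ω * (ω * l), omega_mul_mem_hex.2 (omega_mul_mem_hex.2 l.2)⟩
  left_inv l := Subtype.ext (by simp only; linear_combination (l : ℂ) * omega_cube)
  right_inv l := Subtype.ext (by simp only; linear_combination (l : ℂ) * omega_cube)

lemma omegaEquiv_coe (l : Λ) : ((omegaEquiv l : Λ) : ℂ) = ω * l := rfl

lemma weierstrassP_omega (z : ℂ) : ℘[hexPair] (ω * z) = ω * ℘[hexPair] z := by
  unfold weierstrassP
  rw [← omegaEquiv.tsum_eq, ← tsum_mul_left]
  congr 1; ext l
  rw [omegaEquiv_coe, ← mul_sub, mul_pow, mul_pow]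
  have h : ω ^ 2 ≠ 0 := pow_ne_zero _ omega_ne_zero
  have h2 : (ω ^ 2)⁻¹ = ω := inv_eq_of_mul_eq_one_right (by
    linear_combination omega_cube)
  rw [one_div, one_div, mul_inv, mul_inv, h2, one_div, one_div]
  ring

lemma derivWeierstrassP_omega (z : ℂ) : ℘'[hexPair] (ω * z) = ℘'[hexPair] z := by
  unfold derivWeierstrassP
  rw [← omegaEquiv.tsum_eq]
  congr 2; ext l
  rw [omegaEquiv_coe, ← mul_sub, mul_pow, omega_cube, one_mul]

lemma g₂_hex : hexPair.g₂ = 0 := by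
  have h : hexPair.G 4 = ω ^ 2 * hexPair.G 4 := by
    conv_lhs => unfold PeriodPair.G
    rw [← omegaEquiv.tsum_eq]
    unfold PeriodPair.G
    rw [← tsum_mul_left]
    congr 1; ext l
    rw [omegaEquiv_coe, mul_pow, mul_inv]
    congr 1
    refine inv_eq_of_mul_eq_one_right ?_
    linear_combination (ω ^ 3 + 1) * omega_cube
  have h2 : (1 - ω ^ 2) * hexPair.G 4 = 0 := by linear_combination h
  have h3 : (1 - ω ^ 2) ≠ 0 := by
    intro h3
    apply omega_ne_one
    linear_combination omega_cube + ω * h3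
  simp [PeriodPair.g₂, (mul_eq_zero.1 h2).resolve_left h3]

lemma P_rel {z : ℂ} (hz : z ∉ Λ) :
    ℘'[hexPair] z ^ 2 = 4 * ℘[hexPair] z ^ 3 - hexPair.g₃ := by
  have := hexPair.derivWeierstrassP_sq z hz
  rw [g₂_hex] at this; linear_combination this

lemma countable_hex : (Λ : Set ℂ).Countable :=
  countable_of_Lindelof_of_discrete (X := hexPair.lattice)

lemma preconnected_compl_countable {S : Set ℂ} (hS : S.Countable) : IsPreconnected Sᶜ :=
  (hS.isConnected_compl_of_one_lt_rank (by simp)).isPreconnected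

lemma isOpen_compl_hex : IsOpen (Λ : Set ℂ)ᶜ := hexPair.isClosed_lattice.isOpen_compl

lemma hasDerivAt_P {z : ℂ} (hz : z ∉ Λ) : HasDerivAt ℘[hexPair] (℘'[hexPair] z) z := by
  have h := (hexPair.analyticOnNhd_weierstrassP z hz).differentiableAt.hasDerivAt
  rwa [deriv_weierstrassP] at h

lemma tendsto_P_zero : Tendsto ℘[hexPair] (𝓝[≠] 0) (Bornology.cobounded ℂ) := by
  apply tendsto_cobounded_of_meromorphicOrderAt_neg
  rw [hexPair.order_weierstrassP 0 (zero_mem _)]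
  exact WithTop.coe_lt_coe.2 (by norm_num : (-2 : ℤ) < 0)

lemma P_not_const (k : ℂ) : ¬ ∀ z ∉ Λ, ℘[hexPair] z = k := by
  intro h
  have h1 : ∀ᶠ z in 𝓝[≠] (0 : ℂ), z ∉ Λ := by
    have := hexPair.compl_lattice_sdiff_singleton_mem_nhds 0
    filter_upwards [mem_nhdsWithin_of_mem_nhds this, self_mem_nhdsWithin] with z hz hz0 hz1
    exact hz ⟨hz1, hz0⟩
  have h2 : Tendsto ℘[hexPair] (𝓝[≠] 0) (𝓝 k) :=
    tendsto_nhds_of_eventually_eq (h1.mono h)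
  exact h2.not_tendsto (Metric.disjoint_nhds_cobounded k) tendsto_P_zero

lemma deriv_P'_aux {z : ℂ} (hz : z ∉ Λ) : deriv ℘'[hexPair] z = 6 * ℘[hexPair] z ^ 2 := by
  have hD := hexPair.analyticOnNhd_derivWeierstrassP
  have hP := hexPair.analyticOnNhd_weierstrassP
  have key : ∀ z ∈ (Λ : Set ℂ)ᶜ,
      ℘'[hexPair] z * (deriv ℘'[hexPair] z - 6 * ℘[hexPair] z ^ 2) = 0 := by
    intro z hz
    have h1 : HasDerivAt (fun z => ℘'[hexPair] z ^ 2) _ z :=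
      (hD z hz).differentiableAt.hasDerivAt.pow 2
    have h2 : HasDerivAt (fun z => 4 * ℘[hexPair] z ^ 3 - hexPair.g₃) _ z :=
      (((hasDerivAt_P hz).pow 3).const_mul 4).sub_const _
    have h3 : (fun z => ℘'[hexPair] z ^ 2) =ᶠ[𝓝 z] fun z => 4 * ℘[hexPair] z ^ 3 - hexPair.g₃ := by
      filter_upwards [isOpen_compl_hex.mem_nhds hz] with w hw using P_rel hw
    have := h1.unique (h2.congr_of_eventuallyEq h3)
    push_cast at this
    linear_combination this / 2
  rcases AnalyticOnNhd.eq_zero_or_eq_zero_of_mul_eq_zero hD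
    (hD.deriv.sub (analyticOnNhd_const.mul (hP.pow 2))) key
    (preconnected_compl_countable countable_hex) with h | h
  · exfalso
    refine P_not_const (℘[hexPair] (1 / 2)) fun z hz => ?_
    refine isOpen_compl_hex.is_const_of_deriv_eq_zero
      (preconnected_compl_countable countable_hex) hP.differentiableOn (fun w hw => ?_) hz ?_
    · rw [deriv_weierstrassP]; exact h w hw
    · exact hexPair.ω₁_div_two_notMem_lattice
  · exact sub_eq_zero.1 (h z hz)

lemma hasDerivAt_P' {z : ℂ} (hz : z ∉ Λ) :
    HasDerivAt ℘'[hexPair] (6 * ℘[hexPair] z ^ 2) z := by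
  have h := (hexPair.analyticOnNhd_derivWeierstrassP z hz).differentiableAt.hasDerivAt
  rwa [deriv_P'_aux hz] at h

lemma g₃_ne_zero : hexPair.g₃ ≠ 0 := by
  intro h0
  have hz : (1 / 2 : ℂ) ∉ Λ := hexPair.ω₁_div_two_notMem_lattice
  have hD := hexPair.analyticOnNhd_derivWeierstrassP (1 / 2) hz
  have hP := hexPair.analyticOnNhd_weierstrassP (1 / 2) hz
  have d0 : ℘'[hexPair] (1 / 2) = 0 := by
    have h1 := hexPair.derivWeierstrassP_add_coe (-(1 / 2)) ⟨1, one_mem_hex⟩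
    rw [derivWeierstrassP_neg] at h1
    norm_num at h1
    norm_num
    linear_combination h1 / 2
  have rel : ∀ z ∉ Λ, ℘'[hexPair] z ^ 2 = 4 * ℘[hexPair] z ^ 3 := fun z hz => by
    rw [P_rel hz, h0, sub_zero]
  have p0 : ℘[hexPair] (1 / 2) = 0 := by
    have := rel _ hz
    rw [d0] at this
    simpa using this.symm
  have o1 := hP.analyticOrderAt_deriv_add_one
  rw [deriv_weierstrassP, p0] at o1
  simp only [sub_zero] at o1
  have o2 : analyticOrderAt (℘'[hexPair] ^ 2) (1 / 2)
      = analyticOrderAt ((fun _ => (4 : ℂ)) * ℘[hexPair] ^ 3) (1 / 2) :=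
    analyticOrderAt_congr (by
      filter_upwards [isOpen_compl_hex.mem_nhds hz] with w hw
      simpa using rel w hw)
  rw [analyticOrderAt_mul analyticAt_const (hP.pow 3), analyticOrderAt_pow hD,
    analyticOrderAt_pow hP, analyticAt_const.analyticOrderAt_eq_zero.2 (by norm_num)] at o2
  change _ = analyticOrderAt ℘[hexPair] (1 / 2) at o1
  rw [← o1] at o2
  have htop : analyticOrderAt ℘[hexPair] (1 / 2) = ⊤ := by
    rw [← o1]
    generalize analyticOrderAt ℘'[hexPair] (1 / 2) = n at o2
    induction n using ENat.recTopCoe with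
    | top => rfl
    | coe n =>
      exfalso
      have : 2 * n = 3 * (n + 1) := by
        rw [zero_add, nsmul_eq_mul, nsmul_eq_mul] at o2
        exact_mod_cast o2
      omega
  rw [analyticOrderAt_eq_top] at htop
  exact P_not_const 0 fun z hz' => hexPair.analyticOnNhd_weierstrassP.eqOn_zero_of_preconnected_of_eventuallyEq_zero
    (preconnected_compl_countable countable_hex) hz htop hz'

lemma exists_b : ∃ b : ℂ, b ^ 2 = 1 / (3 * hexPair.g₃) := IsAlgClosed.exists_pow_nat_eq _ two_pos
lemma exists_a : ∃ a : ℂ, a ^ 3 = -1 / hexPair.g₃ := IsAlgClosed.exists_pow_nat_eq _ three_pos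

/-- Scaling constant for the derivative of `℘`. -/
noncomputable def kb : ℂ := exists_b.choose
/-- Scaling constant for `℘`. -/
noncomputable def ka : ℂ := exists_a.choose
lemma kb_sq : kb ^ 2 = 1 / (3 * hexPair.g₃) := exists_b.choose_spec
lemma ka_cube : ka ^ 3 = -1 / hexPair.g₃ := exists_a.choose_spec
lemma kb_ne : kb ≠ 0 := by
  intro h; have := kb_sq; rw [h] at this; simp [g₃_ne_zero] at this
lemma ka_ne : ka ≠ 0 := by
  intro h; have := ka_cube; rw [h, eq_div_iff g₃_ne_zero] at this; norm_num at this
lemma ka_kb : ka ^ 3 = -3 * kb ^ 2 := by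
  rw [ka_cube, kb_sq]; have := g₃_ne_zero; field_simp

/-- Ratio of the scaling constants. -/
noncomputable def kc : ℂ := ka / kb
lemma kc_ne : kc ≠ 0 := div_ne_zero ka_ne kb_ne

/-- Scaled `℘`. -/
noncomputable def X (z : ℂ) : ℂ := ka * ℘[hexPair] z
/-- Scaled derivative of `℘`. -/
noncomputable def Y (z : ℂ) : ℂ := kb * ℘'[hexPair] z

lemma XY_rel {z : ℂ} (hz : z ∉ Λ) : 4 * X z ^ 3 + 1 + 3 * Y z ^ 2 = 0 := by
  have h := P_rel hz
  have hb : 3 * hexPair.g₃ * kb ^ 2 = 1 := by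
    rw [kb_sq]; have := g₃_ne_zero; field_simp
  simp only [X, Y]
  linear_combination (4 * ℘[hexPair] z ^ 3) * ka_kb + 3 * kb ^ 2 * h - hb

lemma hasDerivAt_X {z : ℂ} (hz : z ∉ Λ) : HasDerivAt X (kc * Y z) z := by
  have := (hasDerivAt_P hz).const_mul ka
  refine this.congr_deriv ?_
  have := kb_ne
  simp only [kc, Y]; field_simp

lemma hasDerivAt_Y {z : ℂ} (hz : z ∉ Λ) : HasDerivAt Y (-2 * kc * X z ^ 2) z := by
  have := (hasDerivAt_P' hz).const_mul kb
  refine this.congr_deriv ?_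
  have := kb_ne
  simp only [kc, X]; field_simp
  linear_combination 2 * ℘[hexPair] z ^ 2 * ka_kb

/-- A property that holds outside a closed discrete set. -/
def Gen (P : ℂ → Prop) : Prop := ∀ x, ∀ᶠ y in 𝓝[≠] x, P y

lemma Gen.and {P Q : ℂ → Prop} (hP : Gen P) (hQ : Gen Q) : Gen fun z => P z ∧ Q z :=
  fun x => (hP x).and (hQ x)

lemma Gen.mono {P Q : ℂ → Prop} (hP : Gen P) (h : ∀ z, P z → Q z) : Gen Q :=
  fun x => (hP x).mono h

lemma Gen.all {ι : Type*} [Finite ι] {P : ι → ℂ → Prop} (hP : ∀ i, Gen (P i)) :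
    Gen fun z => ∀ i, P i z := fun x => eventually_all.2 fun i => hP i x

lemma Gen.comp {P : ℂ → Prop} (hP : Gen P) {a : ℂ} (ha : a ≠ 0) (b : ℂ) :
    Gen fun z => P (a * z + b) := by
  intro x
  have : Tendsto (fun z => a * z + b) (𝓝[≠] x) (𝓝[≠] (a * x + b)) := by
    refine tendsto_nhdsWithin_of_tendsto_nhds_of_eventually_within _
      ((by fun_prop : Continuous fun z => a * z + b).continuousAt.mono_left nhdsWithin_le_nhds) ?_
    filter_upwards [self_mem_nhdsWithin] with z hz h
    apply hz
    have : a * z + b = a * x + b := h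
    exact mul_left_cancel₀ ha (add_right_cancel this)
  exact this.eventually (hP _)

lemma Gen.shift {P : ℂ → Prop} (hP : Gen P) (b : ℂ) : Gen fun z => P (z + b) := by
  simpa using hP.comp one_ne_zero b

lemma Gen.frequently {P : ℂ → Prop} (hP : Gen P) (x : ℂ) : ∃ᶠ y in 𝓝 x, P y :=
  ((hP x).frequently).filter_mono nhdsWithin_le_nhds

lemma Gen.exists {P : ℂ → Prop} (hP : Gen P) : ∃ x, P x := (hP 0).exists

lemma Gen.isOpen {P : ℂ → Prop} (hP : Gen P) : IsOpen {z | P z} := by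
  rw [isOpen_iff_mem_nhds]
  intro x hx
  have := hP x
  rw [eventually_nhdsWithin_iff] at this
  filter_upwards [this] with y hy
  by_cases h : y = x
  · subst h; exact hx
  · exact hy h

lemma Gen.preconnected {P : ℂ → Prop} (hP : Gen P) : IsPreconnected {z | P z} := by
  have hc : ({z | P z}ᶜ).Countable := by
    have : DiscreteTopology ↥({z | P z}ᶜ) := by
      rw [discreteTopology_subtype_iff]
      intro x _
      rw [← disjoint_iff, disjoint_principal_right]
      filter_upwards [hP x] with y hy h using h hy
    exact countable_of_Lindelof_of_discrete (X := ↥({z | P z}ᶜ))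
  simpa using preconnected_compl_countable hc

lemma gen_eq_of_continuous {f g : ℂ → ℂ} (h : Gen fun z => f z = g z) {x : ℂ}
    (hf : ContinuousAt f x) (hg : ContinuousAt g x) : f x = g x :=
  tendsto_nhds_unique_of_frequently_eq hf hg (h.frequently x)

/-- `q` extends analytically across `z₀`. -/
def Ext (q : ℂ → ℂ) (z₀ : ℂ) : Prop := ∃ h : ℂ → ℂ, AnalyticAt ℂ h z₀ ∧ h =ᶠ[𝓝[≠] z₀] q

lemma ext_of_div {N D : ℂ → ℂ} {z₀ : ℂ} (hN : AnalyticAt ℂ N z₀) (hD : AnalyticAt ℂ D z₀)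
    (h : D z₀ ≠ 0) : Ext (fun z => N z / D z) z₀ :=
  ⟨_, hN.div hD h, EventuallyEq.rfl⟩

lemma analyticAt_dslope {f : ℂ → ℂ} {z₀ : ℂ} (hf : AnalyticAt ℂ f z₀) :
    AnalyticAt ℂ (dslope f z₀) z₀ := by
  obtain ⟨p, hp⟩ := hf
  exact hp.has_fpower_series_dslope_fslope.analyticAt

lemma ext_of_simple_zero {N D : ℂ → ℂ} {z₀ : ℂ} (hN : AnalyticAt ℂ N z₀)
    (hD : AnalyticAt ℂ D z₀) (hN0 : N z₀ = 0) (hD0 : D z₀ = 0) (h : deriv D z₀ ≠ 0) :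
    Ext (fun z => N z / D z) z₀ := by
  refine ⟨_, (analyticAt_dslope hN).div (analyticAt_dslope hD) (by rwa [dslope_same]), ?_⟩
  filter_upwards [self_mem_nhdsWithin] with z hz
  have hz' : z - z₀ ≠ 0 := sub_ne_zero.2 hz
  have e1 := sub_smul_dslope N z₀ z
  have e2 := sub_smul_dslope D z₀ z
  rw [hN0, sub_zero, smul_eq_mul] at e1
  rw [hD0, sub_zero, smul_eq_mul] at e2
  rw [Pi.div_apply, ← e1, ← e2, mul_div_mul_left _ _ hz']

lemma Ext.congr {q r : ℂ → ℂ} {z₀ : ℂ} (h : Ext q z₀) (e : q =ᶠ[𝓝[≠] z₀] r) : Ext r z₀ := by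
  obtain ⟨f, hf, hq⟩ := h
  exact ⟨f, hf, hq.trans e⟩

lemma Ext.comp_add {q : ℂ → ℂ} {z₀ b : ℂ} (h : Ext q (z₀ + b)) : Ext (fun z => q (z + b)) z₀ := by
  obtain ⟨f, hf, hq⟩ := h
  refine ⟨fun z => f (z + b), hf.comp_of_eq (by fun_prop) rfl, ?_⟩
  have : Tendsto (fun z => z + b) (𝓝[≠] z₀) (𝓝[≠] (z₀ + b)) := by
    refine tendsto_nhdsWithin_of_tendsto_nhds_of_eventually_within _
      ((by fun_prop : Continuous fun z => z + b).continuousAt.mono_left nhdsWithin_le_nhds) ?_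
    filter_upwards [self_mem_nhdsWithin] with z hz h
    exact hz (add_right_cancel h)
  exact this.eventually hq

/-- The theorem of Liouville for elliptic functions without poles. -/
lemma liouville {q : ℂ → ℂ} (hq : ∀ z, Ext q z) (hper : ∀ z, ∀ l ∈ Λ, q (z + l) = q z) :
    ∃ k, Gen fun z => q z = k := by
  choose h ha he using hq
  have lim : ∀ z, Tendsto q (𝓝[≠] z) (𝓝 (h z z)) := fun z =>
    ((ha z).continuousAt.tendsto.mono_left nhdsWithin_le_nhds).congr' (he z)
  set Q : ℂ → ℂ := fun z => h z z with hQ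
  have hloc : ∀ z, Q =ᶠ[𝓝 z] h z := by
    intro z
    have h1 := (eventually_nhdsWithin_iff.1 (he z)).eventually_nhds
    filter_upwards [h1, (ha z).eventually_analyticAt] with w hw hwa
    have : h z =ᶠ[𝓝[≠] w] q := by
      by_cases hzw : w = z
      · subst hzw; exact he w
      · have h2 : ∀ᶠ y in 𝓝[≠] w, y ≠ z :=
          eventually_nhdsWithin_of_eventually_nhds (isOpen_ne.mem_nhds hzw)
        filter_upwards [eventually_nhdsWithin_of_eventually_nhds hw, h2] with y hy hyz
        exact hy hyz
    exact tendsto_nhds_unique ((lim w).congr' EventuallyEq.rfl)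
      ((hwa.continuousAt.tendsto.mono_left nhdsWithin_le_nhds).congr' this)
  have hdiff : Differentiable ℂ Q := fun z =>
    ((ha z).congr (hloc z).symm).differentiableAt
  have hQper : ∀ z, ∀ l ∈ Λ, Q (z + l) = Q z := by
    intro z l hl
    refine tendsto_nhds_unique (lim (z + l)) ?_
    have h1 : Tendsto (fun y => y - l) (𝓝[≠] (z + l)) (𝓝[≠] z) := by
      refine tendsto_nhdsWithin_of_tendsto_nhds_of_eventually_within _ ?_ ?_
      · have : ContinuousAt (fun y => y - l) (z + l) := by fun_prop
        have h := this.tendsto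
        simp only [add_sub_cancel_right] at h
        exact h.mono_left nhdsWithin_le_nhds
      · filter_upwards [self_mem_nhdsWithin] with y hy h
        exact hy (by rw [← show y - l = z from h]; simp)
    refine ((lim z).comp h1).congr fun y => ?_
    have := hper (y - l) l hl
    rw [sub_add_cancel] at this
    exact this.symm
  have hcpt := IsZLattice.isCompact_range_of_periodic Λ Q hdiff.continuous
    (fun z l hl => hQper z l hl)
  have hconst := hdiff.apply_eq_apply_of_bounded hcpt.isBounded
  refine ⟨Q 0, fun x => ?_⟩
  filter_upwards [he x, eventually_nhdsWithin_of_eventually_nhds (hloc x)] with y h1 h2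
  rw [← h1, ← h2]; exact hconst _ _

open Classical in
/-- Projective uniformization of the Fermat cubic `x³ + y³ + z³ = 0`. -/
noncomputable def φ (z : ℂ) : Fin 3 → ℂ :=
  if z ∈ Λ then ![0, 1, -1] else ![2 * X z, 1 + Y z, 1 - Y z]

lemma φ_of_mem {z : ℂ} (h : z ∈ Λ) : φ z = ![0, 1, -1] := if_pos h
lemma φ_of_notMem {z : ℂ} (h : z ∉ Λ) : φ z = ![2 * X z, 1 + Y z, 1 - Y z] := if_neg h
lemma φ_zero : φ 0 = ![0, 1, -1] := φ_of_mem (zero_mem _)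

lemma φ_periodic (z : ℂ) {l : ℂ} (hl : l ∈ Λ) : φ (z + l) = φ z := by
  by_cases h : z ∈ Λ
  · rw [φ_of_mem h, φ_of_mem (add_mem h hl)]
  · have h' : z + l ∉ Λ := fun h' => h (by simpa using sub_mem h' hl)
    rw [φ_of_notMem h, φ_of_notMem h']
    have e1 := hexPair.weierstrassP_add_coe z ⟨l, hl⟩
    have e2 := hexPair.derivWeierstrassP_add_coe z ⟨l, hl⟩
    simp only [X, Y]
    rw [e1, e2]

lemma φ_curve (z : ℂ) : φ z 0 ^ 3 + φ z 1 ^ 3 + φ z 2 ^ 3 = 0 := by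
  by_cases h : z ∈ Λ
  · rw [φ_of_mem h]; norm_num [Matrix.cons_val_two, Matrix.tail_cons]
  · rw [φ_of_notMem h]
    simp only [Matrix.cons_val_zero, Matrix.cons_val_one, Matrix.cons_val]
    linear_combination 2 * XY_rel h

lemma φ_ne_zero (z : ℂ) : φ z ≠ 0 := by
  by_cases h : z ∈ Λ
  · rw [φ_of_mem h]; intro e; simpa using congrFun e 1
  · rw [φ_of_notMem h]; intro e
    have e1 := congrFun e 1
    have e2 := congrFun e 2
    simp only [Matrix.cons_val_one, Matrix.cons_val, Pi.zero_apply] at e1 e2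
    have : (2 : ℂ) = 0 := by linear_combination e1 + e2
    norm_num at this

lemma φ_omega (z : ℂ) : φ (ω * z) = ![ω * φ z 0, φ z 1, φ z 2] := by
  by_cases h : z ∈ Λ
  · rw [φ_of_mem h, φ_of_mem (omega_mul_mem_hex.2 h)]; simp
  · rw [φ_of_notMem h, φ_of_notMem (mt omega_mul_mem_hex.1 h)]
    simp only [X, Y, weierstrassP_omega, derivWeierstrassP_omega, Matrix.cons_val_zero,
      Matrix.cons_val_one, Matrix.cons_val]
    congr 1; ring

lemma φ_neg (z : ℂ) : ∃ ρ : ℂ, ρ ≠ 0 ∧ φ (-z) = ρ • ![φ z 0, φ z 2, φ z 1] := by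
  by_cases h : z ∈ Λ
  · refine ⟨-1, by norm_num, ?_⟩
    rw [φ_of_mem h, φ_of_mem (neg_mem h)]; simp
  · refine ⟨1, one_ne_zero, ?_⟩
    rw [φ_of_notMem h, φ_of_notMem (mt neg_mem_iff.1 h)]
    simp [X, Y, weierstrassP_neg, derivWeierstrassP_neg, sub_eq_add_neg]

/-- A local analytic representative of `φ`. -/
lemma φ_local (z₀ : ℂ) : ∃ ψ : ℂ → Fin 3 → ℂ, (∀ i, AnalyticAt ℂ (fun z => ψ z i) z₀) ∧
    ψ z₀ = φ z₀ ∧ ∀ᶠ z in 𝓝 z₀, ∃ ρ : ℂ, ρ ≠ 0 ∧ φ z = ρ • ψ z := by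
  by_cases h : z₀ ∈ Λ
  · have hA := (hexPair.analyticAt_weierstrassPExcept 0)
    have hB := (hexPair.analyticAt_derivWeierstrassPExcept 0)
    set u : ℂ → ℂ := fun z => 1 + z ^ 2 * ℘[hexPair - (0:ℂ)] z with hu
    set v : ℂ → ℂ := fun z => -2 + z ^ 3 * ℘'[hexPair - (0:ℂ)] z with hv
    have hua : AnalyticAt ℂ u 0 := by fun_prop
    have hva : AnalyticAt ℂ v 0 := by fun_prop
    set ψ₀ : ℂ → Fin 3 → ℂ := fun z => (-2 * kb)⁻¹ •
      ![2 * ka * z * u z, z ^ 3 + kb * v z, z ^ 3 - kb * v z] with hψ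
    have hψa : ∀ i, AnalyticAt ℂ (fun z => ψ₀ z i) 0 := by
      intro i; fin_cases i <;> simp only [hψ] <;> simp <;> fun_prop
    have hψ0 : ψ₀ 0 = ![0, 1, -1] := by
      have := kb_ne
      ext i; fin_cases i <;> simp [hψ, hv] <;> field_simp
    have hev : ∀ᶠ z in 𝓝 (0 : ℂ), ∃ ρ : ℂ, ρ ≠ 0 ∧ φ z = ρ • ψ₀ z := by
      filter_upwards [hexPair.compl_lattice_sdiff_singleton_mem_nhds 0] with z hz
      by_cases hz0 : z = 0
      · subst hz0; exact ⟨1, one_ne_zero, by rw [hψ0, φ_zero, one_smul]⟩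
      · have hz1 : z ∉ Λ := fun h => hz ⟨h, hz0⟩
        refine ⟨-2 * kb / z ^ 3, by simp [kb_ne, hz0], ?_⟩
        have e1 := hexPair.weierstrassPExcept_def 0 z
        have e2 := hexPair.derivWeierstrassPExcept_def 0 z
        simp only [ZeroMemClass.coe_zero, ne_eq, OfNat.ofNat_ne_zero, not_false_eq_true, zero_pow,
          div_zero, sub_zero, zero_sub] at e1 e2
        have e1' : ℘[hexPair] z = u z / z ^ 2 := by
          simp only [hu]; rw [e1]; field_simp; ring
        have e2' : ℘'[hexPair] z = v z / z ^ 3 := by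
          simp only [hv]; rw [e2]; field_simp; ring
        rw [φ_of_notMem hz1, hψ]
        have := kb_ne
        simp only [X, Y, e1', e2']
        ext i; fin_cases i <;> simp <;> field_simp
    refine ⟨fun z => ψ₀ (z - z₀), fun i => ?_, ?_, ?_⟩
    · exact (hψa i).comp_of_eq (by fun_prop) (sub_self _)
    · simp only [sub_self]; rw [hψ0, φ_of_mem h]
    · have : Tendsto (fun z => z - z₀) (𝓝 z₀) (𝓝 0) := by
        have := (by fun_prop : Continuous fun z => z - z₀).tendsto z₀
        rwa [sub_self] at this
      filter_upwards [this.eventually hev] with z hz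
      have e := φ_periodic (z - z₀) h
      rw [sub_add_cancel] at e
      rwa [e]
  · refine ⟨fun z => ![2 * X z, 1 + Y z, 1 - Y z], fun i => ?_, (φ_of_notMem h).symm, ?_⟩
    · have hX : AnalyticAt ℂ X z₀ :=
        analyticAt_const.mul (hexPair.analyticOnNhd_weierstrassP z₀ h)
      have hY : AnalyticAt ℂ Y z₀ :=
        analyticAt_const.mul (hexPair.analyticOnNhd_derivWeierstrassP z₀ h)
      fin_cases i <;> simp <;> fun_prop
    · filter_upwards [isOpen_compl_hex.mem_nhds h] with z hz
      exact ⟨1, one_ne_zero, by rw [one_smul, φ_of_notMem hz]⟩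

/-- The point `φ z` is in the affine chart. -/
def Reg (z : ℂ) : Prop := φ z 2 ≠ 0
/-- First affine coordinate. -/
noncomputable def s (z : ℂ) : ℂ := φ z 0 / φ z 2
/-- Second affine coordinate. -/
noncomputable def t (z : ℂ) : ℂ := φ z 1 / φ z 2

lemma reg_zero : Reg 0 := by rw [Reg, φ_zero]; simp
lemma s_zero : s 0 = 0 := by rw [s, φ_zero]; simp
lemma t_zero : t 0 = -1 := by rw [t, φ_zero]; simp
lemma reg_of_mem {z : ℂ} (h : z ∈ Λ) : Reg z := by rw [Reg, φ_of_mem h]; simp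

lemma φ_eq {z : ℂ} (h : Reg z) : φ z = φ z 2 • ![s z, t z, 1] := by
  have : φ z 2 ≠ 0 := h
  ext i; fin_cases i <;> simp [s, t] <;> field_simp

lemma st_of_prop {z : ℂ} {v : Fin 3 → ℂ} {ρ : ℂ} (hρ : ρ ≠ 0) (h : φ z = ρ • v) :
    (Reg z ↔ v 2 ≠ 0) ∧ s z = v 0 / v 2 ∧ t z = v 1 / v 2 := by
  simp [Reg, s, t, h, hρ, mul_div_mul_left]

lemma curve {z : ℂ} (h : Reg z) : s z ^ 3 + t z ^ 3 + 1 = 0 := by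
  have h2 : φ z 2 ≠ 0 := h
  have := φ_curve z
  simp only [s, t]; field_simp; rw [mul_zero]; exact this

lemma s_per (z : ℂ) {l : ℂ} (hl : l ∈ Λ) : s (z + l) = s z := by rw [s, s, φ_periodic z hl]
lemma t_per (z : ℂ) {l : ℂ} (hl : l ∈ Λ) : t (z + l) = t z := by rw [t, t, φ_periodic z hl]
lemma s_omega (z : ℂ) : s (ω * z) = ω * s z := by
  rw [s, s, φ_omega]; simp [mul_div_assoc]
lemma t_omega (z : ℂ) : t (ω * z) = t z := by
  rw [t, t, φ_omega]; simp
lemma reg_omega (z : ℂ) : Reg (ω * z) ↔ Reg z := by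
  rw [Reg, Reg, φ_omega]; simp

lemma st_local {z₀ : ℂ} (h : Reg z₀) : AnalyticAt ℂ s z₀ ∧ AnalyticAt ℂ t z₀ := by
  obtain ⟨ψ, ha, h0, he⟩ := φ_local z₀
  have hne : ψ z₀ 2 ≠ 0 := by rw [h0]; exact h
  constructor
  · refine ((ha 0).div (ha 2) hne).congr ?_
    filter_upwards [he] with z hz
    obtain ⟨ρ, h1, h2⟩ := hz
    exact (st_of_prop h1 h2).2.1.symm
  · refine ((ha 1).div (ha 2) hne).congr ?_
    filter_upwards [he] with z hz
    obtain ⟨ρ, h1, h2⟩ := hz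
    exact (st_of_prop h1 h2).2.2.symm

lemma analyticAt_s {z₀ : ℂ} (h : Reg z₀) : AnalyticAt ℂ s z₀ := (st_local h).1
lemma analyticAt_t {z₀ : ℂ} (h : Reg z₀) : AnalyticAt ℂ t z₀ := (st_local h).2

lemma gen_notMem : Gen fun z => z ∉ Λ := by
  intro x
  filter_upwards [mem_nhdsWithin_of_mem_nhds (hexPair.compl_lattice_sdiff_singleton_mem_nhds x),
    self_mem_nhdsWithin] with z hz hz0 hz1
  exact hz ⟨hz1, hz0⟩

lemma gen_reg : Gen Reg := by
  intro x
  obtain ⟨ψ, ha, h0, he⟩ := φ_local x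
  rcases (ha 2).eventually_eq_zero_or_eventually_ne_zero with h | h
  · exfalso
    have h1 : ∀ᶠ z in 𝓝 x, ¬ Reg z := by
      filter_upwards [h, he] with z hz hz2
      obtain ⟨ρ, h1, h2⟩ := hz2
      rw [(st_of_prop h1 h2).1]; simpa using hz
    obtain ⟨y, hy, hyΛ⟩ := ((gen_notMem.frequently x).and_eventually h1.eventually_nhds).exists
    have h2 : Y =ᶠ[𝓝 y] fun _ => 1 := by
      filter_upwards [hyΛ, isOpen_compl_hex.mem_nhds hy] with z hz hz2
      rw [Reg, φ_of_notMem hz2] at hz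
      simp only [Matrix.cons_val, ne_eq, not_not] at hz
      linear_combination -hz
    have h3 := (hasDerivAt_Y hy).unique ((hasDerivAt_const y (1 : ℂ)).congr_of_eventuallyEq h2)
    have h4 := XY_rel hy
    have h5 : X y = 0 := by simpa [kc_ne] using h3
    rw [h5, h2.eq_of_nhds] at h4
    norm_num at h4
  · filter_upwards [h, eventually_nhdsWithin_of_eventually_nhds he] with z hz hz2
    obtain ⟨ρ, h1, h2⟩ := hz2
    rw [(st_of_prop h1 h2).1]; exact hz

lemma hasDerivAt_st_aux {z : ℂ} (h : Reg z) (hz : z ∉ Λ) :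
    HasDerivAt s (kc * t z ^ 2) z ∧ HasDerivAt t (-kc * s z ^ 2) z := by
  have es : ∀ w ∉ Λ, s w = 2 * X w / (1 - Y w) := fun w hw => by
    rw [s, φ_of_notMem hw]; simp
  have et : ∀ w ∉ Λ, t w = (1 + Y w) / (1 - Y w) := fun w hw => by
    rw [t, φ_of_notMem hw]; simp
  have hne : 1 - Y z ≠ 0 := by
    rw [Reg, φ_of_notMem hz] at h; simpa using h
  have hev : ∀ᶠ w in 𝓝 z, w ∉ Λ := isOpen_compl_hex.mem_nhds hz
  have d1 := ((hasDerivAt_X hz).const_mul 2).div ((hasDerivAt_Y hz).const_sub 1) hne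
  have d2 := ((hasDerivAt_Y hz).const_add 1).div ((hasDerivAt_Y hz).const_sub 1) hne
  constructor
  · refine (d1.congr_of_eventuallyEq (hev.mono es)).congr_deriv ?_
    rw [et z hz]; field_simp
    linear_combination (-kc) * XY_rel hz
  · refine (d2.congr_of_eventuallyEq (hev.mono et)).congr_deriv ?_
    rw [es z hz]; field_simp; ring

lemma hasDerivAt_s {z : ℂ} (h : Reg z) : HasDerivAt s (kc * t z ^ 2) z := by
  have h1 := (analyticAt_s h).differentiableAt.hasDerivAt
  have : deriv s z = kc * t z ^ 2 := by
    refine gen_eq_of_continuous (f := deriv s) (g := fun z => kc * t z ^ 2) ?_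
      (analyticAt_s h).deriv.continuousAt ((analyticAt_t h).continuousAt.pow 2 |>.const_mul _)
    exact (gen_reg.and gen_notMem).mono fun w hw => (hasDerivAt_st_aux hw.1 hw.2).1.deriv
  rwa [this] at h1

lemma hasDerivAt_t {z : ℂ} (h : Reg z) : HasDerivAt t (-kc * s z ^ 2) z := by
  have h1 := (analyticAt_t h).differentiableAt.hasDerivAt
  have : deriv t z = -kc * s z ^ 2 := by
    refine gen_eq_of_continuous (f := deriv t) (g := fun z => -kc * s z ^ 2) ?_
      (analyticAt_t h).deriv.continuousAt ((analyticAt_s h).continuousAt.pow 2 |>.const_mul _)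
    exact (gen_reg.and gen_notMem).mono fun w hw => (hasDerivAt_st_aux hw.1 hw.2).2.deriv
  rwa [this] at h1

lemma mem_of_st {z : ℂ} (h : Reg z) (ht : t z = -1) : z ∈ Λ := by
  by_contra hz
  have hne : 1 - Y z ≠ 0 := by
    rw [Reg, φ_of_notMem hz] at h; simpa using h
  rw [t, φ_of_notMem hz] at ht
  simp only [Matrix.cons_val_one, Matrix.cons_val, div_eq_iff hne] at ht
  have : (2 : ℂ) = 0 := by linear_combination ht
  norm_num at this

lemma gen_s_ne : Gen fun z => s z ≠ 0 := by
  intro x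
  obtain ⟨ψ, ha, h0, he⟩ := φ_local x
  rcases (ha 0).eventually_eq_zero_or_eventually_ne_zero with h | h
  · exfalso
    have h1 : ∀ᶠ z in 𝓝 x, s z = 0 := by
      filter_upwards [h, he] with z hz hz2
      obtain ⟨ρ, h1, h2⟩ := hz2
      rw [(st_of_prop h1 h2).2.1]; simp [hz]
    obtain ⟨y, hy, hy2⟩ := ((gen_reg.frequently x).and_eventually h1.eventually_nhds).exists
    have h3 := (hasDerivAt_s hy).unique ((hasDerivAt_const y (0 : ℂ)).congr_of_eventuallyEq hy2)
    have h4 : t y = 0 := by simpa [kc_ne] using h3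
    have h5 := curve hy
    rw [h4, hy2.self_of_nhds] at h5
    norm_num at h5
  · filter_upwards [h, eventually_nhdsWithin_of_eventually_nhds he, gen_reg x] with z hz hz2 hz3
    obtain ⟨ρ, h1, h2⟩ := hz2
    have := (st_of_prop h1 h2)
    rw [this.2.1]; exact div_ne_zero hz (this.1.1 hz3)

lemma gen_t_ne : Gen fun z => t z ≠ 0 := by
  intro x
  obtain ⟨ψ, ha, h0, he⟩ := φ_local x
  rcases (ha 1).eventually_eq_zero_or_eventually_ne_zero with h | h
  · exfalso
    have h1 : ∀ᶠ z in 𝓝 x, t z = 0 := by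
      filter_upwards [h, he] with z hz hz2
      obtain ⟨ρ, h1, h2⟩ := hz2
      rw [(st_of_prop h1 h2).2.2]; simp [hz]
    obtain ⟨y, hy, hy2⟩ := ((gen_reg.frequently x).and_eventually h1.eventually_nhds).exists
    have h3 := (hasDerivAt_t hy).unique ((hasDerivAt_const y (0 : ℂ)).congr_of_eventuallyEq hy2)
    have h4 : s y = 0 := by simpa [kc_ne] using h3
    have h5 := curve hy
    rw [h4, hy2.self_of_nhds] at h5
    norm_num at h5
  · filter_upwards [h, eventually_nhdsWithin_of_eventually_nhds he, gen_reg x] with z hz hz2 hz3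
    obtain ⟨ρ, h1, h2⟩ := hz2
    have := (st_of_prop h1 h2)
    rw [this.2.2]; exact div_ne_zero hz (this.1.1 hz3)

/-- Chord addition on the Fermat cubic. -/
def F1 {R : Type*} [CommRing R] (u v : Fin 3 → R) : Fin 3 → R :=
  ![u 0 ^ 2 * v 1 * v 2 - v 0 ^ 2 * u 1 * u 2, u 2 ^ 2 * v 0 * v 1 - v 2 ^ 2 * u 0 * u 1,
    u 1 ^ 2 * v 0 * v 2 - v 1 ^ 2 * u 0 * u 2]

/-- A second, complementary, addition formula. -/
def F2 {R : Type*} [CommRing R] (u v : Fin 3 → R) : Fin 3 → R :=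
  F1 ![u 1, u 2, u 0] ![v 2, v 0, v 1]

/-- Two functions with vanishing Wronskian are proportional. -/
lemma wronskian {V : ℂ → Prop} (hV : Gen V) {N D N' D' : ℂ → ℂ}
    (hN : ∀ z, V z → AnalyticAt ℂ N z) (hD : ∀ z, V z → AnalyticAt ℂ D z)
    (hN' : ∀ z, V z → HasDerivAt N (N' z) z) (hD' : ∀ z, V z → HasDerivAt D (D' z) z)
    (hW : ∀ z, V z → N' z * D z - N z * D' z = 0) {z₀ e : ℂ} (h0 : V z₀) (hD0 : D z₀ ≠ 0)
    (he : N z₀ = e * D z₀) : ∀ z, V z → N z = e * D z := by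
  have hev : ∀ᶠ z in 𝓝 z₀, V z ∧ D z ≠ 0 :=
    (show ∀ᶠ z in 𝓝 z₀, V z from hV.isOpen.mem_nhds h0).and ((hD z₀ h0).continuousAt.eventually_ne hD0)
  obtain ⟨r, hr, hball⟩ := Metric.eventually_nhds_iff_ball.1 hev
  have hd : ∀ z ∈ Metric.ball z₀ r, HasDerivAt (fun z => N z / D z) 0 z := fun z hz => by
    obtain ⟨h1, h2⟩ := hball z hz
    refine ((hN' z h1).div (hD' z h1) h2).congr_deriv ?_
    rw [hW z h1, zero_div]
  have hloc : N =ᶠ[𝓝 z₀] fun z => e * D z := by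
    filter_upwards [Metric.ball_mem_nhds z₀ hr] with z hz
    have h3 := Metric.isOpen_ball.is_const_of_deriv_eq_zero (Metric.isPreconnected_ball (x := z₀) (r := r))
      (fun z hz => (hd z hz).differentiableAt.differentiableWithinAt)
      (fun z hz => (hd z hz).deriv) hz (Metric.mem_ball_self hr)
    simp only [he, mul_div_cancel_right₀ _ hD0] at h3
    rw [← h3, div_mul_cancel₀ _ (hball z hz).2]
  exact AnalyticOnNhd.eqOn_of_preconnected_of_eventuallyEq (f := N) (g := fun z => e * D z)
    (U := {z | V z}) hN (fun z hz => analyticAt_const.mul (hD z hz)) hV.preconnected h0 hloc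

lemma gen_pair (k : ℂ) : Gen fun z => Reg z ∧ Reg (k - z) :=
  gen_reg.and (by simpa [sub_eq_neg_add] using gen_reg.comp (neg_ne_zero.2 one_ne_zero) k)

lemma hasDerivAt_s2 {k z : ℂ} (h : Reg (k - z)) :
    HasDerivAt (fun z => s (k - z)) (-(kc * t (k - z) ^ 2)) z :=
  (hasDerivAt_s h).comp_const_sub k z

lemma hasDerivAt_t2 {k z : ℂ} (h : Reg (k - z)) :
    HasDerivAt (fun z => t (k - z)) (-(-kc * s (k - z) ^ 2)) z :=
  (hasDerivAt_t h).comp_const_sub k z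

lemma analyticAt_s2 {k z : ℂ} (h : Reg (k - z)) : AnalyticAt ℂ (fun z => s (k - z)) z :=
  (analyticAt_s h).comp_of_eq (by fun_prop) rfl
lemma analyticAt_t2 {k z : ℂ} (h : Reg (k - z)) : AnalyticAt ℂ (fun z => t (k - z)) z :=
  (analyticAt_t h).comp_of_eq (by fun_prop) rfl

lemma add_F1_aux {k : ℂ} (hk : Reg k) (hs : s k ≠ 0) {z : ℂ} (hz : Reg z ∧ Reg (k - z)) :
    (s z ^ 2 * t (k - z) - s (k - z) ^ 2 * t z
      = s k * (t z ^ 2 * s (k - z) - t (k - z) ^ 2 * s z)) ∧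
    (s (k - z) * t (k - z) - s z * t z
      = t k * (t z ^ 2 * s (k - z) - t (k - z) ^ 2 * s z)) := by
  have hh : Reg 0 ∧ Reg (k - 0) := ⟨reg_zero, by simpa using hk⟩
  have d1 := fun z (h : Reg z ∧ Reg (k - z)) => hasDerivAt_s h.1
  have d2 := fun z (h : Reg z ∧ Reg (k - z)) => hasDerivAt_t h.1
  have d3 := fun z (h : Reg z ∧ Reg (k - z)) => hasDerivAt_s2 h.2
  have d4 := fun z (h : Reg z ∧ Reg (k - z)) => hasDerivAt_t2 h.2
  have a1 := fun z (h : Reg z ∧ Reg (k - z)) => analyticAt_s h.1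
  have a2 := fun z (h : Reg z ∧ Reg (k - z)) => analyticAt_t h.1
  have a3 := fun z (h : Reg z ∧ Reg (k - z)) => analyticAt_s2 h.2
  have a4 := fun z (h : Reg z ∧ Reg (k - z)) => analyticAt_t2 h.2
  constructor
  · refine wronskian (gen_pair k) (N := fun z => s z ^ 2 * t (k - z) - s (k - z) ^ 2 * t z)
      (D := fun z => t z ^ 2 * s (k - z) - t (k - z) ^ 2 * s z)
      (fun z h => (((a1 z h).pow 2).mul (a4 z h)).sub (((a3 z h).pow 2).mul (a2 z h)))
      (fun z h => (((a2 z h).pow 2).mul (a3 z h)).sub (((a4 z h).pow 2).mul (a1 z h)))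
      (fun z h => (((d1 z h).pow 2).mul (d4 z h)).sub (((d3 z h).pow 2).mul (d2 z h)))
      (fun z h => (((d2 z h).pow 2).mul (d3 z h)).sub (((d4 z h).pow 2).mul (d1 z h)))
      ?_ hh ?_ ?_ z hz
    · intro z h
      have c1 := curve h.1
      have c2 := curve h.2
      simp only [Pi.pow_apply]
      generalize s z = a at *
      generalize t z = b at *
      generalize s (k - z) = c at *
      generalize t (k - z) = d at *
      clear d1 d2 d3 d4 a1 a2 a3 a4
      grind
    · simpa [s_zero, t_zero] using hs
    · simp [s_zero, t_zero]; ring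
  · refine wronskian (gen_pair k) (N := fun z => s (k - z) * t (k - z) - s z * t z)
      (D := fun z => t z ^ 2 * s (k - z) - t (k - z) ^ 2 * s z)
      (fun z h => ((a3 z h).mul (a4 z h)).sub ((a1 z h).mul (a2 z h)))
      (fun z h => (((a2 z h).pow 2).mul (a3 z h)).sub (((a4 z h).pow 2).mul (a1 z h)))
      (fun z h => ((d3 z h).mul (d4 z h)).sub ((d1 z h).mul (d2 z h)))
      (fun z h => (((d2 z h).pow 2).mul (d3 z h)).sub (((d4 z h).pow 2).mul (d1 z h)))
      ?_ hh ?_ ?_ z hz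
    · intro z h
      have c1 := curve h.1
      have c2 := curve h.2
      simp only [Pi.pow_apply]
      generalize s z = a at *
      generalize t z = b at *
      generalize s (k - z) = c at *
      generalize t (k - z) = d at *
      clear d1 d2 d3 d4 a1 a2 a3 a4
      grind
    · simpa [s_zero, t_zero] using hs
    · simp [s_zero, t_zero]; ring

lemma add_F2_aux {k : ℂ} (hk : Reg k) (hs : t k ≠ 0) {z : ℂ} (hz : Reg z ∧ Reg (k - z)) :
    (t z ^ 2 * s (k - z) * t (k - z) - s z
      = s k * (t (k - z) - s z * t z * s (k - z) ^ 2)) ∧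
    (s z ^ 2 * s (k - z) - t (k - z) ^ 2 * t z
      = t k * (t (k - z) - s z * t z * s (k - z) ^ 2)) := by
  have hh : Reg 0 ∧ Reg (k - 0) := ⟨reg_zero, by simpa using hk⟩
  have d1 := fun z (h : Reg z ∧ Reg (k - z)) => hasDerivAt_s h.1
  have d2 := fun z (h : Reg z ∧ Reg (k - z)) => hasDerivAt_t h.1
  have d3 := fun z (h : Reg z ∧ Reg (k - z)) => hasDerivAt_s2 h.2
  have d4 := fun z (h : Reg z ∧ Reg (k - z)) => hasDerivAt_t2 h.2
  have a1 := fun z (h : Reg z ∧ Reg (k - z)) => analyticAt_s h.1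
  have a2 := fun z (h : Reg z ∧ Reg (k - z)) => analyticAt_t h.1
  have a3 := fun z (h : Reg z ∧ Reg (k - z)) => analyticAt_s2 h.2
  have a4 := fun z (h : Reg z ∧ Reg (k - z)) => analyticAt_t2 h.2
  constructor
  · refine wronskian (gen_pair k) (N := fun z => t z ^ 2 * s (k - z) * t (k - z) - s z)
      (D := fun z => t (k - z) - s z * t z * s (k - z) ^ 2)
      (fun z h => ((((a2 z h).pow 2).mul (a3 z h)).mul (a4 z h)).sub (a1 z h))
      (fun z h => (a4 z h).sub (((a1 z h).mul (a2 z h)).mul ((a3 z h).pow 2)))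
      (fun z h => ((((d2 z h).pow 2).mul (d3 z h)).mul (d4 z h)).sub (d1 z h))
      (fun z h => (d4 z h).sub (((d1 z h).mul (d2 z h)).mul ((d3 z h).pow 2)))
      ?_ hh ?_ ?_ z hz
    · intro z h
      have c1 := curve h.1
      have c2 := curve h.2
      simp only [Pi.pow_apply, Pi.mul_apply]
      generalize s z = a at *
      generalize t z = b at *
      generalize s (k - z) = c at *
      generalize t (k - z) = d at *
      clear d1 d2 d3 d4 a1 a2 a3 a4
      grind
    · simpa [s_zero, t_zero] using hs
    · simp [s_zero, t_zero]
  · refine wronskian (gen_pair k) (N := fun z => s z ^ 2 * s (k - z) - t (k - z) ^ 2 * t z)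
      (D := fun z => t (k - z) - s z * t z * s (k - z) ^ 2)
      (fun z h => (((a1 z h).pow 2).mul (a3 z h)).sub (((a4 z h).pow 2).mul (a2 z h)))
      (fun z h => (a4 z h).sub (((a1 z h).mul (a2 z h)).mul ((a3 z h).pow 2)))
      (fun z h => (((d1 z h).pow 2).mul (d3 z h)).sub (((d4 z h).pow 2).mul (d2 z h)))
      (fun z h => (d4 z h).sub (((d1 z h).mul (d2 z h)).mul ((d3 z h).pow 2)))
      ?_ hh ?_ ?_ z hz
    · intro z h
      have c1 := curve h.1
      have c2 := curve h.2
      simp only [Pi.pow_apply, Pi.mul_apply]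
      generalize s z = a at *
      generalize t z = b at *
      generalize s (k - z) = c at *
      generalize t (k - z) = d at *
      clear d1 d2 d3 d4 a1 a2 a3 a4
      grind
    · simpa [s_zero, t_zero] using hs
    · simp [s_zero, t_zero]; ring

/-- Two vectors are parallel. -/
def Cr {R : Type*} [CommRing R] (u v : Fin 3 → R) : Prop := ∀ i j, u i * v j = u j * v i

lemma Cr.symm {R : Type*} [CommRing R] {u v : Fin 3 → R} (h : Cr u v) : Cr v u := fun i j => by
  linear_combination h j i

lemma cr_refl {R : Type*} [CommRing R] (u : Fin 3 → R) : Cr u u := fun _ _ => mul_comm _ _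

lemma cr_smul_left {R : Type*} [CommRing R] [IsDomain R] {a : R} (ha : a ≠ 0) {u v : Fin 3 → R} :
    Cr (a • u) v ↔ Cr u v := by
  refine forall_congr' fun i => forall_congr' fun j => ?_
  simp only [Pi.smul_apply, smul_eq_mul, mul_assoc]
  exact ⟨fun h => mul_left_cancel₀ ha h, fun h => by rw [h]⟩

lemma cr_smul_right {R : Type*} [CommRing R] [IsDomain R] {a : R} (ha : a ≠ 0) {u v : Fin 3 → R} :
    Cr u (a • v) ↔ Cr u v :=
  ⟨fun h => ((cr_smul_left ha).1 h.symm).symm, fun h => ((cr_smul_left ha).2 h.symm).symm⟩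

lemma Cr.smul_self {R : Type*} [CommRing R] (a : R) (u : Fin 3 → R) : Cr (a • u) u := fun i j => by
  simp only [Pi.smul_apply, smul_eq_mul]; ring

lemma Cr.trans {R : Type*} [CommRing R] [IsDomain R] {u v w : Fin 3 → R} (h : Cr u v) (h' : Cr v w)
    (hv : v ≠ 0) : Cr u w := by
  obtain ⟨l, hl⟩ := Function.ne_iff.1 hv
  intro i j
  refine mul_left_cancel₀ (mul_ne_zero hl hl) ?_
  simp only [Pi.zero_apply] at hl
  have e1 := h i l; have e2 := h j l; have e3 := h' l j; have e4 := h' l i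
  calc v l * v l * (u i * w j) = (u i * v l) * (v l * w j) := by ring
    _ = (u l * v i) * (v j * w l) := by rw [e1, e3]
    _ = (u l * v j) * (v i * w l) := by ring
    _ = (u j * v l) * (v l * w i) := by rw [← e2, ← e4]
    _ = _ := by ring

lemma Cr.exists_smul {k : Type*} [Field k] {u v : Fin 3 → k} (h : Cr u v) (hu : u ≠ 0)
    (hv : v ≠ 0) : ∃ ρ : k, ρ ≠ 0 ∧ u = ρ • v := by
  obtain ⟨l, hl⟩ := Function.ne_iff.1 hv
  simp only [Pi.zero_apply] at hl
  have e : u = (u l / v l) • v := by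
    ext i; simp only [Pi.smul_apply, smul_eq_mul]; field_simp; exact h i l
  refine ⟨u l / v l, fun h0 => hu ?_, e⟩
  rw [e, h0, zero_smul]

/-- The point `w` is the sum of the points `u` and `v`. -/
def IsSum {R : Type*} [CommRing R] (u v w : Fin 3 → R) : Prop := Cr (F1 u v) w ∧ Cr (F2 u v) w

lemma F1_smul {R : Type*} [CommRing R] (a b : R) (u v : Fin 3 → R) :
    F1 (a • u) (b • v) = (a ^ 2 * b ^ 2) • F1 u v := by
  ext i; fin_cases i <;> simp [F1] <;> ring

lemma F2_smul {R : Type*} [CommRing R] (a b : R) (u v : Fin 3 → R) :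
    F2 (a • u) (b • v) = (a ^ 2 * b ^ 2) • F2 u v := by
  ext i; fin_cases i <;> simp [F1, F2] <;> ring

lemma isSum_smul {R : Type*} [CommRing R] [IsDomain R] {a b c : R} (ha : a ≠ 0) (hb : b ≠ 0)
    (hc : c ≠ 0) {u v w : Fin 3 → R} : IsSum (a • u) (b • v) (c • w) ↔ IsSum u v w := by
  have : a ^ 2 * b ^ 2 ≠ 0 := by positivity
  rw [IsSum, IsSum, F1_smul, F2_smul, cr_smul_right hc, cr_smul_right hc, cr_smul_left this,
    cr_smul_left this]

lemma F_ne_zero {k : Type*} [Field k] (h3 : (3 : k) ≠ 0) {u v : Fin 3 → k} (hu : u ≠ 0)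
    (hv : v ≠ 0) (cu : u 0 ^ 3 + u 1 ^ 3 + u 2 ^ 3 = 0) (cv : v 0 ^ 3 + v 1 ^ 3 + v 2 ^ 3 = 0) :
    F1 u v ≠ 0 ∨ F2 u v ≠ 0 := by
  by_contra! h
  obtain ⟨h1, h2⟩ := h
  have a0 := congrFun h1 0; have a1 := congrFun h1 1; have a2 := congrFun h1 2
  have b0 := congrFun h2 0; have b1 := congrFun h2 1; have b2 := congrFun h2 2
  have hu' : ¬ (u 0 = 0 ∧ u 1 = 0 ∧ u 2 = 0) := fun h => hu (by
    ext i; fin_cases i; exacts [h.1, h.2.1, h.2.2])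
  have hv' : ¬ (v 0 = 0 ∧ v 1 = 0 ∧ v 2 = 0) := fun h => hv (by
    ext i; fin_cases i; exacts [h.1, h.2.1, h.2.2])
  simp [F1, F2] at a0 a1 a2 b0 b1 b2
  generalize u 0 = x at *
  generalize u 1 = y at *
  generalize u 2 = z at *
  generalize v 0 = X at *
  generalize v 1 = Y at *
  generalize v 2 = Z at *
  clear h1 h2 hu hv
  have no_zero : x ≠ 0 ∧ y ≠ 0 ∧ z ≠ 0 ∧ X ≠ 0 ∧ Y ≠ 0 ∧ Z ≠ 0 := by
    refine ⟨?_, ?_, ?_, ?_, ?_, ?_⟩ <;> rintro rfl <;> grind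
  obtain ⟨n1, n2, n3, n4, n5, n6⟩ := no_zero
  have e1 : Y ^ 3 = X ^ 3 := by
    refine mul_left_cancel₀ (mul_ne_zero (pow_ne_zero 2 n1) n6) ?_
    grind
  have e2 : Z ^ 3 = X ^ 3 := by
    refine mul_left_cancel₀ (mul_ne_zero (pow_ne_zero 2 n3) n5) ?_
    grind
  have : 3 * X ^ 3 = 0 := by linear_combination cv - e1 - e2
  simp [h3, n4] at this

lemma isSum_φ_aux {F : (Fin 3 → ℂ) → (Fin 3 → ℂ) → (Fin 3 → ℂ)}
    (hF : ∀ (a b : ℂ) (u v : Fin 3 → ℂ), F (a • u) (b • v) = (a ^ 2 * b ^ 2) • F u v)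
    (hc : ∀ i, Continuous fun q : (Fin 3 → ℂ) × (Fin 3 → ℂ) => F q.1 q.2 i)
    (hk : ∀ k, Reg k → s k ≠ 0 → t k ≠ 0 → ∀ z, Reg z ∧ Reg (k - z) →
      Cr (F ![s z, t z, 1] ![s (k - z), t (k - z), 1]) ![s k, t k, 1]) (z w : ℂ) :
    Cr (F (φ z) (φ w)) (φ (z + w)) := by
  obtain ⟨ψ, ha, h0, he⟩ := φ_local z
  obtain ⟨ψ', ha', h0', he'⟩ := φ_local w
  obtain ⟨ψ₂, ha₂, h0₂, he₂⟩ := φ_local (z + w)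
  have l1 : Tendsto (fun e : ℂ => z + e) (𝓝 0) (𝓝 z) := by
    simpa using (by fun_prop : Continuous fun e : ℂ => z + e).tendsto 0
  have l2 : Tendsto (fun e : ℂ => w + e) (𝓝 0) (𝓝 w) := by
    simpa using (by fun_prop : Continuous fun e : ℂ => w + e).tendsto 0
  have l3 : Tendsto (fun e : ℂ => 2 * e + (z + w)) (𝓝 0) (𝓝 (z + w)) := by
    simpa using (by fun_prop : Continuous fun e : ℂ => 2 * e + (z + w)).tendsto 0
  have g := (((gen_reg.and (gen_s_ne.and gen_t_ne)).comp two_ne_zero (z + w)).and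
    ((gen_reg.shift z).and (gen_reg.shift w))).frequently 0
  have g' := g.and_eventually ((l1.eventually he).and ((l2.eventually he').and (l3.eventually he₂)))
  have key : ∃ᶠ e in 𝓝 (0 : ℂ),
      Cr (F (ψ (z + e)) (ψ' (w + e))) (ψ₂ (2 * e + (z + w))) := by
    refine g'.mono ?_
    rintro e ⟨⟨⟨k1, k2, k3⟩, k4, k5⟩, ⟨ρ, p1, p2⟩, ⟨ρ', p1', p2'⟩, ⟨ρ₂, p3, p4⟩⟩
    have e1 : 2 * e + (z + w) - (e + z) = e + w := by ring
    have := hk _ k1 k2 k3 (e + z) ⟨k4, by rwa [e1]⟩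
    rw [e1] at this
    have q1 := φ_eq k4; have q2 := φ_eq k5; have q3 := φ_eq k1
    have r : Cr (F (φ (e + z)) (φ (e + w))) (φ (2 * e + (z + w))) := by
      rw [q1, q2, q3, hF, cr_smul_right k1, cr_smul_left]
      · exact this
      · exact mul_ne_zero (pow_ne_zero 2 k4) (pow_ne_zero 2 k5)
    rw [add_comm e z, add_comm e w, p2, p2', p4, hF, cr_smul_right p3, cr_smul_left] at r
    · exact r
    · exact mul_ne_zero (pow_ne_zero 2 p1) (pow_ne_zero 2 p1')
  have c1 : Tendsto (fun e => ψ (z + e)) (𝓝 0) (𝓝 (φ z)) := by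
    rw [← h0]; exact (tendsto_pi_nhds.2 fun i => (ha i).continuousAt).comp l1
  have c2 : Tendsto (fun e => ψ' (w + e)) (𝓝 0) (𝓝 (φ w)) := by
    rw [← h0']; exact (tendsto_pi_nhds.2 fun i => (ha' i).continuousAt).comp l2
  have c3 : Tendsto (fun e => ψ₂ (2 * e + (z + w))) (𝓝 0) (𝓝 (φ (z + w))) := by
    rw [← h0₂]; exact (tendsto_pi_nhds.2 fun i => (ha₂ i).continuousAt).comp l3
  have c4 : ∀ i, Tendsto (fun e => F (ψ (z + e)) (ψ' (w + e)) i) (𝓝 0) (𝓝 (F (φ z) (φ w) i)) :=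
    fun i => ((hc i).tendsto (φ z, φ w)).comp (c1.prodMk_nhds c2)
  intro i j
  exact tendsto_nhds_unique_of_frequently_eq ((c4 i).mul (tendsto_pi_nhds.1 c3 j))
    ((c4 j).mul (tendsto_pi_nhds.1 c3 i)) (key.mono fun e h => h i j)

lemma isSum_φ (z w : ℂ) : IsSum (φ z) (φ w) (φ (z + w)) := by
  constructor
  · refine isSum_φ_aux F1_smul ?_ ?_ z w
    · intro i; fin_cases i <;> simp [F1] <;> fun_prop
    · intro k k1 k2 k3 z hz
      obtain ⟨e1, e2⟩ := add_F1_aux k1 k2 hz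
      have : F1 ![s z, t z, 1] ![s (k - z), t (k - z), 1] =
        (t z ^ 2 * s (k - z) - t (k - z) ^ 2 * s z) • ![s k, t k, 1] := by
        ext i; fin_cases i
        · simp [F1]; linear_combination e1
        · simp [F1]; linear_combination e2
        · simp [F1]
      rw [this]; exact Cr.smul_self _ _
  · refine isSum_φ_aux F2_smul ?_ ?_ z w
    · intro i; fin_cases i <;> simp [F2, F1] <;> fun_prop
    · intro k k1 k2 k3 z hz
      obtain ⟨e1, e2⟩ := add_F2_aux k1 k3 hz
      have : F2 ![s z, t z, 1] ![s (k - z), t (k - z), 1] =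
        (t (k - z) - s z * t z * s (k - z) ^ 2) • ![s k, t k, 1] := by
        ext i; fin_cases i
        · simp [F2, F1]; linear_combination e1
        · simp [F2, F1]; linear_combination e2
        · simp [F2, F1]; ring
      rw [this]; exact Cr.smul_self _ _

lemma IsSum.unique {k : Type*} [Field k] (h3 : (3 : k) ≠ 0) {u v w w' : Fin 3 → k} (hu : u ≠ 0)
    (hv : v ≠ 0) (cu : u 0 ^ 3 + u 1 ^ 3 + u 2 ^ 3 = 0) (cv : v 0 ^ 3 + v 1 ^ 3 + v 2 ^ 3 = 0)
    (h : IsSum u v w) (h' : IsSum u v w') : Cr w w' := by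
  rcases F_ne_zero h3 hu hv cu cv with h0 | h0
  · exact h.1.symm.trans h'.1 h0
  · exact h.2.symm.trans h'.2 h0

lemma φ_add_of {z w : ℂ} {v : Fin 3 → ℂ} (h : IsSum (φ z) (φ w) v) : Cr (φ (z + w)) v :=
  (isSum_φ z w).unique three_ne_zero (φ_ne_zero _) (φ_ne_zero _) (φ_curve _) (φ_curve _) h

lemma φ_cr {z w : ℂ} : Cr (φ z) (φ w) ↔ z - w ∈ Λ := by
  constructor
  · intro h
    obtain ⟨ρ, h0, h1⟩ := h.exists_smul (φ_ne_zero _) (φ_ne_zero _)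
    have e1 := isSum_φ w (-w)
    rw [add_neg_cancel] at e1
    have e2 := isSum_φ z (-w)
    have e3 : IsSum (φ z) (φ (-w)) (φ 0) := by
      rw [h1]
      have := (isSum_smul h0 one_ne_zero one_ne_zero).2 e1
      simpa using this
    have e4 := φ_add_of e3
    rw [← sub_eq_add_neg, φ_zero] at e4
    have p1 := e4 1 2
    have p2 := e4 0 1
    have p3 := e4 0 2
    simp at p1 p2 p3
    have n2 : φ (z - w) 2 ≠ 0 := by
      intro h; apply φ_ne_zero (z - w)
      ext i; fin_cases i
      · exact p2
      · simp [h] at p1; exact p1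
      · exact h
    refine mem_of_st n2 ?_
    rw [t, div_eq_iff n2]; linear_combination -p1
  · intro h
    have := φ_periodic w h
    rw [add_sub_cancel] at this
    rw [this]; exact cr_refl _

lemma st_of_cr {z : ℂ} {v : Fin 3 → ℂ} (hv : v ≠ 0) (h : Cr (φ z) v) :
    (Reg z ↔ v 2 ≠ 0) ∧ s z = v 0 / v 2 ∧ t z = v 1 / v 2 := by
  obtain ⟨ρ, h0, h1⟩ := h.exists_smul (φ_ne_zero _) hv
  exact st_of_prop h0 h1

lemma omega_pow_four : ω ^ 4 = ω := by rw [pow_succ, omega_cube, one_mul]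

lemma omega_sq_ne_one : ω ^ 2 ≠ 1 := fun h => omega_ne_one (by
  have := omega_cube; rw [pow_succ, h, one_mul] at this; exact this)

lemma cube_root_cases {a : ℂ} (h : a ^ 3 = 1) : a = 1 ∨ a = ω ∨ a = ω ^ 2 := by
  have : (a - 1) * ((a - ω) * (a - ω ^ 2)) = 0 := by
    have := omega_sq
    grind
  rcases mul_eq_zero.1 this with h | h
  · exact Or.inl (sub_eq_zero.1 h)
  · rcases mul_eq_zero.1 h with h | h
    · exact Or.inr (Or.inl (sub_eq_zero.1 h))
    · exact Or.inr (Or.inr (sub_eq_zero.1 h))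

lemma exists_D : ∃ D : ℂ, Reg D ∧ s D = 0 ∧ t D = -ω ^ 2 ∧ 3 * D ∈ Λ ∧ ω * D - D ∈ Λ := by
  have hn : 1 - ω ≠ 0 := sub_ne_zero.2 omega_ne_one.symm
  have key : ∀ e : ℂ, (1 - ω) * e ∈ Λ → e ∉ Λ → Reg e ∧ s e = 0 ∧ t e ^ 3 = -1 ∧ t e ≠ -1 := by
    intro e h1 h2
    have e1 := φ_periodic e (neg_mem h1)
    rw [show e + -((1 - ω) * e) = ω * e by ring, φ_omega] at e1
    have e2 : φ e 0 = 0 := by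
      have := congrFun e1 0
      simp at this
      exact (mul_eq_right₀ · |>.1 this |> omega_ne_one |>.elim) |> by_contra
    have hr : Reg e := fun h => by
      have := φ_curve e
      rw [e2, h] at this
      apply φ_ne_zero e
      ext i; fin_cases i
      · exact e2
      · simpa using this
      · exact h
    have hs : s e = 0 := by rw [s, e2, zero_div]
    have := curve hr
    rw [hs] at this
    exact ⟨hr, hs, by linear_combination this, fun h => h2 (mem_of_st hr h)⟩
  have h1 : (1 - ω) * (1 - ω)⁻¹ ∈ Λ := by rw [mul_inv_cancel₀ hn]; exact one_mem_hex
  have h2 : (1 - ω)⁻¹ ∉ Λ := by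
    intro h
    have : (1 - ω) ⁻¹ = (1 - ω ^ 2) / 3 := by
      have w := omega_sq
      field_simp; grind
    rw [this, mem_hex] at h
    obtain ⟨m, n, h⟩ := h
    have h4 : ((3 * m - 2 : ℤ) : ℂ) + ((3 * n - 1 : ℤ) : ℂ) * ω = 0 := by
      push_cast; linear_combination 3 * h - omega_sq
    have h5 := congrArg Complex.im h4
    simp only [Complex.add_im, Complex.intCast_im, Complex.mul_im, Complex.intCast_re, zero_mul,
      add_zero, zero_add, Complex.zero_im, mul_eq_zero, omega_im_ne_zero, or_false,
      Int.cast_eq_zero] at h5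
    omega
  set e := (1 - ω)⁻¹
  have h3e : ∀ e : ℂ, (1 - ω) * e ∈ Λ → 3 * e ∈ Λ := fun e he => by
    have : 3 * e = (1 - ω) * e - ω ^ 2 * ((1 - ω) * e) := by
      have := omega_sq
      grind
    rw [this, pow_two, mul_assoc]
    exact sub_mem he (omega_mul_mem_hex.2 (omega_mul_mem_hex.2 he))
  obtain ⟨k1, k2, k3, k4⟩ := key e h1 h2
  have : (-t e) ^ 3 = 1 := by linear_combination -k3
  rcases cube_root_cases this with h | h | h
  · exact absurd (by linear_combination -h) k4
  · have h1' : (1 - ω) * -e ∈ Λ := by rw [mul_neg]; exact neg_mem h1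
    obtain ⟨l1, l2, l3, l4⟩ := key (-e) h1' (mt neg_mem_iff.1 h2)
    refine ⟨-e, l1, l2, ?_, h3e _ h1', ?_⟩
    · obtain ⟨ρ, r1, r2⟩ := φ_neg e
      rw [(st_of_prop r1 r2).2.2]
      rw [t, neg_eq_iff_eq_neg, div_eq_iff k1] at h
      simp only [Matrix.cons_val_one, Matrix.cons_val]
      rw [h]
      have := omega_ne_zero
      have := k1
      unfold Reg at this
      field_simp
      linear_combination omega_cube
    · have := neg_mem h1'; rwa [← neg_mul, neg_sub, sub_one_mul] at this
  · exact ⟨e, k1, k2, by linear_combination -h, h3e _ h1, by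
      have := neg_mem h1; rwa [← neg_mul, neg_sub, sub_one_mul] at this⟩

/-- The flex `(0 : 1 : -ω)`. -/
noncomputable def D : ℂ := exists_D.choose
lemma reg_D : Reg D := exists_D.choose_spec.1
lemma s_D : s D = 0 := exists_D.choose_spec.2.1
lemma t_D : t D = -ω ^ 2 := exists_D.choose_spec.2.2.1
lemma three_D : 3 * D ∈ Λ := exists_D.choose_spec.2.2.2.1
lemma omega_D : ω * D - D ∈ Λ := exists_D.choose_spec.2.2.2.2

lemma cr_add_D (z : ℂ) : Cr (φ (z + D)) ![ω * φ z 0, ω ^ 2 * φ z 1, φ z 2] := by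
  apply φ_add_of
  have e := φ_eq reg_D
  rw [s_D, t_D] at e
  have c := φ_curve z
  have w := omega_sq
  rw [e, ← one_smul ℂ (φ z), ← one_smul ℂ ![ω * _, _, _], isSum_smul one_ne_zero reg_D one_ne_zero]
  constructor
  · intro i j
    fin_cases i <;> fin_cases j <;> simp [F1] <;> grind
  · intro i j
    fin_cases i <;> fin_cases j <;> simp [F2, F1] <;> grind

lemma omega_vec_ne (z : ℂ) : ![ω * φ z 0, ω ^ 2 * φ z 1, φ z 2] ≠ 0 := by
  intro h
  apply φ_ne_zero z
  have h0 := congrFun h 0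
  have h1 := congrFun h 1
  have h2 := congrFun h 2
  simp [omega_ne_zero] at h0 h1 h2
  ext i; fin_cases i <;> assumption

lemma reg_add_D (z : ℂ) : Reg (z + D) ↔ Reg z := by
  exact (st_of_cr (omega_vec_ne z) (cr_add_D z)).1
lemma s_add_D (z : ℂ) : s (z + D) = ω * s z := by
  have := (st_of_cr (omega_vec_ne z) (cr_add_D z)).2.1
  rw [this, s]; simp [mul_div_assoc]
lemma t_add_D (z : ℂ) : t (z + D) = ω ^ 2 * t z := by
  have := (st_of_cr (omega_vec_ne z) (cr_add_D z)).2.2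
  rw [this, t]; simp [mul_div_assoc]

lemma xy_ne_of_not_reg {z : ℂ} (h : ¬ Reg z) : φ z 0 ≠ 0 ∧ φ z 1 ≠ 0 := by
  rw [Reg, not_not] at h
  have c := φ_curve z
  rw [h] at c
  constructor <;> intro h' <;> apply φ_ne_zero z <;> ext i <;> fin_cases i <;> simp_all

lemma exists_s (a : ℂ) : ∃ z, Reg z ∧ s z = a := by
  by_contra! hcon
  obtain ⟨k, hk⟩ := liouville (q := fun z => 1 / (s z - a)) (fun z₀ => by
    by_cases h : Reg z₀
    · exact ext_of_div analyticAt_const ((analyticAt_s h).sub analyticAt_const)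
        (sub_ne_zero.2 (hcon _ h))
    · obtain ⟨ψ, ha, h0, he⟩ := φ_local z₀
      have h1 : ψ z₀ 0 ≠ 0 := by rw [h0]; exact (xy_ne_of_not_reg h).1
      have h2 : ψ z₀ 2 = 0 := by rw [h0]; exact not_not.1 h
      refine (ext_of_div (N := fun z => ψ z 2) (D := fun z => ψ z 0 - a * ψ z 2) (ha 2)
        ((ha 0).sub (analyticAt_const.mul (ha 2))) (by simp [h1, h2])).congr ?_
      filter_upwards [gen_reg z₀, eventually_nhdsWithin_of_eventually_nhds he] with z hz hz2
      obtain ⟨ρ, r1, r2⟩ := hz2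
      obtain ⟨q1, q2, -⟩ := st_of_prop r1 r2
      have := q1.1 hz
      have h3 := sub_ne_zero.2 (hcon _ hz)
      rw [q2] at h3 ⊢
      rw [div_sub' this, mul_comm (ψ z 2) a, one_div_div]) (fun z l hl => by rw [s_per z hl])
  have hs : Gen fun z => s z = 1 / k + a := (hk.and gen_reg).mono fun z hz => by
    have h3 := sub_ne_zero.2 (hcon _ hz.2)
    rw [← hz.1, one_div_one_div]; ring
  obtain ⟨y, ⟨hy, hyt⟩, hys⟩ := ((gen_reg.and gen_t_ne).and hs).exists
  have h2 := hs.isOpen.mem_nhds hys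
  have h3 := (hasDerivAt_s hy).unique
    ((hasDerivAt_const y (1 / k + a)).congr_of_eventuallyEq h2)
  simp [kc_ne, hyt] at h3

lemma exists_st {a b : ℂ} (h : a ^ 3 + b ^ 3 + 1 = 0) : ∃ z, Reg z ∧ s z = a ∧ t z = b := by
  obtain ⟨z, hz, rfl⟩ := exists_s a
  have c := curve hz
  by_cases hb : b = 0
  · subst hb
    exact ⟨z, hz, rfl, by simpa using (by linear_combination c - h : t z ^ 3 = 0)⟩
  · have : (t z / b) ^ 3 = 1 := by rw [div_pow, div_eq_one_iff_eq (pow_ne_zero 3 hb)]; linear_combination c - h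
    rcases cube_root_cases this with h1 | h1 | h1 <;> rw [div_eq_iff hb] at h1
    · exact ⟨z, hz, rfl, by rw [h1, one_mul]⟩
    · obtain ⟨z', hz', hs', ht'⟩ : ∃ z', Reg z' ∧ s z' = s z ∧ t z' = ω ^ 2 * t z := by
        refine ⟨ω * (ω * (z + D)), ?_, ?_, ?_⟩
        · rw [reg_omega, reg_omega, reg_add_D]; exact hz
        · rw [s_omega, s_omega, s_add_D]; linear_combination s z * omega_cube
        · rw [t_omega, t_omega, t_add_D]
      exact ⟨z', hz', hs', by rw [ht', h1]; linear_combination b * omega_cube⟩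
    · obtain ⟨z', hz', hs', ht'⟩ : ∃ z', Reg z' ∧ s z' = s z ∧ t z' = ω * t z := by
        refine ⟨ω * (z + D + D), ?_, ?_, ?_⟩
        · rw [reg_omega, reg_add_D, reg_add_D]; exact hz
        · rw [s_omega, s_add_D, s_add_D]; linear_combination s z * omega_cube
        · rw [t_omega, t_add_D, t_add_D]; linear_combination t z * omega_pow_four
      exact ⟨z', hz', hs', by rw [ht', h1]; linear_combination b * omega_cube⟩

lemma exists_T : ∃ z, Reg z ∧ s z = -1 ∧ t z = 0 := exists_st (by norm_num)

/-- The flex `(-1 : 0 : 1)`. -/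
noncomputable def T : ℂ := exists_T.choose
lemma reg_T : Reg T := exists_T.choose_spec.1
lemma s_T : s T = -1 := exists_T.choose_spec.2.1
lemma t_T : t T = 0 := exists_T.choose_spec.2.2

lemma cr_add_T (z : ℂ) : Cr (φ (z + T)) ![φ z 2, φ z 0, φ z 1] := by
  apply φ_add_of
  have e := φ_eq reg_T
  rw [s_T, t_T] at e
  have c := φ_curve z
  have e' := isSum_smul (u := φ z) (v := ![-1, 0, 1]) (w := ![φ z 2, φ z 0, φ z 1]) one_ne_zero
    reg_T one_ne_zero
  rw [one_smul, one_smul] at e'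
  rw [e, e']
  constructor
  · intro i j
    fin_cases i <;> fin_cases j <;> simp [F1] <;> grind
  · intro i j
    fin_cases i <;> fin_cases j <;> simp [F2, F1] <;> grind

lemma cyc_ne {v : Fin 3 → ℂ} (hv : v ≠ 0) : ![v 2, v 0, v 1] ≠ 0 := by
  intro h
  apply hv
  have h0 := congrFun h 0
  have h1 := congrFun h 1
  have h2 := congrFun h 2
  simp at h0 h1 h2
  ext i; fin_cases i <;> assumption

lemma φ_add_T (z : ℂ) : ∃ ρ : ℂ, ρ ≠ 0 ∧ φ (z + T) = ρ • ![φ z 2, φ z 0, φ z 1] :=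
  (cr_add_T z).exists_smul (φ_ne_zero _) (cyc_ne (φ_ne_zero _))

lemma φ_add_D (z : ℂ) : ∃ ρ : ℂ, ρ ≠ 0 ∧ φ (z + D) = ρ • ![ω * φ z 0, ω ^ 2 * φ z 1, φ z 2] :=
  (cr_add_D z).exists_smul (φ_ne_zero _) (omega_vec_ne z)

lemma three_T : 3 * T ∈ Λ := by
  obtain ⟨a, ha, h1⟩ := φ_add_T 0
  obtain ⟨b, hb, h2⟩ := φ_add_T (0 + T)
  obtain ⟨c, hc, h3⟩ := φ_add_T (0 + T + T)
  have : Cr (φ (0 + T + T + T)) (φ 0) := by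
    rw [h3, h2, h1, cr_smul_left hc, φ_zero]
    intro i j; fin_cases i <;> fin_cases j <;> simp
  rw [φ_cr] at this
  convert this using 1; ring

lemma exists_D_of_s_zero {z : ℂ} (h : φ z 0 = 0) : ∃ n : ℕ, z - n * D ∈ Λ := by
  have hr : Reg z := fun h' => (xy_ne_of_not_reg (not_not.2 h')).1 h
  have hs : s z = 0 := by rw [s, h, zero_div]
  have c := curve hr
  rw [hs] at c
  have e0 := φ_eq reg_zero
  have eD := φ_eq reg_D
  have eD2 := φ_eq ((reg_add_D D).2 reg_D)
  have : (-t z) ^ 3 = 1 := by linear_combination -c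
  have e := φ_eq hr
  have r2 := (reg_add_D D).2 reg_D
  rw [hs] at e
  rcases cube_root_cases this with h | h | h
  · exact ⟨0, by simpa using mem_of_st hr (by linear_combination -h)⟩
  · refine ⟨2, ?_⟩
    have : Cr (φ z) (φ (D + D)) := by
      rw [e, eD2, cr_smul_left hr, cr_smul_right r2, s_add_D, t_add_D, s_D, t_D]
      have : t z = ω ^ 2 * - ω ^ 2 := by linear_combination -h + omega_pow_four
      rw [this, mul_zero]; exact cr_refl _
    rw [φ_cr] at this
    convert this using 1; push_cast; ring
  · refine ⟨1, ?_⟩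
    have : Cr (φ z) (φ D) := by
      rw [e, eD, cr_smul_left hr, cr_smul_right reg_D, s_D, t_D, ← h, neg_neg]
      exact cr_refl _
    rw [φ_cr] at this
    simpa using this

lemma three_mul_mem_of_flex {z : ℂ} (h : φ z 0 * φ z 1 * φ z 2 = 0) : 3 * z ∈ Λ := by
  have key : ∀ z, φ z 0 = 0 → 3 * z ∈ Λ := fun z hz => by
    obtain ⟨n, hn⟩ := exists_D_of_s_zero hz
    have h1 : 3 * (z - n * D) ∈ Λ := by
      have := mul_mem_hex (by simpa using intCast_mem_hex 3) hn
      simpa using this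
    have h2 : n * (3 * D) ∈ Λ := by
      have := mul_mem_hex (by simpa using intCast_mem_hex n) three_D
      simpa using this
    convert add_mem h1 h2 using 1; ring
  rcases mul_eq_zero.1 h with h | h
  · rcases mul_eq_zero.1 h with h | h
    · exact key z h
    · obtain ⟨ρ, r1, r2⟩ := φ_add_T z
      obtain ⟨ρ', r1', r2'⟩ := φ_add_T (z + T)
      have := key (z + T + T) (by rw [r2', r2]; simp [h])
      convert sub_mem (sub_mem this three_T) three_T using 1; ring
  · obtain ⟨ρ, r1, r2⟩ := φ_add_T z
    have := key (z + T) (by rw [r2]; simp [h])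
    convert sub_mem this three_T using 1; ring

/-- The coordinates of multiplication by `ω² - ω`. -/
noncomputable def hvec (u : Fin 3 → ℂ) : Fin 3 → ℂ :=
  ![-3 * u 0 * u 1 * u 2, u 0 ^ 3 + ω * u 1 ^ 3 + ω ^ 2 * u 2 ^ 3,
    u 0 ^ 3 + ω ^ 2 * u 1 ^ 3 + ω * u 2 ^ 3]

lemma hvec_ne {u : Fin 3 → ℂ} (hu : u ≠ 0) (c : u 0 ^ 3 + u 1 ^ 3 + u 2 ^ 3 = 0) : hvec u ≠ 0 := by
  intro h
  have h1 := congrFun h 1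
  have h2 := congrFun h 2
  simp [hvec] at h1 h2
  have e0 : u 0 ^ 3 = 0 := by
    linear_combination (1 / 3) * (c + h1 + h2) - (1 / 3) * (u 1 ^ 3 + u 2 ^ 3) * omega_sq
  have e1 : u 1 ^ 3 = 0 := by
    linear_combination (1 / 3) * (c + ω ^ 2 * h1 + ω * h2) - (1/3) * (u 0 ^ 3 +  u 2 ^ 3 * (ω ^ 2 - ω + 1)) * omega_sq - (2/3) * (u 1 ^ 3 )  * omega_cube
  have e2 : u 2 ^ 3 = 0 := by linear_combination c - e0 - e1
  apply hu
  ext i; fin_cases i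
  · simpa using e0
  · simpa using e1
  · simpa using e2

lemma φ_h (z : ℂ) : ∃ ρ : ℂ, ρ ≠ 0 ∧ φ ((ω ^ 2 - ω) * z) = ρ • hvec (φ z) := by
  refine Cr.exists_smul ?_ (φ_ne_zero _) (hvec_ne (φ_ne_zero _) (φ_curve _))
  have e : (ω ^ 2 - ω) * z = ω * (ω * z) + -(ω * z) := by ring
  rw [e]
  apply φ_add_of
  obtain ⟨ρ, r1, r2⟩ := φ_neg (ω * z)
  have c := φ_curve z
  have w := omega_sq
  rw [r2, φ_omega, φ_omega, ← one_smul ℂ (hvec _), ← one_smul ℂ ![ω * _, _, _],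
    isSum_smul one_ne_zero r1 one_ne_zero]
  constructor
  · intro i j
    fin_cases i <;> fin_cases j <;> simp [F1, hvec] <;> grind
  · intro i j
    fin_cases i <;> fin_cases j <;> simp [F2, F1, hvec] <;> grind

lemma s_add_T (z : ℂ) : s (z + T) = (t z)⁻¹ := by
  obtain ⟨ρ, r1, r2⟩ := φ_add_T z
  rw [(st_of_prop r1 r2).2.1, t]; simp
lemma t_add_T {z : ℂ} (h : Reg z) : t (z + T) = s z / t z := by
  obtain ⟨ρ, r1, r2⟩ := φ_add_T z
  have : φ z 2 ≠ 0 := h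
  rw [(st_of_prop r1 r2).2.2, s, t]; simp; field_simp

/-- `φ z` is not a flex. -/
def NF (z : ℂ) : Prop := φ z 0 * φ z 1 * φ z 2 ≠ 0

lemma NF.reg {z : ℂ} (h : NF z) : Reg z := right_ne_zero_of_mul h
lemma NF.s_ne {z : ℂ} (h : NF z) : s z ≠ 0 :=
  div_ne_zero (left_ne_zero_of_mul (left_ne_zero_of_mul h)) h.reg
lemma NF.t_ne {z : ℂ} (h : NF z) : t z ≠ 0 :=
  div_ne_zero (right_ne_zero_of_mul (left_ne_zero_of_mul h)) h.reg

lemma gen_NF : Gen NF := ((gen_reg.and gen_s_ne).and gen_t_ne).mono fun z h =>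
  mul_ne_zero (mul_ne_zero (left_ne_zero_of_mul (b := (φ z 2)⁻¹) h.1.2)
    (left_ne_zero_of_mul (b := (φ z 2)⁻¹) h.2)) h.1.1

lemma NF.lin {z : ℂ} (h : NF z) {a b : ℂ} (ha : a ^ 3 = 1) (hb : b ^ 3 = 1) :
    a * s z + b * t z + 1 ≠ 0 := by
  intro e
  have c := curve h.reg
  have : 3 * (a * b) * (s z * t z) = 0 := by
    grind
  have h1 : a ≠ 0 := by rintro rfl; norm_num at ha
  have h2 : b ≠ 0 := by rintro rfl; norm_num at hb
  simp [h1, h2, h.s_ne, h.t_ne] at this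

lemma exists_flex {z : ℂ} (h : ¬ NF z) : ∃ m n : ℕ, z + m * T + n * D ∈ Λ := by
  rw [NF, not_not] at h
  have key : ∀ z, φ z 0 = 0 → ∃ n : ℕ, z + n * D ∈ Λ := fun z hz => by
    obtain ⟨n, hn⟩ := exists_D_of_s_zero hz
    refine ⟨2 * n, ?_⟩
    have h2 : n * (3 * D) ∈ Λ := by
      have := mul_mem_hex (by simpa using intCast_mem_hex n) three_D
      simpa using this
    convert add_mem hn h2 using 1; push_cast; ring
  rcases mul_eq_zero.1 h with h | h
  · rcases mul_eq_zero.1 h with h | h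
    · obtain ⟨n, hn⟩ := key z h
      exact ⟨0, n, by simpa using hn⟩
    · obtain ⟨ρ, r1, r2⟩ := φ_add_T z
      obtain ⟨ρ', r1', r2'⟩ := φ_add_T (z + T)
      obtain ⟨n, hn⟩ := key (z + T + T) (by rw [r2', r2]; simp [h])
      exact ⟨2, n, by convert hn using 1; push_cast; ring⟩
  · obtain ⟨ρ, r1, r2⟩ := φ_add_T z
    obtain ⟨n, hn⟩ := key (z + T) (by rw [r2]; simp [h])
    exact ⟨1, n, by convert hn using 1; push_cast; ring⟩

/-- `c` parametrizes a subgroup of order `p` of `ℂ / Λ`. -/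
structure Sub (p : ℕ) (c : ZMod p → ℂ) : Prop where
  add : ∀ i j, c (i + j) - (c i + c j) ∈ Λ
  inj : ∀ i, c i ∈ Λ → i = 0

namespace Sub
variable {p : ℕ} [hpp : Fact p.Prime] {c : ZMod p → ℂ} (hc : Sub p c) (hp : p % 3 = 1)
include hc

lemma zero : c 0 ∈ Λ := by
  have := neg_mem (hc.add 0 0); simpa using this

lemma nsmul (n : ℕ) (i : ZMod p) : c (n * i) - n * c i ∈ Λ := by
  induction n with
  | zero => simpa using hc.zero
  | succ n ih =>
    have := add_mem (hc.add (n * i) i) ih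
    convert this using 1; push_cast; rw [add_mul, one_mul]; ring

lemma nsmul_mem {n : ℕ} {i : ZMod p} (h : n * c i ∈ Λ) : (n : ZMod p) * i = 0 :=
  hc.inj _ (by have := add_mem (hc.nsmul n i) h; simpa using this)

include hp in
omit hc in
lemma three_ne : ¬ p ∣ 3 := by
  intro h
  have := (Nat.prime_three.eq_one_or_self_of_dvd p h)
  rcases this with h1 | h1
  · exact hpp.out.one_lt.ne' h1
  · omega

include hp in
lemma nine {i : ZMod p} (h : 9 * c i ∈ Λ) : i = 0 := by
  have h1 := hc.nsmul_mem (n := 9) (by exact_mod_cast h)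
  refine (mul_eq_zero.1 h1).resolve_left ?_
  intro h
  rw [ZMod.natCast_eq_zero_iff] at h
  exact three_ne hp (hpp.out.dvd_of_dvd_pow (n := 2) (by norm_num; exact h))

include hp in
lemma nf {i : ZMod p} (h : i ≠ 0) : NF (c i) := by
  intro h'
  apply h
  apply hc.nine hp
  have := mul_mem_hex (by simpa using intCast_mem_hex 3) (three_mul_mem_of_flex h')
  convert this using 1; ring

include hp in
lemma reg (i : ZMod p) : Reg (c i) := by
  by_cases h : i = 0
  · subst h; exact reg_of_mem hc.zero
  · exact (hc.nf hp h).reg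

lemma neg (i : ZMod p) : c (-i) + c i ∈ Λ := by
  have := neg_mem (sub_mem (hc.add (-i) i) (by simpa using hc.zero))
  convert this using 1; ring

omit hc in
lemma gen_nf : Gen fun z => ∀ i, NF (z + c i) := Gen.all fun i => gen_NF.shift (c i)

omit hc in
lemma reduce {Q : ℂ → Prop} (h0 : Q 0) (hN : ∀ z, (∀ i, NF (z + c i)) → Q z)
    (hT : ∀ z, Q (z + T) → Q z) (hD : ∀ z, Q (z + D) → Q z) (hcc : ∀ z i, Q (z + c i) → Q z)
    (hper : ∀ z, ∀ l ∈ Λ, Q (z + l) → Q z) (z : ℂ) : Q z := by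
  by_cases h : ∀ i, NF (z + c i)
  · exact hN z h
  · push Not at h
    obtain ⟨i, hi⟩ := h
    obtain ⟨m, n, hmn⟩ := exists_flex hi
    have hT' : ∀ (m : ℕ) z, Q (z + m * T) → Q z := by
      intro m
      induction m with
      | zero => intro z h; simpa using h
      | succ m ih => intro z h; exact ih z (hT _ (by convert h using 1; push_cast; ring))
    have hD' : ∀ (m : ℕ) z, Q (z + m * D) → Q z := by
      intro m
      induction m with
      | zero => intro z h; simpa using h
      | succ m ih => intro z h; exact ih z (hD _ (by convert h using 1; push_cast; ring))
    refine hcc z i (hT' m _ (hD' n _ (hper _ _ (neg_mem hmn) ?_)))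
    rwa [add_neg_cancel]

end Sub

/-- The product of `s` over a coset. -/
noncomputable def ff {p : ℕ} [NeZero p] (c : ZMod p → ℂ) (z : ℂ) : ℂ := ∏ i, s (z + c i)
/-- The product of `t` over a coset. -/
noncomputable def gg {p : ℕ} [NeZero p] (c : ZMod p → ℂ) (z : ℂ) : ℂ := ∏ i, t (z + c i)

namespace Sub
variable {p : ℕ} [hpp : Fact p.Prime] {c : ZMod p → ℂ} (hc : Sub p c) (hp : p % 3 = 1)

include hp in
omit hpp in
lemma pow_p {a : ℂ} (ha : a ^ 3 = 1) : a ^ p = a := by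
  conv_lhs => rw [← Nat.div_add_mod p 3, hp, pow_add, pow_mul, ha]
  simp

/-- Invariance of products over cosets under translation by the subgroup. -/
lemma prod_shift (hc : Sub p c) {F : ℂ → ℂ} (hF : ∀ z, ∀ l ∈ Λ, F (z + l) = F z) (z : ℂ)
    (j : ZMod p) : ∏ i, F (z + c j + c i) = ∏ i, F (z + c i) := by
  rw [← Equiv.prod_comp (Equiv.addLeft j) fun i => F (z + c i)]
  refine Finset.prod_congr rfl fun i _ => ?_
  rw [← hF (z + c j + c i) _ (hc.add j i), Equiv.coe_addLeft]
  congr 1; ring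

lemma ff_shift (hc : Sub p c) (z : ℂ) (j : ZMod p) : ff c (z + c j) = ff c z :=
  hc.prod_shift (fun z _ => s_per z) z j
lemma gg_shift (hc : Sub p c) (z : ℂ) (j : ZMod p) : gg c (z + c j) = gg c z :=
  hc.prod_shift (fun z _ => t_per z) z j
omit hpp in
lemma prod_per {F : ℂ → ℂ} [NeZero p] (hF : ∀ z, ∀ l ∈ Λ, F (z + l) = F z) (z l : ℂ) (hl : l ∈ Λ) :
    ∏ i, F (z + l + c i) = ∏ i, F (z + c i) := by
  refine Finset.prod_congr rfl fun i _ => ?_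
  rw [← hF (z + c i) _ hl]; congr 1; ring
lemma ff_per (z : ℂ) {l : ℂ} (hl : l ∈ Λ) : ff c (z + l) = ff c z :=
  prod_per (fun z _ => s_per z) z l hl
lemma gg_per (z : ℂ) {l : ℂ} (hl : l ∈ Λ) : gg c (z + l) = gg c z :=
  prod_per (fun z _ => t_per z) z l hl

lemma ff_D (hp : p % 3 = 1) (z : ℂ) : ff c (z + D) = ω * ff c z := by
  have : ∀ i, s (z + D + c i) = ω * s (z + c i) := fun i => by
    rw [← s_add_D]; congr 1; ring
  simp only [ff, this, Finset.prod_mul_distrib, Finset.prod_const, Finset.card_univ, ZMod.card,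
    pow_p hp omega_cube]

lemma gg_D (hp : p % 3 = 1) (z : ℂ) : gg c (z + D) = ω ^ 2 * gg c z := by
  have : ∀ i, t (z + D + c i) = ω ^ 2 * t (z + c i) := fun i => by
    rw [← t_add_D]; congr 1; ring
  have h3 : (ω ^ 2) ^ 3 = 1 := by rw [← pow_mul, mul_comm, pow_mul, omega_cube, one_pow]
  simp only [gg, this, Finset.prod_mul_distrib, Finset.prod_const, Finset.card_univ, ZMod.card,
    pow_p hp h3]

lemma ff_T (z : ℂ) : ff c (z + T) = (gg c z)⁻¹ := by
  have : ∀ i, s (z + T + c i) = (t (z + c i))⁻¹ := fun i => by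
    rw [← s_add_T]; congr 1; ring
  simp only [ff, this, Finset.prod_inv_distrib, gg]

lemma gg_T {z : ℂ} (hz : ∀ i, Reg (z + c i)) : gg c (z + T) = ff c z / gg c z := by
  have : ∀ i, t (z + T + c i) = s (z + c i) / t (z + c i) := fun i => by
    rw [← t_add_T (hz i)]; congr 1; ring
  simp only [ff, this, Finset.prod_div_distrib, gg]

lemma t_zero' (hc : Sub p c) : t (c 0) = -1 := by
  rw [t, φ_of_mem hc.zero]; simp
lemma s_zero' (hc : Sub p c) : s (c 0) = 0 := by
  rw [s, φ_of_mem hc.zero]; simp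

lemma ff_zero (hc : Sub p c) : ff c 0 = 0 :=
  Finset.prod_eq_zero (Finset.mem_univ 0) (by rw [zero_add, hc.s_zero'])

lemma st_neg_c (hc : Sub p c) (hp : p % 3 = 1) (i : ZMod p) :
    s (c (-i)) = s (c i) / t (c i) ∧ t (c (-i)) = (t (c i))⁻¹ := by
  have e := φ_periodic (-c i) (hc.neg i)
  rw [add_comm, add_neg_cancel_right] at e
  obtain ⟨ρ, r1, r2⟩ := φ_neg (c i)
  rw [← e] at r2
  obtain ⟨-, h1, h2⟩ := st_of_prop r1 r2
  have h : φ (c i) 2 ≠ 0 := hc.reg hp i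
  constructor
  · rw [h1]; simp [s, t]; field_simp
  · rw [h2, t]; simp

lemma prod_involution {F : ZMod p → ℂ} (hp : p % 3 = 1)
    (h : ∀ i ≠ 0, F i * F (-i) = 1) : ∏ i ∈ Finset.univ.erase 0, F i = 1 := by
  refine Finset.prod_involution (fun i _ => -i) ?_ ?_ ?_ ?_
  · intro i hi; exact h i (Finset.ne_of_mem_erase hi)
  · intro i hi _ he
    have hi' := Finset.ne_of_mem_erase hi
    have : (2 : ZMod p) * i = 0 := by linear_combination -he
    rcases mul_eq_zero.1 this with h | h
    · have h2 : ((2 : ℕ) : ZMod p) = 0 := by exact_mod_cast h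
      rw [ZMod.natCast_eq_zero_iff, Nat.prime_dvd_prime_iff_eq hpp.out Nat.prime_two] at h2
      omega
    · exact hi' h
  · intro i hi; simpa using Finset.ne_of_mem_erase hi
  · intro i _; simp

lemma gg_zero (hc : Sub p c) (hp : p % 3 = 1) : gg c 0 = -1 := by
  rw [gg, ← Finset.mul_prod_erase _ _ (Finset.mem_univ 0)]
  simp only [zero_add]
  rw [hc.t_zero', prod_involution hp, mul_one]
  intro i hi
  rw [(hc.st_neg_c hp i).2, mul_inv_cancel₀ (hc.nf hp hi).t_ne]

omit hpp in
lemma analyticAt_prod {F : ℂ → ℂ} {z : ℂ} {S : Finset (ZMod p)}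
    (h : ∀ i ∈ S, AnalyticAt ℂ F (z + c i)) : AnalyticAt ℂ (fun z => ∏ i ∈ S, F (z + c i)) z := by
  refine Finset.analyticAt_fun_prod _ fun i hi => ?_
  exact (h i hi).comp_of_eq (by fun_prop) rfl

lemma analyticAt_ff {z : ℂ} (h : ∀ i, Reg (z + c i)) : AnalyticAt ℂ (ff c) z :=
  analyticAt_prod fun i _ => analyticAt_s (h i)
lemma analyticAt_gg {z : ℂ} (h : ∀ i, Reg (z + c i)) : AnalyticAt ℂ (gg c) z :=
  analyticAt_prod fun i _ => analyticAt_t (h i)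

/-- The derivative at `0` of a product with a simple zero. -/
lemma deriv_prod_zero (hc : Sub p c) {F : ℂ → ℂ} (hF : ∀ z, ∀ l ∈ Λ, F (z + l) = F z)
    (hreg : ∀ i, AnalyticAt ℂ F (c i)) (h0 : F 0 = 0) :
    deriv (fun z => ∏ i, F (z + c i)) 0 = deriv F 0 * ∏ i ∈ Finset.univ.erase 0, F (c i) := by
  have e : (fun z => ∏ i, F (z + c i)) =
      fun z => F z * ∏ i ∈ Finset.univ.erase 0, F (z + c i) := by
    ext z
    rw [← Finset.mul_prod_erase _ _ (Finset.mem_univ 0), hF z _ hc.zero]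
  have h1 : AnalyticAt ℂ F 0 := by
    have : F = fun z => F (z + c 0) := by ext z; rw [hF z _ hc.zero]
    rw [this]; exact (hreg 0).comp_of_eq (by fun_prop) (by simp)
  have h2 : AnalyticAt ℂ (fun z => ∏ i ∈ Finset.univ.erase 0, F (z + c i)) 0 :=
    analyticAt_prod fun i _ => by simpa using hreg i
  rw [e, deriv_fun_mul h1.differentiableAt h2.differentiableAt, h0]
  simp

/-- Analytic continuation of a function with prescribed behaviour under translation. -/
lemma ext_shift {q : ℂ → ℂ} {b θ z : ℂ} (hθ : θ ≠ 0) (h : Gen fun z => q (z + b) = θ * q z)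
    (hq : Ext q (z + b)) : Ext q z := by
  obtain ⟨f, hf, he⟩ := hq.comp_add
  refine ⟨fun z => θ⁻¹ * f z, analyticAt_const.mul hf, ?_⟩
  filter_upwards [he, h z] with y h1 h2
  rw [h1, h2, inv_mul_cancel_left₀ hθ]

/-- The constant in the product formula for the line `s + t + 1 = 0`. -/
noncomputable def κ {p : ℕ} [NeZero p] (c : ZMod p → ℂ) : ℂ :=
  ∏ i ∈ Finset.univ.erase 0, (ω * s (c i) + ω ^ 2 * t (c i) + 1)⁻¹

/-- Product of the translates of a flex tangent line -/
noncomputable def qq {p : ℕ} [NeZero p] (c : ZMod p → ℂ) (z : ℂ) : ℂ :=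
  (ff c z + gg c z + 1) / ∏ i, (s (z + c i) + t (z + c i) + 1)

lemma qq_ext (hc : Sub p c) (hp : p % 3 = 1) (z : ℂ) :
    Ext (qq c) z ∧ Ext (qq c) (z + D) ∧ Ext (qq c) (z + D + D) := by
  have hper : ∀ z, ∀ l ∈ Λ, qq c (z + l) = qq c z := fun z l hl => by
    rw [qq, ff_per z hl, gg_per z hl, qq]
    congr 1
    exact prod_per (F := fun z => s z + t z + 1) (fun z l hl => by rw [s_per z hl, t_per z hl]) z l hl
  have hsh : ∀ z j, qq c (z + c j) = qq c z := fun z j => by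
    rw [qq, hc.ff_shift z, hc.gg_shift z, qq]
    congr 1
    exact hc.prod_shift (F := fun z => s z + t z + 1) (fun z l hl => by rw [s_per z hl, t_per z hl]) z j
  have hT : Gen fun z => qq c (z + T) = 1 * qq c z := by
    refine (gen_nf (c := c)).mono fun z hz => ?_
    have : ∀ i, s (z + T + c i) + t (z + T + c i) + 1
        = (s (z + c i) + t (z + c i) + 1) / t (z + c i) := fun i => by
      rw [show z + T + c i = z + c i + T by ring, s_add_T, t_add_T (hz i).reg]
      have := (hz i).t_ne
      field_simp; ring
    rw [qq, ff_T, gg_T fun i => (hz i).reg, qq]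
    simp only [this, Finset.prod_div_distrib]
    rw [← gg]
    have : gg c z ≠ 0 := Finset.prod_ne_zero_iff.2 fun i _ => (hz i).t_ne
    field_simp; ring
  have easy : ∀ z, (∀ i, Reg (z + c i) ∧ s (z + c i) + t (z + c i) + 1 ≠ 0) → Ext (qq c) z := by
    intro z hz
    refine ext_of_div (((analyticAt_ff fun i => (hz i).1).add (analyticAt_gg fun i => (hz i).1)).add
      analyticAt_const) ?_ (Finset.prod_ne_zero_iff.2 fun i _ => (hz i).2)
    exact analyticAt_prod (F := fun z => s z + t z + 1) fun i _ =>
      ((analyticAt_s (hz i).1).add (analyticAt_t (hz i).1)).add analyticAt_const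
  have w3 : (ω ^ 2) ^ 3 = 1 := by rw [← pow_mul, mul_comm, pow_mul, omega_cube, one_pow]
  have hnf : ∀ z, NF (z + D) ↔ NF z := fun z => by
    obtain ⟨ρ, r1, r2⟩ := φ_add_D z
    simp [NF, r2, r1, omega_ne_zero]
  refine reduce (c := c) (Q := fun z => Ext (qq c) z ∧ Ext (qq c) (z + D) ∧ Ext (qq c) (z + D + D))
    ?_ ?_ ?_ ?_ ?_ ?_ z
  · refine ⟨?_, ?_, ?_⟩
    · refine ext_of_simple_zero
        (((analyticAt_ff fun i => ?_).add (analyticAt_gg fun i => ?_)).add analyticAt_const)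
        (analyticAt_prod (F := fun z => s z + t z + 1) fun i _ => ?_) ?_ ?_ ?_
      · rw [zero_add]; exact hc.reg hp i
      · rw [zero_add]; exact hc.reg hp i
      · rw [zero_add]
        exact ((analyticAt_s (hc.reg hp i)).add (analyticAt_t (hc.reg hp i))).add analyticAt_const
      · simp [hc.ff_zero, hc.gg_zero hp]
      · refine Finset.prod_eq_zero (Finset.mem_univ 0) ?_
        simp [hc.s_zero', hc.t_zero']
      · rw [hc.deriv_prod_zero (F := fun z => s z + t z + 1)
          (fun z l hl => by rw [s_per z hl, t_per z hl]) (fun i =>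
            ((analyticAt_s (hc.reg hp i)).add (analyticAt_t (hc.reg hp i))).add analyticAt_const)
          (by simp [s_zero, t_zero])]
        refine mul_ne_zero ?_ (Finset.prod_ne_zero_iff.2 fun i hi => ?_)
        · rw [(((hasDerivAt_s reg_zero).fun_add (hasDerivAt_t reg_zero)).add_const 1).deriv]
          simp [s_zero, t_zero, kc_ne]
        · have := (hc.nf hp (Finset.ne_of_mem_erase hi)).lin (a := 1) (b := 1) (by simp) (by simp)
          simpa using this
    · refine easy _ fun i => ?_
      rw [show 0 + D + c i = c i + D by ring, reg_add_D, s_add_D, t_add_D]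
      refine ⟨hc.reg hp i, ?_⟩
      by_cases hi : i = 0
      · subst hi; rw [hc.s_zero', hc.t_zero']
        intro h; exact omega_sq_ne_one (by linear_combination -h)
      · exact (hc.nf hp hi).lin omega_cube w3
    · refine easy _ fun i => ?_
      rw [show 0 + D + D + c i = c i + D + D by ring, reg_add_D, s_add_D, t_add_D, reg_add_D, s_add_D, t_add_D]
      refine ⟨hc.reg hp i, ?_⟩
      by_cases hi : i = 0
      · subst hi; rw [hc.s_zero', hc.t_zero']
        intro h; exact omega_ne_one (by linear_combination -h - omega_pow_four)
      · have := (hc.nf hp hi).lin w3 omega_cube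
        rw [← mul_assoc, ← mul_assoc, ← pow_two, ← pow_add, omega_pow_four]
        exact this
  · intro z hz
    have : ∀ z, (∀ i, NF (z + c i)) → Ext (qq c) z := fun z hz => easy z fun i =>
      ⟨(hz i).reg, by simpa using (hz i).lin (a := 1) (b := 1) (by simp) (by simp)⟩
    refine ⟨this z hz, this _ fun i => ?_, this _ fun i => ?_⟩
    · rw [show z + D + c i = z + c i + D by ring, hnf]; exact hz i
    · rw [show z + D + D + c i = z + c i + D + D by ring, hnf, hnf]; exact hz i
  · rintro z ⟨h1, h2, h3⟩
    refine ⟨ext_shift one_ne_zero hT h1, ext_shift one_ne_zero hT ?_, ext_shift one_ne_zero hT ?_⟩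
    · convert h2 using 1; ring
    · convert h3 using 1; ring
  · rintro z ⟨h1, h2, h3⟩
    refine ⟨?_, h1, h2⟩
    have := ext_shift (q := qq c) (b := 3 * D) (θ := 1) (z := z) one_ne_zero (Gen.mono gen_reg fun z _ => by
      rw [one_mul, hper _ _ three_D]) (by convert h3 using 1; ring)
    exact this
  · rintro z j ⟨h1, h2, h3⟩
    have hj : Gen fun z => qq c (z + c j) = 1 * qq c z := gen_reg.mono fun z _ => by rw [one_mul, hsh]
    refine ⟨ext_shift one_ne_zero hj h1, ext_shift one_ne_zero hj ?_, ext_shift one_ne_zero hj ?_⟩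
    · convert h2 using 1; ring
    · convert h3 using 1; ring
  · rintro z l hl ⟨h1, h2, h3⟩
    have hj : Gen fun z => qq c (z + l) = 1 * qq c z := gen_reg.mono fun z _ => by rw [one_mul, hper _ _ hl]
    refine ⟨ext_shift one_ne_zero hj h1, ext_shift one_ne_zero hj ?_, ext_shift one_ne_zero hj ?_⟩
    · convert h2 using 1; ring
    · convert h3 using 1; ring

lemma line_one (hc : Sub p c) (hp : p % 3 = 1) :
    Gen fun z => ff c z + gg c z + 1 = κ c * ∏ i, (s (z + c i) + t (z + c i) + 1) := by
  have w3 : (ω ^ 2) ^ 3 = 1 := by rw [← pow_mul, mul_comm, pow_mul, omega_cube, one_pow]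
  obtain ⟨k, hk⟩ := liouville (fun z => (hc.qq_ext hp z).1) (fun z l hl => by
    rw [qq, ff_per z hl, gg_per z hl, qq]
    congr 1
    exact prod_per (F := fun z => s z + t z + 1) (fun z l hl => by rw [s_per z hl, t_per z hl]) z l hl)
  have hk₂ : Gen fun z => ff c z + gg c z + 1 = k * ∏ i, (s (z + c i) + t (z + c i) + 1) := by
    refine (hk.and (gen_nf (c := c))).mono fun z hz => ?_
    rw [← hz.1, qq, div_mul_cancel₀]
    exact Finset.prod_ne_zero_iff.2 fun i _ => by
      simpa using (hz.2 i).lin (a := 1) (b := 1) (by simp) (by simp)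
  have hr : ∀ i, Reg (D + c i) := fun i => by rw [add_comm, reg_add_D]; exact hc.reg hp i
  have := gen_eq_of_continuous hk₂ (x := D)
    (((analyticAt_ff hr).add (analyticAt_gg hr)).add analyticAt_const).continuousAt
    ((analyticAt_prod (F := fun z => s z + t z + 1) fun i _ =>
      ((analyticAt_s (hr i)).add (analyticAt_t (hr i))).add analyticAt_const).continuousAt.const_mul k)
  have e1 : ff c D = 0 := by
    have := ff_D (c := c) hp 0; rwa [zero_add, hc.ff_zero, mul_zero] at this
  have e2 : gg c D = - ω ^ 2 := by
    have := gg_D (c := c) hp 0; rw [zero_add, hc.gg_zero hp] at this; rw [this]; ring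
  have e3 : ∀ i, s (D + c i) + t (D + c i) + 1 = ω * s (c i) + ω ^ 2 * t (c i) + 1 := fun i => by
    rw [add_comm D, s_add_D, t_add_D]
  simp only [e1, e2, e3] at this
  rw [← Finset.mul_prod_erase _ _ (Finset.mem_univ 0), hc.s_zero', hc.t_zero'] at this
  have hn : (1 : ℂ) - ω ^ 2 ≠ 0 := sub_ne_zero.2 omega_sq_ne_one.symm
  have h4 : k = κ c := by
    rw [κ, Finset.prod_inv_distrib]
    have h5 : ∏ i ∈ Finset.univ.erase 0, (ω * s (c i) + ω ^ 2 * t (c i) + 1) ≠ 0 :=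
      Finset.prod_ne_zero_iff.2 fun i hi => (hc.nf hp (Finset.ne_of_mem_erase hi)).lin omega_cube w3
    refine eq_inv_of_mul_eq_one_left ?_
    refine mul_left_cancel₀ hn ?_
    linear_combination -this
  rwa [h4] at hk₂

/-- The Hesse parameter of the image curve. -/
noncomputable def lam {p : ℕ} [NeZero p] (c : ZMod p → ℂ) : ℂ := 1 - 3 ^ (p - 1) * κ c ^ 3

lemma hesse (hc : Sub p c) (hp : p % 3 = 1) :
    Gen fun z => ff c z ^ 3 + gg c z ^ 3 + 1 = 3 * lam c * ff c z * gg c z := by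
  have h1 := hc.line_one hp
  refine ((h1.and ((h1.shift D).and (h1.shift (D + D)))).and (gen_nf (c := c))).mono fun z hz => ?_
  obtain ⟨⟨e1, e2, e3⟩, hnf⟩ := hz
  rw [← add_assoc] at e3
  simp only [ff_D hp, gg_D hp] at e2 e3
  have d2 : ∀ i, s (z + D + c i) + t (z + D + c i) + 1
      = ω * s (z + c i) + ω ^ 2 * t (z + c i) + 1 := fun i => by
    rw [show z + D + c i = z + c i + D by ring, s_add_D, t_add_D]
  have d3 : ∀ i, s (z + D + D + c i) + t (z + D + D + c i) + 1
      = ω ^ 2 * s (z + c i) + ω * t (z + c i) + 1 := fun i => by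
    rw [show z + D + D + c i = z + c i + D + D by ring, s_add_D, t_add_D, s_add_D, t_add_D]
    linear_combination t (z + c i) * omega_pow_four
  simp only [d2, d3] at e2 e3
  have key : (∏ i, (s (z + c i) + t (z + c i) + 1)) *
      (∏ i, (ω * s (z + c i) + ω ^ 2 * t (z + c i) + 1)) *
      (∏ i, (ω ^ 2 * s (z + c i) + ω * t (z + c i) + 1)) = - 3 ^ p * ff c z * gg c z := by
    rw [← Finset.prod_mul_distrib, ← Finset.prod_mul_distrib]
    have : ∀ i, (s (z + c i) + t (z + c i) + 1) * (ω * s (z + c i) + ω ^ 2 * t (z + c i) + 1) *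
        (ω ^ 2 * s (z + c i) + ω * t (z + c i) + 1) = -3 * (s (z + c i) * t (z + c i)) := fun i => by
      have := curve (hnf i).reg
      have w := omega_sq
      grind
    simp only [this, Finset.prod_mul_distrib, Finset.prod_const, Finset.card_univ, ZMod.card, ff, gg]
    have hodd : Odd p := hpp.out.odd_of_ne_two (by omega)
    rw [hodd.neg_pow]; ring
  have w := omega_sq
  have hp1 : (3 : ℂ) ^ p = 3 * 3 ^ (p - 1) := by
    rw [← pow_succ', Nat.sub_add_cancel hpp.out.one_lt.le]
  rw [hp1] at key
  have e : (ff c z + gg c z + 1) * (ω * ff c z + ω ^ 2 * gg c z + 1) *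
      (ω * (ω * ff c z) + ω ^ 2 * (ω ^ 2 * gg c z) + 1)
      = κ c ^ 3 * (- (3 * 3 ^ (p - 1)) * ff c z * gg c z) := by
    rw [e1, e2, e3, ← key]; ring
  have e' : (ff c z + gg c z + 1) * (ω * ff c z + ω ^ 2 * gg c z + 1) *
      (ω * (ω * ff c z) + ω ^ 2 * (ω ^ 2 * gg c z) + 1)
      = ff c z ^ 3 + gg c z ^ 3 + 1 - 3 * ff c z * gg c z := by
    clear e e1 e2 e3 key d2 d3
    generalize ff c z = a
    generalize gg c z = b
    grind
  rw [lam]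
  linear_combination e - e'

end Sub

/-- The cubic form `s³ + θ t³ + θ²`. -/
noncomputable def aa (θ z : ℂ) : ℂ := s z ^ 3 + θ * t z ^ 3 + θ ^ 2

lemma aa_per (θ z : ℂ) {l : ℂ} (hl : l ∈ Λ) : aa θ (z + l) = aa θ z := by
  rw [aa, s_per z hl, t_per z hl, aa]

lemma omega_sq_cube : (ω ^ 2) ^ 3 = 1 := by rw [← pow_mul, mul_comm, pow_mul, omega_cube, one_pow]

lemma aa_T {θ z : ℂ} (hθ : θ ^ 3 = 1) (h : NF z) : aa θ (z + T) = θ * aa θ z / t z ^ 3 := by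
  have := h.t_ne
  rw [aa, s_add_T, t_add_T h.reg, aa]
  field_simp
  linear_combination -hθ

lemma aa_D (θ z : ℂ) : aa θ (z + D) = aa θ z := by
  rw [aa, s_add_D, t_add_D, aa, mul_pow, mul_pow, omega_cube, omega_sq_cube]; simp

lemma analyticAt_aa {θ z : ℂ} (h : Reg z) : AnalyticAt ℂ (aa θ) z :=
  (((analyticAt_s h).pow 3).add (analyticAt_const.mul ((analyticAt_t h).pow 3))).add analyticAt_const

namespace Sub
variable {p : ℕ} [hpp : Fact p.Prime] {c : ZMod p → ℂ}

/-- The constant in the product formula for `aa`. -/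
noncomputable def EE {p : ℕ} [NeZero p] (c : ZMod p → ℂ) (θ : ℂ) : ℂ :=
  ∏ i ∈ Finset.univ.erase 0, aa θ (c i)

/-- Auxiliary entire elliptic function. -/
noncomputable def qa {p : ℕ} [NeZero p] (c : ZMod p → ℂ) (θ z : ℂ) : ℂ :=
  (∏ i, aa θ (z + c i) - EE c θ * (ff c z ^ 3 + θ * gg c z ^ 3 + θ ^ 2)) / (ff c z * gg c z)

lemma qa_per {θ z l : ℂ} (hl : l ∈ Λ) : qa c θ (z + l) = qa c θ z := by
  rw [qa, ff_per z hl, gg_per z hl, qa, prod_per (fun z l hl => aa_per θ z hl) z l hl]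

lemma qa_T {θ z : ℂ} (hp : p % 3 = 1) (hθ : θ ^ 3 = 1) (h : ∀ i, NF (z + c i)) :
    qa c θ (z + T) = θ * qa c θ z := by
  have e : ∀ i, aa θ (z + T + c i) = θ * aa θ (z + c i) / t (z + c i) ^ 3 := fun i => by
    rw [← aa_T hθ (h i)]; congr 1; ring
  rw [qa, ff_T, gg_T fun i => (h i).reg, qa]
  simp only [e, Finset.prod_div_distrib, Finset.prod_mul_distrib, Finset.prod_const,
    Finset.card_univ, ZMod.card, pow_p hp hθ, Finset.prod_pow]
  rw [← gg]
  have h1 : gg c z ≠ 0 := Finset.prod_ne_zero_iff.2 fun i _ => (h i).t_ne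
  have h2 : ff c z ≠ 0 := Finset.prod_ne_zero_iff.2 fun i _ => (h i).s_ne
  field_simp
  linear_combination EE c θ * hθ

lemma qa_D {θ z : ℂ} (hp : p % 3 = 1) : qa c θ (z + D) = 1 * qa c θ z := by
  have e : ∀ i, aa θ (z + D + c i) = aa θ (z + c i) := fun i => by
    rw [← aa_D θ (z + c i)]; congr 1; ring
  rw [qa, ff_D hp, gg_D hp, qa]
  simp only [e, mul_pow, omega_cube, omega_sq_cube]
  rw [show ω * ff c z * (ω ^ 2 * gg c z) = ω ^ 3 * (ff c z * gg c z) by ring, omega_cube]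
  simp only [one_mul]

lemma qa_c {θ z : ℂ} (hc : Sub p c) (j : ZMod p) : qa c θ (z + c j) = 1 * qa c θ z := by
  rw [qa, hc.ff_shift z, hc.gg_shift z, qa, hc.prod_shift (fun z l hl => aa_per θ z hl), one_mul]

lemma qa_ext {θ : ℂ} (hc : Sub p c) (hp : p % 3 = 1) (hθ : θ ^ 3 = 1) (z : ℂ) :
    Ext (qa c θ) z := by
  have hθ0 : θ ≠ 0 := by rintro rfl; norm_num at hθ
  have hnum : ∀ z, (∀ i, Reg (z + c i)) → AnalyticAt ℂ (fun z => ∏ i, aa θ (z + c i) -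
      EE c θ * (ff c z ^ 3 + θ * gg c z ^ 3 + θ ^ 2)) z := fun z h =>
    (analyticAt_prod fun i _ => analyticAt_aa (h i)).sub (analyticAt_const.mul
      ((((analyticAt_ff h).pow 3).add (analyticAt_const.mul ((analyticAt_gg h).pow 3))).add
        analyticAt_const))
  have hden : ∀ z, (∀ i, Reg (z + c i)) → AnalyticAt ℂ (fun z => ff c z * gg c z) z := fun z h =>
    (analyticAt_ff h).mul (analyticAt_gg h)
  have h0 : ∀ i, Reg (0 + c i) := fun i => by rw [zero_add]; exact hc.reg hp i
  refine reduce (c := c) (Q := fun z => Ext (qa c θ) z) ?_ ?_ ?_ ?_ ?_ ?_ z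
  · refine ext_of_simple_zero (hnum 0 h0) (hden 0 h0) ?_ ?_ ?_
    · rw [← Finset.mul_prod_erase _ _ (Finset.mem_univ 0)]
      simp only [zero_add, hc.ff_zero, hc.gg_zero hp]
      rw [← EE, aa, hc.s_zero', hc.t_zero']
      ring
    · rw [hc.ff_zero, zero_mul]
    · rw [deriv_fun_mul (analyticAt_ff h0).differentiableAt (analyticAt_gg h0).differentiableAt,
        hc.ff_zero, zero_mul, add_zero, hc.gg_zero hp]
      unfold ff
      rw [hc.deriv_prod_zero (fun z l hl => s_per z hl) (fun i => analyticAt_s (hc.reg hp i)) s_zero,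
        (hasDerivAt_s reg_zero).deriv]
      refine mul_ne_zero (mul_ne_zero ?_ (Finset.prod_ne_zero_iff.2 fun i hi => ?_)) (by simp)
      · simp [t_zero, kc_ne]
      · exact (hc.nf hp (Finset.ne_of_mem_erase hi)).s_ne
  · intro z hz
    exact ext_of_div (hnum z fun i => (hz i).reg) (hden z fun i => (hz i).reg)
      (mul_ne_zero (Finset.prod_ne_zero_iff.2 fun i _ => (hz i).s_ne)
        (Finset.prod_ne_zero_iff.2 fun i _ => (hz i).t_ne))
  · intro z
    exact ext_shift hθ0 ((gen_nf (c := c)).mono fun z hz => qa_T hp hθ hz)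
  · intro z
    exact ext_shift one_ne_zero (gen_reg.mono fun z _ => qa_D hp)
  · intro z i
    exact ext_shift one_ne_zero (gen_reg.mono fun z _ => qa_c hc i)
  · intro z l hl
    exact ext_shift one_ne_zero (gen_reg.mono fun z _ => by rw [qa_per hl, one_mul])

lemma prod_aa {θ : ℂ} (hc : Sub p c) (hp : p % 3 = 1) (hθ : θ ^ 3 = 1) (hθ1 : θ ≠ 1) :
    Gen fun z => ∏ i, aa θ (z + c i) = EE c θ * (ff c z ^ 3 + θ * gg c z ^ 3 + θ ^ 2) := by
  obtain ⟨k, hk⟩ := liouville (fun z => hc.qa_ext hp hθ z) fun z l hl => qa_per hl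
  obtain ⟨z, ⟨h1, h2⟩, h3⟩ := ((hk.and (hk.shift T)).and (gen_nf (c := c))).exists
  have hk0 : k = 0 := by
    rw [qa_T hp hθ h3, h1] at h2
    have : (θ - 1) * k = 0 := by linear_combination h2
    exact (mul_eq_zero.1 this).resolve_left (sub_ne_zero.2 hθ1)
  refine (hk.and (gen_nf (c := c))).mono fun z hz => ?_
  obtain ⟨h1, h2⟩ := hz
  rw [hk0, qa, div_eq_zero_iff] at h1
  exact sub_eq_zero.1 (h1.resolve_right (mul_ne_zero (Finset.prod_ne_zero_iff.2 fun i _ => (h2 i).s_ne)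
        (Finset.prod_ne_zero_iff.2 fun i _ => (h2 i).t_ne)))

lemma EE_symm (hc : Sub p c) (hp : p % 3 = 1) : EE c (ω ^ 2) = EE c ω := by
  have h1 : EE c (ω ^ 2) = ∏ i ∈ Finset.univ.erase 0, aa (ω ^ 2) (c (-i)) := by
    rw [EE]
    refine Finset.prod_nbij' (fun i => -i) (fun i => -i) ?_ ?_ ?_ ?_ ?_ <;> simp
  have h2 : ∏ i ∈ Finset.univ.erase 0, t (c i) = 1 := prod_involution hp fun i hi => by
    rw [(hc.st_neg_c hp i).2, mul_inv_cancel₀ (hc.nf hp hi).t_ne]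
  rw [h1, ← mul_one (∏ i ∈ _, _), ← one_pow 3, ← h2, ← Finset.prod_pow, ← Finset.prod_mul_distrib, EE]
  refine Finset.prod_congr rfl fun i hi => ?_
  have := (hc.nf hp (Finset.ne_of_mem_erase hi)).t_ne
  rw [aa, (hc.st_neg_c hp i).1, (hc.st_neg_c hp i).2, aa]
  have w := omega_sq
  field_simp
  grind

lemma aa_ne (hc : Sub p c) (hp : p % 3 = 1) {i : ZMod p} (hi : i ≠ 0) : aa ω (c i) ≠ 0 := by
  intro h
  obtain ⟨ρ, h1, h2⟩ := φ_h (c i)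
  have h3 : φ ((ω ^ 2 - ω) * c i) 1 = 0 := by
    have hr : φ (c i) 2 ≠ 0 := hc.reg hp i
    rw [h2]
    simp only [hvec, Pi.smul_apply, smul_eq_mul]
    simp only [aa, s, t] at h
    field_simp at h
    have h' : φ (c i) 0 ^ 3 + ω * φ (c i) 1 ^ 3 + ω ^ 2 * φ (c i) 2 ^ 3 = 0 := by linear_combination h
    simp [h']
  have h4 := three_mul_mem_of_flex (z := (ω ^ 2 - ω) * c i) (by rw [h3]; simp)
  have h5 := mul_mem_hex (sub_mem omega_mem_hex (mul_mem_hex omega_mem_hex omega_mem_hex)) h4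
  refine hi (hc.nine hp ?_)
  convert h5 using 1
  have w := omega_sq
  grind

lemma EE_ne (hc : Sub p c) (hp : p % 3 = 1) : EE c ω ≠ 0 :=
  Finset.prod_ne_zero_iff.2 fun _ hi => hc.aa_ne hp (Finset.ne_of_mem_erase hi)

/-- The factor `μ`. -/
noncomputable def mu {p : ℕ} [NeZero p] (c : ZMod p → ℂ) : ℂ := (-3) ^ p / (3 * EE c ω)

lemma h_mul (hc : Sub p c) (hp : p % 3 = 1) : Sub p fun i => (ω ^ 2 - ω) * c i := by
  have hm : ω ^ 2 - ω ∈ Λ := sub_mem (by rw [pow_two]; exact mul_mem_hex omega_mem_hex omega_mem_hex) omega_mem_hex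
  have w := omega_sq
  refine ⟨fun i j => ?_, fun i hi => ?_⟩
  · convert mul_mem_hex hm (hc.add i j) using 1; ring
  · have h9 := mul_mem_hex (mul_mem_hex hm (mul_mem_hex hm hm)) hi
    refine hc.nine hp ?_
    convert h9 using 1; grind

lemma s_h {z : ℂ} (h : Reg z) : s ((ω ^ 2 - ω) * z) = -3 * (s z * t z) / aa (ω ^ 2) z := by
  obtain ⟨ρ, h1, h2⟩ := φ_h z
  have hr : φ z 2 ≠ 0 := h
  rw [(st_of_prop h1 h2).2.1, aa, s, t]
  simp only [hvec, Matrix.cons_val]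
  rw [show (ω ^ 2) ^ 2 = ω by rw [← pow_mul]; exact omega_pow_four]
  rw [show φ z 0 ^ 3 + ω ^ 2 * φ z 1 ^ 3 + ω * φ z 2 ^ 3 = ((φ z 0 / φ z 2) ^ 3 +
    ω ^ 2 * (φ z 1 / φ z 2) ^ 3 + ω) * φ z 2 ^ 3 by field_simp]
  rw [mul_comm _ (φ z 2 ^ 3), ← div_div]
  congr 1
  field_simp

lemma t_h {z : ℂ} (h : Reg z) : t ((ω ^ 2 - ω) * z) = aa ω z / aa (ω ^ 2) z := by
  obtain ⟨ρ, h1, h2⟩ := φ_h z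
  have hr : φ z 2 ≠ 0 := h
  rw [(st_of_prop h1 h2).2.2, ← mul_div_mul_right (aa ω z) _ (pow_ne_zero 3 hr), aa, aa, s, t]
  simp only [hvec, Matrix.cons_val]
  rw [show (ω ^ 2) ^ 2 = ω by rw [← pow_mul]; exact omega_pow_four]
  congr 1 <;> field_simp

lemma aa_ne_of_reg {z : ℂ} (h : Reg z) (h' : Reg ((ω ^ 2 - ω) * z)) : aa (ω ^ 2) z ≠ 0 := by
  obtain ⟨ρ, h1, h2⟩ := φ_h z
  have hr : φ z 2 ≠ 0 := h
  intro e
  have := (st_of_prop h1 h2).1.1 h'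
  apply this
  simp only [hvec, Matrix.cons_val]
  rw [aa, s, t, show (ω ^ 2) ^ 2 = ω by rw [← pow_mul]; exact omega_pow_four] at e
  field_simp at e
  linear_combination e

lemma h_ne : ω ^ 2 - ω ≠ 0 := fun h => omega_ne_one (mul_left_cancel₀ omega_ne_zero (by linear_combination h))

lemma gen_ff_ne : Gen fun z => ff c z ≠ 0 ∧ gg c z ≠ 0 := (gen_nf (c := c)).mono fun _ hz =>
  ⟨Finset.prod_ne_zero_iff.2 fun i _ => (hz i).s_ne, Finset.prod_ne_zero_iff.2 fun i _ => (hz i).t_ne⟩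

lemma lam_mu (hc : Sub p c) (hp : p % 3 = 1) :
    lam c = lam (fun i => (ω ^ 2 - ω) * c i) * mu c ∧ mu c ^ 3 = lam c ^ 3 - 1 := by
  have hE := hc.EE_ne hp
  have hμ : (-3 : ℂ) ^ p / EE c ω = 3 * mu c := by rw [mu]; field_simp
  have h2 : (ω ^ 2 : ℂ) ≠ 1 := omega_sq_ne_one
  have hz0 := ((hc.h_mul hp).hesse hp).comp h_ne 0
  have hreg : Gen fun z => ∀ i, Reg ((ω ^ 2 - ω) * (z + c i)) := Gen.all fun i =>
    (gen_reg.comp h_ne ((ω ^ 2 - ω) * c i)).mono fun _ hz => by rwa [mul_add]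
  have main : Gen fun z => (ff c z * gg c z) ^ 2 * (3 * (mu c ^ 3 + 1 - lam c ^ 3)) =
      (lam (fun i => (ω ^ 2 - ω) * c i) * mu c - lam c) *
      ((ff c z ^ 3 + ω * gg c z ^ 3 + ω ^ 2) * (ff c z ^ 3 + ω ^ 2 * gg c z ^ 3 + ω)) := by
    refine ((hz0.and (((hc.prod_aa hp omega_cube omega_ne_one).and
      (hc.prod_aa hp omega_sq_cube h2)).and (hc.hesse hp))).and (((gen_nf (c := c)).and
      (gen_ff_ne (c := c))).and hreg)).mono fun z hz => ?_
    obtain ⟨⟨e1, ⟨e2, e3⟩, e4⟩, ⟨hnf, hf, hg⟩, hr⟩ := hz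
    rw [add_zero] at e1
    have ha : ∏ i, aa (ω ^ 2) (z + c i) ≠ 0 :=
      Finset.prod_ne_zero_iff.2 fun i _ => aa_ne_of_reg (hnf i).reg (hr i)
    have f1 : ff (fun i => (ω ^ 2 - ω) * c i) ((ω ^ 2 - ω) * z) =
        (-3) ^ p * (ff c z * gg c z) / ∏ i, aa (ω ^ 2) (z + c i) := by
      rw [ff]
      simp only [← mul_add, s_h (hnf _).reg, Finset.prod_div_distrib, Finset.prod_mul_distrib,
        Finset.prod_const, Finset.card_univ, ZMod.card]
      rfl
    have g1 : gg (fun i => (ω ^ 2 - ω) * c i) ((ω ^ 2 - ω) * z) =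
        (∏ i, aa ω (z + c i)) / ∏ i, aa (ω ^ 2) (z + c i) := by
      rw [gg]
      simp only [← mul_add, t_h (hnf _).reg, Finset.prod_div_distrib]
    rw [f1, g1] at e1
    have e5 : (-3 : ℂ) ^ p = 3 * mu c * EE c ω := by rw [← hμ]; field_simp
    rw [e3, hc.EE_symm hp] at ha
    rw [e5, e2, e3, hc.EE_symm hp, show (ω ^ 2) ^ 2 = ω by rw [← pow_mul]; exact omega_pow_four] at e1
    rw [show (ω ^ 2) ^ 2 = ω by rw [← pow_mul]; exact omega_pow_four] at ha
    have ha2 := right_ne_zero_of_mul ha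
    have w := omega_sq
    have hUV : (ff c z ^ 3 + ω * gg c z ^ 3 + ω ^ 2) ^ 3 + (ff c z ^ 3 + ω ^ 2 * gg c z ^ 3 + ω) ^ 3 =
        27 * (ff c z * gg c z) ^ 3 + 9 * lam c * (ff c z * gg c z) *
        ((ff c z ^ 3 + ω * gg c z ^ 3 + ω ^ 2) * (ff c z ^ 3 + ω ^ 2 * gg c z ^ 3 + ω)) - 27 * lam c ^ 3 *
          (ff c z * gg c z) ^ 3 := by
      have key : ∀ x y : ℂ, (x + ω * y + ω ^ 2) ^ 3 + (x + ω ^ 2 * y + ω) ^ 3 = 27 * (x * y) +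
          3 * (x + y + 1) * ((x + ω * y + ω ^ 2) * (x + ω ^ 2 * y + ω)) - (x + y + 1) ^ 3 := by
        intro x y
        clear * - w
        grind
      rw [key, e4]
      ring
    generalize (ff c z ^ 3 + ω * gg c z ^ 3 + ω ^ 2) = U at *
    generalize (ff c z ^ 3 + ω ^ 2 * gg c z ^ 3 + ω) = V at *
    generalize lam (fun i => (ω ^ 2 - ω) * c i) = l' at *
    field_simp at e1
    have hfg := mul_ne_zero hf hg
    refine mul_left_cancel₀ (mul_ne_zero (show (9 : ℂ) ≠ 0 by norm_num) hfg) ?_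
    linear_combination e1 - hUV
  have hr0 : ∀ i, Reg (0 + c i) := fun i => by rw [zero_add]; exact hc.reg hp i
  have af := (analyticAt_ff hr0).continuousAt
  have ag := (analyticAt_gg hr0).continuousAt
  have := gen_eq_of_continuous main (x := 0) (by fun_prop) (by fun_prop)
  rw [hc.ff_zero, hc.gg_zero hp] at this
  have hb : lam (fun i => (ω ^ 2 - ω) * c i) * mu c - lam c = 0 := by
    have h3 : (0 ^ 3 + ω * (-1) ^ 3 + ω ^ 2) * (0 ^ 3 + ω ^ 2 * (-1) ^ 3 + ω) ≠ (0 : ℂ) := by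
      have : (0 ^ 3 + ω * (-1) ^ 3 + ω ^ 2) * (0 ^ 3 + ω ^ 2 * (-1) ^ 3 + ω) =
        - (ω ^ 2 - ω) ^ 2 := by ring
      rw [this]; exact neg_ne_zero.2 (pow_ne_zero 2 h_ne)
    exact (mul_eq_zero.1 (this.symm.trans (by ring))).resolve_right h3
  obtain ⟨z, h3, hf, hg⟩ := (main.and (gen_ff_ne (c := c))).exists
  rw [hb, zero_mul] at h3
  have h4 := (mul_eq_zero.1 h3).resolve_left (pow_ne_zero 2 (mul_ne_zero hf hg))
  exact ⟨by linear_combination -hb, by linear_combination h4 / 3⟩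

end Sub

lemma cr_of_st {z w : ℂ} (hz : Reg z) (hw : Reg w) (h1 : s z = s w) (h2 : t z = t w) :
    z - w ∈ Λ := by
  refine φ_cr.1 ?_
  rw [φ_eq hz, φ_eq hw, h1, h2]
  exact (cr_smul_left hz).2 ((cr_smul_right hw).2 (cr_refl _))

lemma φ_congr {z w : ℂ} (h : z - w ∈ Λ) : φ z = φ w := by
  have := φ_periodic w h
  rwa [add_sub_cancel] at this
lemma s_congr {z w : ℂ} (h : z - w ∈ Λ) : s z = s w := by rw [s, s, φ_congr h]
lemma t_congr {z w : ℂ} (h : z - w ∈ Λ) : t z = t w := by rw [t, t, φ_congr h]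
lemma analyticAt_mul_s {k z : ℂ} (h : Reg (k * z)) : AnalyticAt ℂ (fun z => s (k * z)) z :=
  (analyticAt_s h).comp_of_eq (by fun_prop) rfl
lemma analyticAt_mul_t {k z : ℂ} (h : Reg (k * z)) : AnalyticAt ℂ (fun z => t (k * z)) z :=
  (analyticAt_t h).comp_of_eq (by fun_prop) rfl

namespace Sub
variable {p : ℕ} [hpp : Fact p.Prime] {c : ZMod p → ℂ}

lemma lam_congr {c' : ZMod p → ℂ} (u : ZMod p ≃ ZMod p) (hu : u 0 = 0)
    (h : ∀ i, c' i - c (u i) ∈ Λ) : lam c' = lam c := by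
  rw [lam, lam]
  congr 3
  rw [κ, κ]
  refine Finset.prod_bij' (fun i _ => u i) (fun i _ => u.symm i) ?_ ?_ ?_ ?_ ?_
  · intro i hi; simpa [hu] using (u.injective.ne (Finset.ne_of_mem_erase hi))
  · intro i hi
    have := Finset.ne_of_mem_erase hi
    simpa [Equiv.symm_apply_eq, hu] using this
  · simp
  · simp
  · intro i _; rw [s_congr (h i), t_congr (h i)]

omit hpp in
lemma omega_mul (hc : Sub p c) : Sub p fun i => ω * c i :=
  ⟨fun i j => by
    have := omega_mul_mem_hex.2 (hc.add i j)
    convert this using 1; ring, fun i hi => hc.inj i (omega_mul_mem_hex.1 hi)⟩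

lemma lam_omega (hc : Sub p c) (hp : p % 3 = 1) : lam (fun i => ω * c i) = ω ^ 2 * lam c := by
  have h1 := (hc.omega_mul.hesse hp).comp omega_ne_zero 0
  obtain ⟨z, ⟨h1, h2⟩, h3, h4⟩ := ((h1.and (hc.hesse hp)).and (gen_ff_ne (c := c))).exists
  have e1 : ff (fun i => ω * c i) (ω * z + 0) = ω * ff c z := by
    simp only [ff, add_zero, ← mul_add, s_omega, Finset.prod_mul_distrib, Finset.prod_const,
      Finset.card_univ, ZMod.card, pow_p hp omega_cube]
  have e2 : gg (fun i => ω * c i) (ω * z + 0) = gg c z := by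
    simp only [gg, add_zero, ← mul_add, t_omega]
  rw [e1, e2, mul_pow, omega_cube, one_mul, h2] at h1
  have h5 := mul_left_cancel₀ (mul_ne_zero (mul_ne_zero (show (3 : ℂ) ≠ 0 by norm_num) h3) h4)
    (show 3 * ff c z * gg c z * lam c = 3 * ff c z * gg c z * (ω * lam fun i => ω * c i) by
      linear_combination h1)
  rw [h5]
  linear_combination -(lam fun i => ω * c i) * omega_cube

section Stable
variable (hc : Sub p c) (hp : p % 3 = 1) {r : ZMod p} (hr : ∀ i, ω * c i - c (r * i) ∈ Λ)
include hc hp hr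

omit hp in
lemma r_ne : r ≠ 0 := by
  rintro rfl
  have h1 := hr 1
  rw [zero_mul] at h1
  have h2 := omega_mul_mem_hex.1 (by simpa using add_mem h1 hc.zero)
  exact one_ne_zero (hc.inj 1 h2)

lemma lam_stable : lam c = 0 := by
  have h := hc.lam_omega hp
  rw [lam_congr (c := c) (Equiv.mulLeft₀ r (hc.r_ne hr)) (by simp) hr] at h
  have : (1 - ω ^ 2) * lam c = 0 := by linear_combination h
  exact (mul_eq_zero.1 this).resolve_left (sub_ne_zero.2 omega_sq_ne_one.symm)

lemma fermat : Gen fun z => ff c z ^ 3 + gg c z ^ 3 + 1 = 0 :=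
  (hc.hesse hp).mono fun z h => by rw [h, hc.lam_stable hp hr]; ring

lemma fermat_deriv : Gen fun z => ff c z ^ 2 * deriv (ff c) z + gg c z ^ 2 * deriv (gg c) z = 0 := by
  have h := (hc.fermat hp hr).and (gen_nf (c := c))
  refine Gen.mono h fun z hz => ?_
  have e : (fun z => ff c z ^ 3 + gg c z ^ 3 + 1) =ᶠ[𝓝 z] fun _ => 0 := by
    filter_upwards [h.isOpen.mem_nhds hz] with y hy using hy.1
  have d1 := (analyticAt_ff fun i => (hz.2 i).reg).differentiableAt.hasDerivAt
  have d2 := (analyticAt_gg fun i => (hz.2 i).reg).differentiableAt.hasDerivAt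
  have := (((d1.pow 3).fun_add (d2.pow 3)).add_const 1).unique
    ((hasDerivAt_const z (0 : ℂ)).congr_of_eventuallyEq e)
  simp at this
  linear_combination this / 3

omit hc hp hr in
lemma deriv_ff_add {b θ : ℂ} (h : ∀ z, ff c (z + b) = θ * ff c z) (z : ℂ) :
    deriv (ff c) (z + b) = θ * deriv (ff c) z := by
  rw [← deriv_comp_add_const, ← deriv_const_mul_field]
  congr 1; ext z; exact h z

/-- The logarithmic-type quotient showing that the image differential is a multiple of `dz`. -/
noncomputable def qd {p : ℕ} [NeZero p] (c : ZMod p → ℂ) (z : ℂ) : ℂ := deriv (ff c) z / gg c z ^ 2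

lemma qd_T : Gen fun z => qd c (z + T) = 1 * qd c z := by
  refine ((hc.fermat_deriv hp hr).and (gen_nf (c := c))).mono fun z hz => ?_
  obtain ⟨h, hn⟩ := hz
  have h1 : gg c z ≠ 0 := Finset.prod_ne_zero_iff.2 fun i _ => (hn i).t_ne
  have h2 : ff c z ≠ 0 := Finset.prod_ne_zero_iff.2 fun i _ => (hn i).s_ne
  have e : deriv (ff c) (z + T) = - deriv (gg c) z / gg c z ^ 2 := by
    rw [← deriv_comp_add_const]
    have : (fun x => ff c (x + T)) = fun x => (gg c x)⁻¹ := by ext x; exact ff_T x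
    rw [this]
    exact ((analyticAt_gg fun i => (hn i).reg).differentiableAt.hasDerivAt.fun_inv h1).deriv
  rw [qd, e, gg_T fun i => (hn i).reg, qd]
  field_simp
  linear_combination -h

lemma qd_ext (z : ℂ) : Ext (qd c) z := by
  have easy : ∀ z, (∀ i, Reg (z + c i)) → gg c z ≠ 0 → Ext (qd c) z := fun z h1 h2 =>
    ext_of_div (analyticAt_ff h1).deriv ((analyticAt_gg h1).pow 2) (pow_ne_zero 2 h2)
  refine reduce (c := c) (Q := fun z => Ext (qd c) z) ?_ ?_ ?_ ?_ ?_ ?_ z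
  · refine easy 0 (fun i => by rw [zero_add]; exact hc.reg hp i) (by rw [hc.gg_zero hp]; simp)
  · exact fun z hz => easy z (fun i => (hz i).reg) (Finset.prod_ne_zero_iff.2 fun i _ => (hz i).t_ne)
  · exact fun z => ext_shift one_ne_zero (hc.qd_T hp hr)
  · refine fun z => ext_shift one_ne_zero (gen_reg.mono fun z _ => ?_)
    rw [qd, gg_D hp, deriv_ff_add (ff_D hp), qd, mul_pow, ← pow_mul, omega_pow_four,
      mul_div_mul_left _ _ omega_ne_zero, one_mul]
  · refine fun z i => ext_shift one_ne_zero (gen_reg.mono fun z _ => ?_)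
    rw [qd, hc.gg_shift, deriv_ff_add (θ := 1) (fun z => by rw [hc.ff_shift, one_mul]), qd, one_mul]
    ring
  · refine fun z l hl => ext_shift one_ne_zero (gen_reg.mono fun z _ => ?_)
    rw [qd, gg_per z hl, deriv_ff_add (θ := 1) (fun z => by rw [ff_per z hl, one_mul]), qd, one_mul]
    ring

omit hp hr in
/-- The multiplier of the isogeny with kernel `c`. -/
noncomputable def PP {p : ℕ} [NeZero p] (c : ZMod p → ℂ) : ℂ := ∏ i ∈ Finset.univ.erase 0, s (c i)

omit hr in
lemma PP_ne : PP c ≠ 0 := Finset.prod_ne_zero_iff.2 fun _ hi => (hc.nf hp (Finset.ne_of_mem_erase hi)).s_ne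

lemma deriv_gen : Gen fun z => deriv (ff c) z = kc * PP c * gg c z ^ 2 := by
  obtain ⟨k, hk⟩ := liouville (hc.qd_ext hp hr) fun z l hl => by
    rw [qd, gg_per z hl, deriv_ff_add (θ := 1) (fun z => by rw [ff_per z hl, one_mul]), qd, one_mul]
  have h1 : Gen fun z => deriv (ff c) z = k * gg c z ^ 2 := (hk.and (gen_ff_ne (c := c))).mono
    fun z hz => by rw [← hz.1, qd, div_mul_cancel₀ _ (pow_ne_zero 2 hz.2.2)]
  have h0 : ∀ i, Reg (0 + c i) := fun i => by rw [zero_add]; exact hc.reg hp i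
  have := gen_eq_of_continuous h1 (x := 0) (analyticAt_ff h0).deriv.continuousAt
    (((analyticAt_gg h0).pow 2).continuousAt.const_mul k)
  rw [hc.gg_zero hp] at this
  have h2 : deriv (ff c) 0 = kc * PP c := by
    have := hc.deriv_prod_zero (F := s) (fun z l hl => s_per z hl)
      (fun i => analyticAt_s (hc.reg hp i)) s_zero
    rw [(hasDerivAt_s reg_zero).deriv, t_zero] at this
    rw [PP]; refine Eq.trans this ?_; ring
  have h3 : k = kc * PP c := by rw [← h2, this]; ring
  rwa [h3] at h1

lemma hasDeriv_ff {z : ℂ} (h : ∀ i, Reg (z + c i)) :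
    HasDerivAt (ff c) (kc * PP c * gg c z ^ 2) z := by
  have := gen_eq_of_continuous (hc.deriv_gen hp hr) (x := z) (analyticAt_ff h).deriv.continuousAt
    (((analyticAt_gg h).pow 2).continuousAt.const_mul _)
  rw [← this]
  exact (analyticAt_ff h).differentiableAt.hasDerivAt

lemma hasDeriv_gg {z : ℂ} (h : ∀ i, Reg (z + c i)) :
    HasDerivAt (gg c) (-(kc * PP c * ff c z ^ 2)) z := by
  have h1 : Gen fun z => deriv (gg c) z = -(kc * PP c * ff c z ^ 2) := by
    refine (((hc.deriv_gen hp hr).and (hc.fermat_deriv hp hr)).and (gen_ff_ne (c := c))).mono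
      fun z hz => ?_
    obtain ⟨⟨h1, h2⟩, h3, h4⟩ := hz
    rw [h1] at h2
    refine mul_left_cancel₀ (pow_ne_zero 2 h4) ?_
    linear_combination h2
  have := gen_eq_of_continuous h1 (x := z) (analyticAt_gg h).deriv.continuousAt
    (((analyticAt_ff h).pow 2).continuousAt.const_mul _).neg
  rw [← this]
  exact (analyticAt_gg h).differentiableAt.hasDerivAt

lemma fermat_at {z : ℂ} (h : ∀ i, Reg (z + c i)) : ff c z ^ 3 + gg c z ^ 3 + 1 = 0 :=
  gen_eq_of_continuous (hc.fermat hp hr) ((((analyticAt_ff h).pow 3).add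
    ((analyticAt_gg h).pow 3)).add analyticAt_const).continuousAt continuousAt_const

lemma isog_aux {z : ℂ} (hz : (∀ i, Reg (z + c i)) ∧ Reg (-PP c * z)) :
    (gg c z ^ 2 * s (-PP c * z) * t (-PP c * z) - ff c z
      = 0 * (t (-PP c * z) - ff c z * gg c z * s (-PP c * z) ^ 2)) ∧
    (ff c z ^ 2 * s (-PP c * z) - t (-PP c * z) ^ 2 * gg c z
      = -1 * (t (-PP c * z) - ff c z * gg c z * s (-PP c * z) ^ 2)) := by
  have hV : Gen fun z => (∀ i, Reg (z + c i)) ∧ Reg (-PP c * z) :=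
    ((gen_nf (c := c)).mono fun z h i => (h i).reg).and
      (by simpa using gen_reg.comp (neg_ne_zero.2 (hc.PP_ne hp)) 0)
  have hh : (∀ i, Reg (0 + c i)) ∧ Reg (-PP c * 0) :=
    ⟨fun i => by rw [zero_add]; exact hc.reg hp i, by rw [mul_zero]; exact reg_zero⟩
  have d1 := fun z (h : (∀ i, Reg (z + c i)) ∧ Reg (-PP c * z)) => hc.hasDeriv_ff hp hr h.1
  have d2 := fun z (h : (∀ i, Reg (z + c i)) ∧ Reg (-PP c * z)) => hc.hasDeriv_gg hp hr h.1
  have d3 := fun z (h : (∀ i, Reg (z + c i)) ∧ Reg (-PP c * z)) =>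
    (hasDerivAt_s h.2).comp z ((hasDerivAt_id z).const_mul (-PP c))
  have d4 := fun z (h : (∀ i, Reg (z + c i)) ∧ Reg (-PP c * z)) =>
    (hasDerivAt_t h.2).comp z ((hasDerivAt_id z).const_mul (-PP c))
  have a1 := fun z (h : (∀ i, Reg (z + c i)) ∧ Reg (-PP c * z)) => analyticAt_ff h.1
  have a2 := fun z (h : (∀ i, Reg (z + c i)) ∧ Reg (-PP c * z)) => analyticAt_gg h.1
  have a3 : ∀ z, ((∀ i, Reg (z + c i)) ∧ Reg (-PP c * z)) → AnalyticAt ℂ (fun z => s (-PP c * z)) z :=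
    fun z h => analyticAt_mul_s h.2
  have a4 : ∀ z, ((∀ i, Reg (z + c i)) ∧ Reg (-PP c * z)) → AnalyticAt ℂ (fun z => t (-PP c * z)) z :=
    fun z h => analyticAt_mul_t h.2
  constructor
  · refine wronskian hV (N := fun z => gg c z ^ 2 * s (-PP c * z) * t (-PP c * z) - ff c z)
      (D := fun z => t (-PP c * z) - ff c z * gg c z * s (-PP c * z) ^ 2)
      (fun z h => ((((a2 z h).pow 2).mul (a3 z h)).mul (a4 z h)).sub (a1 z h))
      (fun z h => (a4 z h).sub (((a1 z h).mul (a2 z h)).mul ((a3 z h).pow 2)))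
      (fun z h => ((((d2 z h).pow 2).mul (d3 z h)).mul (d4 z h)).sub (d1 z h))
      (fun z h => (d4 z h).sub (((d1 z h).mul (d2 z h)).mul ((d3 z h).pow 2)))
      ?_ hh ?_ ?_ z hz
    · intro z h
      have c1 := hc.fermat_at hp hr h.1
      have c2 := curve h.2
      simp only [Pi.pow_apply, Pi.mul_apply, Function.comp_apply]
      generalize ff c z = a at *
      generalize gg c z = b at *
      generalize s (-PP c * z) = c' at *
      generalize t (-PP c * z) = d at *
      generalize PP c = e at *
      clear d1 d2 d3 d4 a1 a2 a3 a4 hV hh hz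
      grind
    · simp [s_zero, t_zero]
    · simp [s_zero, t_zero, hc.ff_zero]
  · refine wronskian hV (N := fun z => ff c z ^ 2 * s (-PP c * z) - t (-PP c * z) ^ 2 * gg c z)
      (D := fun z => t (-PP c * z) - ff c z * gg c z * s (-PP c * z) ^ 2)
      (fun z h => (((a1 z h).pow 2).mul (a3 z h)).sub (((a4 z h).pow 2).mul (a2 z h)))
      (fun z h => (a4 z h).sub (((a1 z h).mul (a2 z h)).mul ((a3 z h).pow 2)))
      (fun z h => (((d1 z h).pow 2).mul (d3 z h)).sub (((d4 z h).pow 2).mul (d2 z h)))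
      (fun z h => (d4 z h).sub (((d1 z h).mul (d2 z h)).mul ((d3 z h).pow 2)))
      ?_ hh ?_ ?_ z hz
    · intro z h
      have c1 := hc.fermat_at hp hr h.1
      have c2 := curve h.2
      simp only [Pi.pow_apply, Pi.mul_apply, Function.comp_apply]
      generalize ff c z = a at *
      generalize gg c z = b at *
      generalize s (-PP c * z) = c' at *
      generalize t (-PP c * z) = d at *
      generalize PP c = e at *
      clear d1 d2 d3 d4 a1 a2 a3 a4 hV hh hz
      grind
    · simp [s_zero, t_zero, hc.ff_zero]
    · simp [s_zero, t_zero, hc.gg_zero hp, hc.ff_zero]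

/-- The isogeny with kernel `c` is multiplication by `PP c`. -/
lemma isog : Gen fun z => ff c z = s (PP c * z) ∧ gg c z = t (PP c * z) := by
  have hV : Gen fun z => (∀ i, Reg (z + c i)) ∧ Reg (-PP c * z) :=
    ((gen_nf (c := c)).mono fun z h i => (h i).reg).and
      (by simpa using gen_reg.comp (neg_ne_zero.2 (hc.PP_ne hp)) 0)
  have hV' : Gen fun z => (∀ i, Reg (z + c i)) ∧ Reg (PP c * z) :=
    ((gen_nf (c := c)).mono fun z h i => (h i).reg).and
      (by simpa using gen_reg.comp (hc.PP_ne hp) 0)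
  have h0 : (∀ i, Reg (0 + c i)) ∧ Reg (PP c * 0) :=
    ⟨fun i => by rw [zero_add]; exact hc.reg hp i, by rw [mul_zero]; exact reg_zero⟩
  have h0' : (∀ i, Reg (0 + c i)) ∧ Reg (-PP c * 0) :=
    ⟨fun i => by rw [zero_add]; exact hc.reg hp i, by rw [mul_zero]; exact reg_zero⟩
  have hD : ∀ᶠ z in 𝓝 0, t (-PP c * z) - ff c z * gg c z * s (-PP c * z) ^ 2 ≠ 0 := by
    have a : ContinuousAt (fun z => t (-PP c * z) - ff c z * gg c z * s (-PP c * z) ^ 2) 0 :=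
      ((analyticAt_mul_t h0'.2).sub (((analyticAt_ff h0'.1).mul (analyticAt_gg h0'.1)).mul
        ((analyticAt_mul_s h0'.2).pow 2))).continuousAt
    exact a.eventually_ne (by simp [s_zero, t_zero, hc.ff_zero])
  have loc : ∀ᶠ z in 𝓝 0, ff c z = s (PP c * z) ∧ gg c z = t (PP c * z) := by
    filter_upwards [hD, hV.isOpen.mem_nhds h0'] with z h1 h2
    obtain ⟨z', hz', e1, e2⟩ := exists_st (hc.fermat_at hp hr h2.1)
    have hs := isSum_φ z' (-PP c * z)
    obtain ⟨i1, i2⟩ := hc.isog_aux hp hr h2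
    have : z' + -PP c * z - 0 ∈ Λ := by
      refine φ_cr.1 (Cr.symm ?_)
      rw [φ_eq hz', φ_eq h2.2, e1, e2, ← one_smul ℂ (φ (z' + _)),
        isSum_smul hz' h2.2 one_ne_zero] at hs
      have h3 : F2 ![ff c z, gg c z, 1] ![s (-PP c * z), t (-PP c * z), 1] =
          (-(t (-PP c * z) - ff c z * gg c z * s (-PP c * z) ^ 2)) • φ 0 := by
        rw [φ_zero]
        generalize s (-PP c * z) = x at *
        generalize t (-PP c * z) = y at *
        ext i; fin_cases i
        · simp [F2, F1]; linear_combination i1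
        · simp [F2, F1]; linear_combination i2
        · simp [F2, F1]; ring
      have h4 := hs.2
      rw [h3, cr_smul_left (neg_ne_zero.2 h1)] at h4
      exact h4
    have h5 : z' - PP c * z ∈ Λ := by convert this using 1; ring
    rw [← e1, ← e2]
    exact ⟨s_congr h5, t_congr h5⟩
  have i1 := AnalyticOnNhd.eqOn_of_preconnected_of_eventuallyEq (f := ff c) (g := fun z => s (PP c * z))
    (U := {z | (∀ i, Reg (z + c i)) ∧ Reg (PP c * z)}) (fun z hz => analyticAt_ff hz.1)
    (fun z hz => analyticAt_mul_s hz.2) hV'.preconnected h0 (loc.mono fun z h => h.1)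
  have i2 := AnalyticOnNhd.eqOn_of_preconnected_of_eventuallyEq (f := gg c) (g := fun z => t (PP c * z))
    (U := {z | (∀ i, Reg (z + c i)) ∧ Reg (PP c * z)}) (fun z hz => analyticAt_gg hz.1)
    (fun z hz => analyticAt_mul_t hz.2) hV'.preconnected h0 (loc.mono fun z h => h.2)
  exact hV'.mono fun z hz => ⟨i1 hz, i2 hz⟩

end Stable
end Sub
namespace Sub
variable {p : ℕ} [hpp : Fact p.Prime] {c : ZMod p → ℂ}

section Stable
variable (hc : Sub p c) (hp : p % 3 = 1) {r : ZMod p} (hr : ∀ i, ω * c i - c (r * i) ∈ Λ)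
include hc hp hr

lemma isog_shift {b w : ℂ}
    (h : Gen fun z => ff c (z + b) = s (PP c * z + w) ∧ gg c (z + b) = t (PP c * z + w)) :
    PP c * b - w ∈ Λ := by
  have hP := hc.PP_ne hp
  obtain ⟨z, ⟨⟨h1, h2⟩, h3, h4⟩, h5, h6⟩ := ((h.and ((hc.isog hp hr).shift b)).and
    ((gen_reg.comp hP w).and (gen_reg.comp hP (PP c * b)))).exists
  rw [mul_add] at h3 h4
  convert cr_of_st h6 h5 (by rw [← h1, h3]) (by rw [← h2, h4]) using 1
  ring

lemma PP_mul_mem {l : ℂ} (hl : l ∈ Λ) : PP c * l ∈ Λ := by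
  simpa using hc.isog_shift hp hr (b := l) (w := 0) ((hc.isog hp hr).mono fun z h => by
    rw [ff_per z hl, gg_per z hl, add_zero]; exact h)

lemma PP_mul_c (j : ZMod p) : PP c * c j ∈ Λ := by
  simpa using hc.isog_shift hp hr (b := c j) (w := 0) ((hc.isog hp hr).mono fun z h => by
    rw [hc.ff_shift, hc.gg_shift, add_zero]; exact h)

lemma PP_mul_T : PP c * T - T ∈ Λ := by
  refine hc.isog_shift hp hr (((hc.isog hp hr).and ((gen_nf (c := c)).and
    (gen_reg.comp (hc.PP_ne hp) 0))).mono fun z h => ?_)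
  obtain ⟨⟨h1, h2⟩, h3, h4⟩ := h
  rw [add_zero] at h4
  rw [ff_T, gg_T fun i => (h3 i).reg, s_add_T, t_add_T h4, h1, h2]
  exact ⟨rfl, rfl⟩

lemma PP_mul_D : PP c * D - D ∈ Λ := by
  refine hc.isog_shift hp hr ((hc.isog hp hr).mono fun z h => ?_)
  rw [ff_D hp, gg_D hp, s_add_D, t_add_D, h.1, h.2]
  exact ⟨rfl, rfl⟩

lemma mul_PP_flex {z : ℂ} (h : PP c * z ∈ Λ) {m n : ℕ} (h' : z + m * T + n * D ∈ Λ) : z ∈ Λ := by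
  have h1 := hc.PP_mul_mem hp hr h'
  have h2 := hc.PP_mul_T hp hr
  have h3 := hc.PP_mul_D hp hr
  have e : z = (z + m * T + n * D) - PP c * (z + m * T + n * D) + PP c * z + m • (PP c * T - T) +
    n • (PP c * D - D) := by
    simp only [nsmul_eq_mul]; ring
  rw [e]
  exact add_mem (add_mem (add_mem (sub_mem h' h1) h) (_root_.nsmul_mem h2 m)) (_root_.nsmul_mem h3 n)

lemma PP_ker {z : ℂ} (h : PP c * z ∈ Λ) : ∃ i, z + c i ∈ Λ := by
  by_contra! H
  have hn : ∀ i, NF (z + c i) := fun i => by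
    by_contra hn
    obtain ⟨m, n, hmn⟩ := exists_flex hn
    refine H i (hc.mul_PP_flex hp hr ?_ hmn)
    rw [mul_add]
    exact add_mem h (hc.PP_mul_c hp hr i)
  have h1 := gen_eq_of_continuous ((hc.isog hp hr).mono fun z h => h.1) (x := z)
    (analyticAt_ff fun i => (hn i).reg).continuousAt (analyticAt_mul_s (reg_of_mem h)).continuousAt
  have h2 : s (PP c * z) = 0 := by
    rw [s_congr (w := 0) (by simpa using h), s_zero]
  exact Finset.prod_ne_zero_iff.2 (fun i _ => (hn i).s_ne) (h1.trans h2)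

end Stable
end Sub

section Torsion
variable {p : ℕ} [hpp : Fact p.Prime]

lemma div_mem_iff {X Y : ℤ} : ((X : ℂ) + Y * ω) / p ∈ Λ ↔ (X : ZMod p) = 0 ∧ (Y : ZMod p) = 0 := by
  have hp : (p : ℂ) ≠ 0 := by exact_mod_cast hpp.out.ne_zero
  rw [ZMod.intCast_zmod_eq_zero_iff_dvd, ZMod.intCast_zmod_eq_zero_iff_dvd, mem_hex]
  constructor
  · rintro ⟨m, n, h⟩
    rw [eq_div_iff hp] at h
    have h2 : ((X - m * p : ℤ) : ℂ) + ((Y - n * p : ℤ) : ℂ) * ω = 0 := by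
      push_cast; linear_combination -h
    have him := congrArg Complex.im h2
    simp only [Complex.add_im, Complex.intCast_im, Complex.mul_im, Complex.intCast_re, zero_mul,
      add_zero, zero_add, Complex.zero_im, mul_eq_zero, omega_im_ne_zero, or_false] at him
    rw [show ((Y - n * p : ℤ) : ℂ) = 0 by
      rw [← Complex.ofReal_intCast, him]; simp, zero_mul, add_zero] at h2
    have him' : Y - n * p = 0 := by exact_mod_cast him
    have h2' : X - m * p = 0 := by exact_mod_cast h2
    exact ⟨⟨m, by linarith⟩, ⟨n, by linarith⟩⟩
  · rintro ⟨⟨m, rfl⟩, ⟨n, rfl⟩⟩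
    refine ⟨m, n, ?_⟩
    push_cast; field_simp

/-- The `p`-torsion point with coordinates `a, b` in an eigenbasis for `ω`. -/
noncomputable def Pt (r a b : ZMod p) : ℂ :=
  (((a.val * (1 + r.val) - b.val * r.val : ℤ) : ℂ) + ((a.val + b.val : ℤ) : ℂ) * ω) / p

lemma Pt_add (r a b a' b' : ZMod p) : Pt r (a + a') (b + b') - (Pt r a b + Pt r a' b') ∈ Λ := by
  have : Pt r (a + a') (b + b') - (Pt r a b + Pt r a' b') =
    (((((a + a').val * (1 + r.val) - (b + b').val * r.val) - (a.val * (1 + r.val) - b.val * r.val)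
      - (a'.val * (1 + r.val) - b'.val * r.val) : ℤ) : ℂ) +
      (((a + a').val + (b + b').val - (a.val + b.val) - (a'.val + b'.val) : ℤ) : ℂ) * ω) / p := by
    simp only [Pt]; push_cast; ring
  rw [this, div_mem_iff]
  push_cast
  simp only [ZMod.natCast_val, ZMod.cast_id', id]
  constructor <;> ring

variable {r : ZMod p} (hr : r ^ 2 + r + 1 = 0) (hp : p % 3 = 1)

include hr in
lemma omega_mul_Pt (a b : ZMod p) : ω * Pt r a b - Pt r (r * a) (r ^ 2 * b) ∈ Λ := by
  have : ω * Pt r a b - Pt r (r * a) (r ^ 2 * b) =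
    (((-(a.val + b.val) - ((r * a).val * (1 + r.val) - (r ^ 2 * b).val * r.val) : ℤ) : ℂ) +
      (((a.val * (1 + r.val) - b.val * r.val) - (a.val + b.val) -
        ((r * a).val + (r ^ 2 * b).val) : ℤ) : ℂ) * ω) / p := by
    simp only [Pt]; push_cast
    have := omega_sq
    linear_combination ((a.val + b.val : ℂ) / p) * this
  rw [this, div_mem_iff]
  push_cast
  simp only [ZMod.natCast_val, ZMod.cast_id', id]
  constructor
  · linear_combination (-a - b + r * b) * hr
  · linear_combination (- b) * hr

include hp in
lemma three_ne_zero_zmod : (3 : ZMod p) ≠ 0 := fun h => by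
  have : ((3 : ℕ) : ZMod p) = 0 := by exact_mod_cast h
  rw [ZMod.natCast_eq_zero_iff] at this
  have := (Nat.dvd_prime Nat.prime_three).1 this
  have := hpp.out.one_lt
  omega

include hr hp in
lemma two_mul_r_add_one_ne : 1 + 2 * r ≠ 0 := fun h => three_ne_zero_zmod hp (by
  linear_combination -(1 + 2 * r) * h + 4 * hr)

include hr hp in
lemma Pt_inj {a b : ZMod p} (h : Pt r a b ∈ Λ) : a = 0 ∧ b = 0 := by
  rw [Pt, div_mem_iff] at h
  push_cast at h
  simp only [ZMod.natCast_val, ZMod.cast_id', id] at h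
  obtain ⟨h1, h2⟩ := h
  have : (1 + 2 * r) * a = 0 := by linear_combination h1 + r * h2
  have ha := (mul_eq_zero.1 this).resolve_left (two_mul_r_add_one_ne hr hp)
  exact ⟨ha, by simpa [ha] using h2⟩

include hr hp in
lemma exists_Pt {z : ℂ} (h : p * z ∈ Λ) : ∃ a b : ZMod p, z - Pt r a b ∈ Λ := by
  have hp0 : (p : ℂ) ≠ 0 := by exact_mod_cast hpp.out.ne_zero
  obtain ⟨x, y, hxy⟩ := mem_hex.1 h
  have hz : z = (x + y * ω) / p := by rw [hxy]; field_simp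
  have h2 := two_mul_r_add_one_ne hr hp
  set a : ZMod p := (x + y * r) / (1 + 2 * r) with ha
  have ha' : a * (1 + 2 * r) = x + y * r := div_mul_cancel₀ _ h2
  refine ⟨a, y - a, ?_⟩
  have : z - Pt r a (y - a) = (((x - (a.val * (1 + r.val) - (y - a).val * r.val) : ℤ) : ℂ) +
    ((y - (a.val + (y - a).val) : ℤ) : ℂ) * ω) / p := by
    rw [hz]; simp only [Pt]; push_cast; ring
  rw [this, div_mem_iff]
  push_cast
  simp only [ZMod.natCast_val, ZMod.cast_id', id]
  constructor
  · linear_combination -ha'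
  · ring

/-- The cyclic subgroup spanned by `Pt r a b`. -/
noncomputable def cyc (r a b : ZMod p) (k : ZMod p) : ℂ := Pt r (k * a) (k * b)

include hr hp in
lemma sub_cyc {a b : ZMod p} (h : a ≠ 0 ∨ b ≠ 0) : Sub p (cyc r a b) := by
  refine ⟨fun i j => ?_, fun i hi => ?_⟩
  · simp only [cyc, add_mul]; exact Pt_add _ _ _ _ _
  · obtain ⟨h1, h2⟩ := Pt_inj hr hp hi
    rcases h with h | h
    · exact (mul_eq_zero.1 h1).resolve_right h
    · exact (mul_eq_zero.1 h2).resolve_right h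

include hr in
lemma omega_cyc (a b k : ZMod p) : ω * cyc r a b k - cyc r (r * a) (r ^ 2 * b) k ∈ Λ := by
  rw [cyc, cyc, show k * (r * a) = r * (k * a) by ring, show k * (r ^ 2 * b) = r ^ 2 * (k * b) by ring]
  exact omega_mul_Pt hr _ _

include hr in
lemma omega_cyc_left (k : ZMod p) : ω * cyc r 1 0 k - cyc r 1 0 (r * k) ∈ Λ := by
  have := omega_mul_Pt hr k 0
  rw [mul_zero] at this
  simpa only [cyc, mul_one, mul_zero] using this

include hr in
lemma omega_cyc_right (k : ZMod p) : ω * cyc r 0 1 k - cyc r 0 1 (r ^ 2 * k) ∈ Λ := by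
  have := omega_mul_Pt hr 0 k
  rw [mul_zero] at this
  simpa only [cyc, mul_one, mul_zero] using this

lemma Pt_sub (r a b a' b' : ZMod p) : Pt r (a - a') (b - b') - (Pt r a b - Pt r a' b') ∈ Λ := by
  have := Pt_add r (a - a') (b - b') a' b'
  rw [sub_add_cancel, sub_add_cancel] at this
  convert neg_mem this using 1; ring

include hr hp in
lemma p_mul_Pt (a b : ZMod p) : p * Pt r a b ∈ Λ := by
  by_cases h : a ≠ 0 ∨ b ≠ 0
  · have hc := sub_cyc hr hp h
    have := hc.nsmul p 1
    rw [CharP.cast_eq_zero, zero_mul] at this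
    simpa [cyc] using sub_mem hc.zero this
  · push Not at h
    simp [h.1, h.2, Pt]

section Mult
open CubeSum.Sub

/-- Multipliers of the two `ω`-stable subgroups. -/
noncomputable def π₁ (r : ZMod p) : ℂ := PP (cyc r 1 0)
noncomputable def π₂ (r : ZMod p) : ℂ := PP (cyc r 0 1)

include hr hp

lemma π₁_mul_Pt (a : ZMod p) : π₁ r * Pt r a 0 ∈ Λ := by
  have := (sub_cyc hr hp (Or.inl one_ne_zero)).PP_mul_c hp (omega_cyc_left hr) a
  rwa [cyc, mul_one, mul_zero] at this

lemma π₂_mul_Pt (b : ZMod p) : π₂ r * Pt r 0 b ∈ Λ := by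
  have := (sub_cyc hr hp (Or.inr one_ne_zero)).PP_mul_c hp (omega_cyc_right hr) b
  rwa [cyc, mul_one, mul_zero] at this

lemma π₁_mem : π₁ r ∈ Λ := by
  have := (sub_cyc hr hp (Or.inl one_ne_zero)).PP_mul_mem hp (omega_cyc_left hr) one_mem_hex
  rwa [mul_one] at this

lemma π₂_mem : π₂ r ∈ Λ := by
  have := (sub_cyc hr hp (Or.inr one_ne_zero)).PP_mul_mem hp (omega_cyc_right hr) one_mem_hex
  rwa [mul_one] at this

lemma π₁_ker {z : ℂ} (h : π₁ r * z ∈ Λ) : ∃ a, z + Pt r a 0 ∈ Λ := by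
  obtain ⟨i, hi⟩ := (sub_cyc hr hp (Or.inl one_ne_zero)).PP_ker hp (omega_cyc_left hr) h
  exact ⟨i, by simpa [cyc] using hi⟩

lemma π₂_ker {z : ℂ} (h : π₂ r * z ∈ Λ) : ∃ b, z + Pt r 0 b ∈ Λ := by
  obtain ⟨i, hi⟩ := (sub_cyc hr hp (Or.inr one_ne_zero)).PP_ker hp (omega_cyc_right hr) h
  exact ⟨i, by simpa [cyc] using hi⟩

lemma π₁_ne : π₁ r ≠ 0 := (sub_cyc hr hp (Or.inl one_ne_zero)).PP_ne hp
lemma π₂_ne : π₂ r ≠ 0 := (sub_cyc hr hp (Or.inr one_ne_zero)).PP_ne hp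

lemma p_div_mem : p / (π₁ r * π₂ r) ∈ Λ := by
  have n1 := π₁_ne hr hp
  have n2 := π₂_ne hr hp
  set w := p / (π₁ r * π₂ r) with hw
  have k1 : π₁ r * w ∈ Λ := by
    obtain ⟨b, hb⟩ := π₂_ker hr hp (z := 1 / π₂ r) (by
      rw [mul_one_div_cancel n2]; exact one_mem_hex)
    convert sub_mem (mul_mem_hex (intCast_mem_hex p) hb) (p_mul_Pt hr hp 0 b) using 1
    rw [hw]; push_cast; field_simp; ring
  have k2 : π₂ r * w ∈ Λ := by
    obtain ⟨b, hb⟩ := π₁_ker hr hp (z := 1 / π₁ r) (by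
      rw [mul_one_div_cancel n1]; exact one_mem_hex)
    convert sub_mem (mul_mem_hex (intCast_mem_hex p) hb) (p_mul_Pt hr hp b 0) using 1
    rw [hw]; push_cast; field_simp; ring
  obtain ⟨a, ha⟩ := π₁_ker hr hp k1
  obtain ⟨b, hb⟩ := π₂_ker hr hp k2
  have := Pt_sub r a 0 0 b
  have h := Pt_inj hr hp (a := a - 0) (b := 0 - b) (by
    convert add_mem this (sub_mem ha hb) using 1; ring)
  rw [sub_zero] at h
  rw [h.1] at ha
  convert ha using 1
  simp [Pt]

lemma div_p_mem : π₁ r * π₂ r / p ∈ Λ := by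
  have hp0 : (p : ℂ) ≠ 0 := by exact_mod_cast hpp.out.ne_zero
  have m1 := π₁_mem hr hp
  have m2 := π₂_mem hr hp
  obtain ⟨a, b, h⟩ := exists_Pt hr hp (z := 1 / p) (by rw [mul_one_div_cancel hp0]; exact one_mem_hex)
  have h2 := Pt_add r a 0 0 b
  rw [add_zero, zero_add] at h2
  have m12 := mul_mem_hex m1 m2
  convert add_mem (add_mem (mul_mem_hex m12 h) (mul_mem_hex m12 h2)) (add_mem
    (mul_mem_hex m2 (π₁_mul_Pt hr hp a)) (mul_mem_hex m1 (π₂_mul_Pt hr hp b))) using 1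
  field_simp; ring

omit hr hp hpp in
lemma D_not_mem : D ∉ Λ := fun h => by
  have h1 := t_congr (z := D) (w := 0) (by simpa using h)
  rw [t_D, t_zero, neg_inj] at h1
  exact omega_sq_ne_one h1

omit hr hp hpp in
lemma unit_eq_one {u w : ℂ} (hu : u ∈ Λ) (hw : w ∈ Λ) (h : u * w = 1) (hT : u * T - T ∈ Λ)
    (hD : u * D - D ∈ Λ) : u = 1 := by
  obtain ⟨m, n, rfl⟩ := mem_hex.1 hu
  obtain ⟨m', n', rfl⟩ := mem_hex.1 hw
  have ho := omega_sq
  have e : ((m * m' - n * n' - 1 : ℤ) : ℂ) + ((m * n' + n * m' - n * n' : ℤ) : ℂ) * ω = 0 := by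
    push_cast; linear_combination h - (n * n' : ℂ) * ho
  have him := congrArg Complex.im e
  simp only [Complex.add_im, Complex.intCast_im, Complex.mul_im, Complex.intCast_re, zero_mul,
    add_zero, zero_add, Complex.zero_im, mul_eq_zero, omega_im_ne_zero, or_false] at him
  have e2 : m * n' + n * m' - n * n' = 0 := by exact_mod_cast him
  rw [e2, Int.cast_zero, zero_mul, add_zero] at e
  have e1 : m * m' - n * n' - 1 = 0 := by exact_mod_cast e
  have hN : (m ^ 2 - m * n + n ^ 2) * (m' ^ 2 - m' * n' + n' ^ 2) = 1 := by
    have : (m ^ 2 - m * n + n ^ 2) * (m' ^ 2 - m' * n' + n' ^ 2) = (m * m' - n * n') ^ 2 -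
      (m * m' - n * n') * (m * n' + n * m' - n * n') + (m * n' + n * m' - n * n') ^ 2 := by ring
    rw [this, e2, show m * m' - n * n' = 1 by linarith]; norm_num
  have hN1 : m ^ 2 - m * n + n ^ 2 = 1 := by
    rcases Int.eq_one_or_neg_one_of_mul_eq_one hN with h | h
    · exact h
    · nlinarith [sq_nonneg (2 * m - n), sq_nonneg n]
  have bn1 : n ≤ 1 := by nlinarith [sq_nonneg (2 * m - n)]
  have bn2 : -1 ≤ n := by nlinarith [sq_nonneg (2 * m - n)]
  have bm1 : m ≤ 1 := by nlinarith [sq_nonneg (2 * n - m)]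
  have bm2 : -1 ≤ m := by nlinarith [sq_nonneg (2 * n - m)]
  have hwD := omega_D
  have h3D := three_D
  have hsT : s (ω * T) = ω * s T := s_omega T
  have hssT : s (ω * (ω * T)) = ω * (ω * s T) := by rw [s_omega, s_omega]
  clear hN e e1 e2 him hw hu h
  interval_cases n <;> interval_cases m <;> simp at hN1 hT hD ⊢
  · have := s_congr (z := ω * (ω * T)) (w := T) (by
      convert hT using 1; linear_combination T * ho)
    rw [hssT, s_T] at this
    exfalso
    exact omega_sq_ne_one (by linear_combination -this)
  · refine (D_not_mem ?_).elim
    convert add_mem (add_mem hD hwD) h3D using 1; ring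
  · refine (D_not_mem ?_).elim
    convert add_mem hD h3D using 1; ring
  · have := s_congr (z := ω * T) (w := T) (by convert hT using 1)
    rw [hsT, s_T] at this
    exact (omega_ne_one (by linear_combination -this)).elim
  · refine (D_not_mem ?_).elim
    convert sub_mem hD hwD using 1; ring

lemma π₁_mul_π₂ : π₁ r * π₂ r = p := by
  have hp0 : (p : ℂ) ≠ 0 := by exact_mod_cast hpp.out.ne_zero
  have n1 := π₁_ne hr hp
  have n2 := π₂_ne hr hp
  have h1 := sub_cyc hr hp (a := 1) (b := 0) (Or.inl one_ne_zero)
  have h2 := sub_cyc hr hp (a := 0) (b := 1) (Or.inr one_ne_zero)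
  have key : ∀ W : ℂ, 3 * W ∈ Λ → π₁ r * W - W ∈ Λ → π₂ r * W - W ∈ Λ →
      p / (π₁ r * π₂ r) * W - W ∈ Λ := fun W h3 k1 k2 => by
    have hu := p_div_mem hr hp
    have e1 := mul_mem_hex hu (mul_mem_hex (π₁_mem hr hp) k2)
    have e2 := mul_mem_hex hu k1
    have e3 : p * W - W ∈ Λ := by
      convert _root_.nsmul_mem h3 (p / 3) using 1
      have : (p : ℂ) = 3 * (p / 3 : ℕ) + 1 := by
        have : p = 3 * (p / 3) + 1 := by omega
        exact_mod_cast this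
      rw [nsmul_eq_mul]
      linear_combination W * this
    convert sub_mem e3 (add_mem e1 e2) using 1
    field_simp; ring
  have := unit_eq_one (p_div_mem hr hp) (div_p_mem hr hp) (by field_simp)
    (key T three_T (h1.PP_mul_T hp (omega_cyc_left hr)) (h2.PP_mul_T hp (omega_cyc_right hr)))
    (key D three_D (h1.PP_mul_D hp (omega_cyc_left hr)) (h2.PP_mul_D hp (omega_cyc_right hr)))
  field_simp at this
  exact this.symm

end Mult
end Torsion

section Place
variable (B : ValuationSubring ℂ)

/-- `a` is the residue of the `B`-integral number `x`. -/
def Rd (x : ℂ) (a : IsLocalRing.ResidueField B) : Prop := ∃ h : x ∈ B, IsLocalRing.residue B ⟨x, h⟩ = a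

variable {B}

namespace Rd
variable {x y : ℂ} {a b : (IsLocalRing.ResidueField B)}

lemma mk (h : x ∈ B) : ∃ a, Rd B x a := ⟨_, h, rfl⟩
lemma unique (h : Rd B x a) (h' : Rd B x b) : a = b := h.2.symm.trans h'.2
lemma one : Rd B 1 1 := ⟨one_mem B, map_one _⟩
lemma zero : Rd B 0 0 := ⟨zero_mem B, map_zero _⟩
lemma add (h : Rd B x a) (h' : Rd B y b) : Rd B (x + y) (a + b) :=
  ⟨add_mem h.1 h'.1, by rw [← h.2, ← h'.2, ← map_add]; rfl⟩
lemma mul (h : Rd B x a) (h' : Rd B y b) : Rd B (x * y) (a * b) :=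
  ⟨mul_mem h.1 h'.1, by rw [← h.2, ← h'.2, ← map_mul]; rfl⟩
lemma neg (h : Rd B x a) : Rd B (-x) (-a) := ⟨neg_mem h.1, by rw [← h.2, ← map_neg]; rfl⟩
lemma sub (h : Rd B x a) (h' : Rd B y b) : Rd B (x - y) (a - b) := by
  rw [sub_eq_add_neg, sub_eq_add_neg]; exact h.add h'.neg
lemma pow (h : Rd B x a) (n : ℕ) : Rd B (x ^ n) (a ^ n) :=
  ⟨pow_mem h.1 n, by rw [← h.2, ← map_pow]; rfl⟩
lemma natCast (n : ℕ) : Rd B n n := ⟨natCast_mem B n, map_natCast _ n⟩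
lemma intCast (n : ℤ) : Rd B n n := ⟨intCast_mem B n, map_intCast _ n⟩
lemma prod {ι : Type*} {S : Finset ι} {f : ι → ℂ} {g : ι → (IsLocalRing.ResidueField B)} (h : ∀ i ∈ S, Rd B (f i) (g i)) :
    Rd B (∏ i ∈ S, f i) (∏ i ∈ S, g i) := by
  classical
  induction S using Finset.induction_on with
  | empty => simpa using one
  | insert i S hi ih =>
    rw [Finset.prod_insert hi, Finset.prod_insert hi]
    exact (h i (Finset.mem_insert_self i S)).mul (ih fun j hj => h j (Finset.mem_insert_of_mem hj))
lemma ne (h : Rd B x a) (ha : a ≠ 0) : x ≠ 0 := by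
  rintro rfl; exact ha (h.unique zero)
lemma inv (h : Rd B x a) (ha : a ≠ 0) : Rd B x⁻¹ a⁻¹ := by
  have hx := h.ne ha
  have hm : x⁻¹ ∈ B := by
    have hu : IsUnit (⟨x, h.1⟩ : B) := by
      by_contra hu
      exact ha (h.2 ▸ (IsLocalRing.residue_eq_zero_iff _).2 hu)
    obtain ⟨y, hy⟩ := hu.exists_right_inv
    have e : x * y = 1 := congrArg Subtype.val hy
    rw [inv_eq_of_mul_eq_one_right e]; exact y.2
  obtain ⟨b, hb⟩ := mk hm
  have := (h.mul hb).unique (by rw [mul_inv_cancel₀ hx]; exact one)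
  rwa [inv_eq_of_mul_eq_one_right this]
lemma div (h : Rd B x a) (h' : Rd B y b) (hb : b ≠ 0) : Rd B (x / y) (a / b) := by
  rw [div_eq_mul_inv, div_eq_mul_inv]; exact h.mul (h'.inv hb)
lemma surj (a : (IsLocalRing.ResidueField B)) : ∃ x, Rd B x a := by
  obtain ⟨x, hx⟩ := IsLocalRing.residue_surjective a
  exact ⟨x, x.2, hx⟩
lemma of_pow {n : ℕ} (hn : n ≠ 0) (h : Rd B (x ^ n) a) : x ∈ B := by
  rcases B.mem_or_inv_mem x with h' | h'
  · exact h'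
  · by_cases hx : x = 0
    · rw [hx]; exact zero_mem B
    · obtain ⟨m, rfl⟩ := Nat.exists_eq_succ_of_ne_zero hn
      have := mul_mem h.1 (pow_mem h' m)
      rwa [pow_succ', mul_assoc, ← mul_pow, mul_inv_cancel₀ hx, one_pow, mul_one] at this
end Rd

lemma Cr.rd {u v : Fin 3 → ℂ} {u' v' : Fin 3 → (IsLocalRing.ResidueField B)} (h : Cr u v) (hu : ∀ i, Rd B (u i) (u' i))
    (hv : ∀ i, Rd B (v i) (v' i)) : Cr u' v' := fun i j =>
  ((hu i).mul (hv j)).unique (by rw [h i j]; exact (hu j).mul (hv i))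

lemma rd_F1 {u v : Fin 3 → ℂ} {u' v' : Fin 3 → (IsLocalRing.ResidueField B)} (hu : ∀ i, Rd B (u i) (u' i))
    (hv : ∀ i, Rd B (v i) (v' i)) (i : Fin 3) : Rd B (F1 u v i) (F1 u' v' i) := by
  fin_cases i
  · exact ((((hu 0).pow 2).mul (hv 1)).mul (hv 2)).sub ((((hv 0).pow 2).mul (hu 1)).mul (hu 2))
  · exact ((((hu 2).pow 2).mul (hv 0)).mul (hv 1)).sub ((((hv 2).pow 2).mul (hu 0)).mul (hu 1))
  · exact ((((hu 1).pow 2).mul (hv 0)).mul (hv 2)).sub ((((hv 1).pow 2).mul (hu 0)).mul (hu 2))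

lemma rd_F2 {u v : Fin 3 → ℂ} {u' v' : Fin 3 → (IsLocalRing.ResidueField B)} (hu : ∀ i, Rd B (u i) (u' i))
    (hv : ∀ i, Rd B (v i) (v' i)) (i : Fin 3) : Rd B (F2 u v i) (F2 u' v' i) := by
  refine rd_F1 ?_ ?_ i <;> intro j <;> fin_cases j
  exacts [hu 1, hu 2, hu 0, hv 2, hv 0, hv 1]

variable (B) in
/-- `u` represents the reduction of the point `φ z`. -/
def Red (z : ℂ) (u : Fin 3 → (IsLocalRing.ResidueField B)) : Prop :=
  u ≠ 0 ∧ ∃ ρ : ℂ, ρ ≠ 0 ∧ ∃ v : Fin 3 → ℂ, φ z = ρ • v ∧ ∀ i, Rd B (v i) (u i)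

namespace Red
variable {z w : ℂ} {u v x : Fin 3 → (IsLocalRing.ResidueField B)}

lemma exists' (z : ℂ) : ∃ u, Red B z u := by
  obtain ⟨i, -, hi⟩ := Finset.exists_max_image Finset.univ (fun i => B.valuation (φ z i))
    Finset.univ_nonempty
  have hne : φ z i ≠ 0 := fun h => φ_ne_zero z (funext fun j => by
    have := hi j (Finset.mem_univ j)
    rw [h, map_zero] at this
    simpa using this)
  have hm : ∀ j, φ z j / φ z i ∈ B := fun j => by
    rw [← B.valuation_le_one_iff, map_div₀]
    exact div_le_one_of_le₀ (hi j (Finset.mem_univ j)) zero_le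
  choose u hu using fun j => Rd.mk (hm j)
  refine ⟨u, fun h => ?_, φ z i, hne, fun j => φ z j / φ z i, ?_, hu⟩
  · have := hu i
    rw [div_self hne, h] at this
    exact one_ne_zero (Rd.one.unique this)
  · ext j; simp [mul_div_cancel₀ _ hne]

lemma ne (h : Red B z u) : u ≠ 0 := h.1

lemma curve (h : Red B z u) : u 0 ^ 3 + u 1 ^ 3 + u 2 ^ 3 = 0 := by
  obtain ⟨-, ρ, hρ, v, hv, hr⟩ := h
  have c := φ_curve z
  rw [hv] at c
  simp only [Pi.smul_apply, smul_eq_mul, mul_pow, ← mul_add] at c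
  have c' := (mul_eq_zero.1 c).resolve_left (pow_ne_zero 3 hρ)
  exact ((((hr 0).pow 3).add ((hr 1).pow 3)).add ((hr 2).pow 3)).unique (c' ▸ Rd.zero)

lemma congr (h : Red B z u) (hzw : z - w ∈ Λ) : Red B w u := by
  rwa [Red, φ_congr hzw] at h

lemma cr (h : Red B z u) (h' : Red B z v) : Cr u v := by
  obtain ⟨-, ρ, hρ, a, ha, hra⟩ := h
  obtain ⟨-, ρ', hρ', b, hb, hrb⟩ := h'
  refine Cr.rd ?_ hra hrb
  rw [← cr_smul_left hρ, ← cr_smul_right hρ', ← ha, ← hb]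
  exact cr_refl _

lemma of_cr (h : Red B z u) (hv : v ≠ 0) (hc : Cr u v) : Red B z v := by
  obtain ⟨ρ, hρ, rfl⟩ := hc.symm.exists_smul hv h.ne
  obtain ⟨hu, ρ', hρ', a, ha, hra⟩ := h
  obtain ⟨y, hy⟩ := Rd.surj ρ
  have hy0 := hy.ne hρ
  refine ⟨hv, ρ' / y, div_ne_zero hρ' hy0, y • a, ?_, fun i => hy.mul (hra i)⟩
  rw [smul_smul, div_mul_cancel₀ _ hy0, ha]

lemma isSum (h : Red B z u) (h' : Red B w v) (h'' : Red B (z + w) x) : IsSum u v x := by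
  obtain ⟨-, ρ, hρ, a, ha, hra⟩ := h
  obtain ⟨-, ρ', hρ', b, hb, hrb⟩ := h'
  obtain ⟨-, ρ'', hρ'', c, hc, hrc⟩ := h''
  have := isSum_φ z w
  rw [ha, hb, hc, isSum_smul hρ hρ' hρ''] at this
  exact ⟨this.1.rd (rd_F1 hra hrb) hrc, this.2.rd (rd_F2 hra hrb) hrc⟩

lemma add (h3 : (3 : (IsLocalRing.ResidueField B)) ≠ 0) (h : Red B z u) (h' : Red B w v) (hx : x ≠ 0) (hs : IsSum u v x) :
    Red B (z + w) x := by
  obtain ⟨y, hy⟩ := exists' (B := B) (z + w)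
  exact hy.of_cr hx (IsSum.unique h3 h.ne h'.ne h.curve h'.curve (h.isSum h' hy) hs)

lemma st (h : Red B z u) (h2 : u 2 ≠ 0) :
    Reg z ∧ Rd B (s z) (u 0 / u 2) ∧ Rd B (t z) (u 1 / u 2) := by
  obtain ⟨-, ρ, hρ, a, ha, hra⟩ := h
  obtain ⟨e1, e2, e3⟩ := st_of_prop hρ ha
  rw [e2, e3]
  exact ⟨e1.2 ((hra 2).ne h2), (hra 0).div (hra 2) h2, (hra 1).div (hra 2) h2⟩

lemma of_st {a b : (IsLocalRing.ResidueField B)} (h : Reg z) (hs : Rd B (s z) a) (ht : Rd B (t z) b) : Red B z ![a, b, 1] := by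
  refine ⟨fun h => one_ne_zero (congrFun h 2), _, h, _, φ_eq h, fun i => ?_⟩
  fin_cases i
  exacts [hs, ht, Rd.one]

lemma zero : Red B 0 ![0, -1, 1] :=
  of_st reg_zero (by rw [s_zero]; exact Rd.zero) (by rw [t_zero]; exact Rd.one.neg)

lemma of_mem (h : z ∈ Λ) : Red B z ![0, -1, 1] := zero.congr (by simpa using neg_mem h)

end Red

lemma isSum_torsion {k : Type*} [Field k] {a b : k} (ha : a ^ 3 = 1) (hb : b ^ 3 = 1) :
    IsSum ![0, -a, 1] ![0, -b, 1] ![0, -(a * b), 1] := by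
  constructor <;> intro i j <;> fin_cases i <;> fin_cases j <;> simp [F1, F2] <;> grind

lemma isSum_zero_right {k : Type*} [Field k] (u : Fin 3 → k) (c : u 0 ^ 3 + u 1 ^ 3 + u 2 ^ 3 = 0) :
    IsSum u ![0, -1, 1] u := by
  constructor <;> intro i j <;> fin_cases i <;> fin_cases j <;> simp [F1, F2] <;> grind

lemma isSum_flex {k : Type*} [Field k] (u : Fin 3 → k) (c : u 0 ^ 3 + u 1 ^ 3 + u 2 ^ 3 = 0)
    (h : u 0 * u 1 * u 2 = 0) : IsSum u u ![u 0, u 2, u 1] := by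
  constructor <;> intro i j <;> fin_cases i <;> fin_cases j <;> simp [F1, F2] <;> grind

lemma isSum_neg {k : Type*} [Field k] (u : Fin 3 → k) (c : u 0 ^ 3 + u 1 ^ 3 + u 2 ^ 3 = 0) :
    IsSum u ![u 0, u 2, u 1] ![0, -1, 1] := by
  constructor <;> intro i j <;> fin_cases i <;> fin_cases j <;> simp [F1, F2] <;> grind

lemma swap_ne {k : Type*} [Field k] {u : Fin 3 → k} (hu : u ≠ 0) : ![u 0, u 2, u 1] ≠ 0 := fun h =>
  hu (by ext i; fin_cases i; exacts [congrFun h 0, congrFun h 2, congrFun h 1])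

lemma O_ne {k : Type*} [Field k] (a : k) : (![0, a, 1] : Fin 3 → k) ≠ 0 := fun h => one_ne_zero (congrFun h 2)

namespace Red
variable {z w : ℂ} {u v x : Fin 3 → (IsLocalRing.ResidueField B)}

lemma three_mul (h3 : (3 : (IsLocalRing.ResidueField B)) ≠ 0) (h : Red B z u) (hu : u 0 * u 1 * u 2 = 0) :
    Red B (3 * z) ![0, -1, 1] := by
  have e : 3 * z = z + (z + z) := by ring
  rw [e]
  exact Red.add h3 h (Red.add h3 h h (swap_ne h.ne) (isSum_flex u h.curve hu)) (O_ne _) (isSum_neg u h.curve)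

lemma add_O (h3 : (3 : (IsLocalRing.ResidueField B)) ≠ 0) (h : Red B z u) (h' : Red B w ![0, -1, 1]) : Red B (z + w) u :=
  add h3 h h' h.ne (isSum_zero_right u h.curve)

lemma nsmul_O (h3 : (3 : (IsLocalRing.ResidueField B)) ≠ 0) (h : Red B z ![0, -1, 1]) (n : ℕ) : Red B (n * z) ![0, -1, 1] := by
  induction n with
  | zero => simpa using zero
  | succ n ih =>
    rw [show ((n + 1 : ℕ) : ℂ) * z = n * z + z by push_cast; ring]
    exact add_O h3 ih h

lemma sum_torsion (h3 : (3 : (IsLocalRing.ResidueField B)) ≠ 0) {ι : Type*} {S : Finset ι} {M : ι → ℂ} {a : (IsLocalRing.ResidueField B)} (ha : a ^ 3 = 1)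
    (h : ∀ i ∈ S, Red B (M i) ![0, -a, 1]) : Red B (∑ i ∈ S, M i) ![0, -a ^ S.card, 1] := by
  classical
  induction S using Finset.induction_on with
  | empty => simpa using zero
  | insert i S hi ih =>
    rw [Finset.sum_insert hi, Finset.card_insert_of_notMem hi, pow_succ']
    refine add h3 (h i (Finset.mem_insert_self i S)) (ih fun j hj => h j (Finset.mem_insert_of_mem hj))
      (O_ne _) (isSum_torsion ha ?_)
    rw [← pow_mul, mul_comm, pow_mul, ha, one_pow]

end Red

lemma exists_place (p : ℕ) [hp : Fact p.Prime] : ∃ B : ValuationSubring ℂ, Rd B p 0 := by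
  let A : Subring ℂ := (Int.castRingHom ℂ).range
  let I : Ideal A := Ideal.span {(p : A)}
  have hI : I ≠ ⊤ := by
    rw [Ne, Ideal.eq_top_iff_one, Ideal.mem_span_singleton]
    rintro ⟨⟨_, y, rfl⟩, h⟩
    have h' : (1 : ℂ) = p * (y : ℂ) := congrArg Subtype.val h
    have h'' : (1 : ℤ) = p * y := by exact_mod_cast h'
    have := Int.isUnit_iff.1 (IsUnit.of_mul_eq_one y h''.symm)
    have := hp.out.one_lt
    omega
  obtain ⟨B, -, hB⟩ := Ideal.image_subset_nonunits_valuationSubring I hI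
  have : (p : ℂ) ∈ B.nonunits := hB ⟨(p : A), Ideal.subset_span rfl, by simp⟩
  obtain ⟨h, h'⟩ := ValuationSubring.mem_nonunits_iff_exists_mem_maximalIdeal.1 this
  exact ⟨B, h, (IsLocalRing.residue_eq_zero_iff _).2 h'⟩

end Place

section PlaceTorsion
open CubeSum.Sub

variable {p : ℕ} [hpp : Fact p.Prime] {B : ValuationSubring ℂ}

lemma exists_hom (h : Rd B p 0) : Nonempty (ZMod p →+* IsLocalRing.ResidueField B) := by
  have h0 : (p : IsLocalRing.ResidueField B) = 0 := (Rd.natCast p).unique h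
  have : CharP (IsLocalRing.ResidueField B) p := (CharP.charP_iff_prime_eq_zero hpp.out).2 h0
  exact ⟨ZMod.castHom (dvd_refl p) _⟩

lemma exists_root (hp : p % 3 = 1) : ∃ r : ZMod p, r ^ 2 + r + 1 = 0 := by
  obtain ⟨g, hg⟩ := IsCyclic.exists_monoid_generator (α := (ZMod p)ˣ)
  have ho : orderOf g = p - 1 := by
    rw [orderOf_eq_card_of_forall_mem_powers hg, Nat.card_eq_fintype_card, ZMod.card_units]
  have h2 := hpp.out.two_le
  refine ⟨((g ^ ((p - 1) / 3) : (ZMod p)ˣ) : ZMod p), ?_⟩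
  have h1 : g ^ ((p - 1) / 3) ≠ 1 := fun h => by
    have := Nat.le_of_dvd (by omega) (orderOf_dvd_of_pow_eq_one h)
    omega
  have h3 : (g ^ ((p - 1) / 3)) ^ 3 = 1 := by
    rw [← pow_mul, show (p - 1) / 3 * 3 = orderOf g by omega, pow_orderOf_eq_one]
  generalize g ^ ((p - 1) / 3) = x at h1 h3
  have h4 : ((x : ZMod p)) ^ 3 = 1 := by rw [← Units.val_pow_eq_pow_val, h3, Units.val_one]
  have h5 : (x : ZMod p) - 1 ≠ 0 := fun h => h1 (Units.ext (by simpa using sub_eq_zero.1 h))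
  exact mul_left_cancel₀ h5 (by linear_combination h4)

lemma rd_omega_exists (hp : p % 3 = 1) (ι : ZMod p →+* IsLocalRing.ResidueField B) :
    ∃ r : ZMod p, r ^ 2 + r + 1 = 0 ∧ Rd B ω (ι r) := by
  obtain ⟨r, hr⟩ := exists_root hp
  obtain ⟨x, hx⟩ := Rd.mk (B := B) (Rd.of_pow (n := 3) (by norm_num) (omega_cube ▸ Rd.one))
  have h : x ^ 2 + x + 1 = 0 := (((hx.pow 2).add hx).add Rd.one).unique (by
    rw [omega_sq, show -1 - ω + ω + 1 = 0 by ring]; exact Rd.zero)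
  have hr' : ι r ^ 2 + ι r + 1 = 0 := by rw [← map_pow, ← map_add, ← map_one ι, ← map_add, hr, map_zero]
  have h' : (x - ι r) * (x - ι (r ^ 2)) = 0 := by
    rw [map_pow]; linear_combination h - (1 + x - ι r) * hr'
  rcases mul_eq_zero.1 h' with e | e
  · exact ⟨r, hr, sub_eq_zero.1 e ▸ hx⟩
  · exact ⟨r ^ 2, by linear_combination (r ^ 2 - r + 1) * hr, sub_eq_zero.1 e ▸ hx⟩

variable (hp : p % 3 = 1) (ι : ZMod p →+* IsLocalRing.ResidueField B)

include hp ι in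
lemma three_ne_zero_res : (3 : IsLocalRing.ResidueField B) ≠ 0 := fun h => by
  refine three_ne_zero_zmod hp (ι.injective ?_)
  rw [map_zero, map_ofNat, h]

include hp ι in
lemma Red.flex {z : ℂ} {u : Fin 3 → IsLocalRing.ResidueField B} (h : Red B z u)
    (hu : u 0 * u 1 * u 2 = 0) (hz : p * z ∈ Λ) : Red B z ![0, -1, 1] := by
  have h3 := three_ne_zero_res hp ι
  have h1 := (h.three_mul h3 hu).nsmul_O h3 (p / 3)
  have h2 := h.add_O h3 h1
  have e : z + (p / 3 : ℕ) * (3 * z) = p * z := by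
    have : (p : ℂ) = ((3 * (p / 3) + 1 : ℕ) : ℂ) := by congr 1; omega
    rw [this]; push_cast; ring
  rw [e] at h2
  exact h.of_cr (O_ne _) (h2.cr (.of_mem hz))

section SubRed
variable {c : ZMod p → ℂ} (hc : Sub p c)
include hc

lemma Sub.p_mul (i : ZMod p) : p * c i ∈ Λ := by
  have := hc.nsmul p i
  rw [CharP.cast_eq_zero, zero_mul] at this
  convert sub_mem hc.zero this using 1; ring

lemma Sub.red_all (h3 : (3 : IsLocalRing.ResidueField B) ≠ 0) {i : ZMod p} (hi : i ≠ 0)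
    (h : Red B (c i) ![0, -1, 1]) (j : ZMod p) : Red B (c j) ![0, -1, 1] := by
  have := hc.nsmul (j / i).val i
  rw [ZMod.natCast_val, ZMod.cast_id', id, div_mul_cancel₀ _ hi] at this
  refine (h.nsmul_O h3 (j / i).val).congr ?_
  convert neg_mem this using 1; ring

include hp ι in
lemma Sub.red_cases : (∀ i, Red B (c i) ![0, -1, 1]) ∨
    ∀ i ≠ 0, ∀ u, Red B (c i) u → u 0 * u 1 * u 2 ≠ 0 := by
  by_cases h : ∃ i ≠ 0, Red B (c i) ![0, -1, 1]
  · obtain ⟨i, hi, h⟩ := h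
    exact Or.inl (hc.red_all (three_ne_zero_res hp ι) hi h)
  · push Not at h
    exact Or.inr fun i hi u hu hn => h i hi (hu.flex hp ι hn (hc.p_mul i))

omit hc in
lemma Sub.PP_rd_ne (h : ∀ i ≠ 0, ∀ u, Red B (c i) u → u 0 * u 1 * u 2 ≠ 0) : ¬ Rd B (PP c) 0 := fun h0 => by
  choose u hu using fun i => Red.exists' (B := B) (c i)
  have := Rd.prod (B := B) (S := Finset.univ.erase 0) (f := fun i => s (c i)) (g := fun i => u i 0 / u i 2)
    fun i hi => ((hu i).st (right_ne_zero_of_mul (h i (Finset.ne_of_mem_erase hi) _ (hu i)))).2.1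
  refine Finset.prod_ne_zero_iff.2 (fun i hi => ?_) (this.unique h0)
  have := h i (Finset.ne_of_mem_erase hi) _ (hu i)
  exact div_ne_zero (left_ne_zero_of_mul (left_ne_zero_of_mul this)) (right_ne_zero_of_mul this)

omit hc in
include hp in
lemma Sub.PP_rd (h : ∀ i, Red B (c i) ![0, -1, 1]) : Rd B (PP c) 0 := by
  have := Rd.prod (B := B) (S := Finset.univ.erase 0) (f := fun i => s (c i)) (g := fun i => 0)
    fun i hi => by simpa using ((h i).st one_ne_zero).2.1
  have h2 := hpp.out.two_le
  rw [Finset.prod_const, Finset.card_erase_of_mem (Finset.mem_univ _), Finset.card_univ, ZMod.card,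
    zero_pow (by omega)] at this
  exact this
end SubRed

variable {r : ZMod p} (hr : r ^ 2 + r + 1 = 0) {ι} (hω : Rd B ω (ι r))

include hω in
lemma rd_lattice (X Y : ℤ) : Rd B (X + Y * ω) (ι (X + Y * r)) := by
  rw [map_add, map_mul, map_intCast, map_intCast]
  exact (Rd.intCast X).add ((Rd.intCast Y).mul hω)

include hr hω hp

lemma rd_π₁ : Rd B (π₁ r) 0 := by
  obtain ⟨X, Y, e⟩ := mem_hex.1 (π₁_mem hr hp)
  have h := π₁_mul_Pt hr hp 1
  have e' : π₁ r * Pt r 1 0 = (((X * (1 + r.val) - Y : ℤ) : ℂ) + ((X + Y * r.val : ℤ) : ℂ) * ω) / p := by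
    have := hpp.out.two_le
    have : Fact (1 < p) := ⟨this⟩
    rw [← e, Pt, ZMod.val_one, ZMod.val_zero]
    push_cast; rw [mul_div_assoc']; congr 1
    linear_combination (Y : ℂ) * omega_sq
  rw [e', div_mem_iff] at h
  have h2 := h.2
  push_cast at h2
  rw [ZMod.natCast_val, ZMod.cast_id', id] at h2
  rw [← e]
  convert rd_lattice hω X Y
  rw [h2, map_zero]

lemma rd_π₂ : ¬ Rd B (π₂ r) 0 := fun h0 => by
  obtain ⟨X, Y, e⟩ := mem_hex.1 (π₂_mem hr hp)
  have h := π₂_mul_Pt hr hp 1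
  have h2 := hpp.out.two_le
  have : Fact (1 < p) := ⟨h2⟩
  have e' : π₂ r * Pt r 0 1 = (((-X * r.val - Y : ℤ) : ℂ) + ((X - Y * r.val - Y : ℤ) : ℂ) * ω) / p := by
    rw [← e, Pt, ZMod.val_one, ZMod.val_zero]
    push_cast; rw [mul_div_assoc']; congr 1
    linear_combination (Y : ℂ) * omega_sq
  rw [e', div_mem_iff] at h
  have h2 := h.2
  push_cast at h2
  rw [ZMod.natCast_val, ZMod.cast_id', id] at h2
  have h4 : (X + Y * r : ZMod p) = 0 := by
    refine ι.injective ?_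
    rw [map_zero]
    exact (rd_lattice hω X Y).unique (by rwa [e])
  have hY : (Y : ZMod p) = 0 := by
    have : (Y : ZMod p) * (1 + 2 * r) = 0 := by linear_combination h4 - h2
    exact (mul_eq_zero.1 this).resolve_right (two_mul_r_add_one_ne hr hp)
  have hX : (X : ZMod p) = 0 := by linear_combination h4 - r * hY
  have hm : π₂ r / p ∈ Λ := by rw [← e, div_mem_iff]; exact ⟨hX, hY⟩
  have h5 := mul_mem_hex hm (π₁_mul_Pt hr hp 1)
  have h6 : π₂ r / p * (π₁ r * Pt r 1 0) = Pt r 1 0 := by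
    have hp0 : (p : ℂ) ≠ 0 := by exact_mod_cast hpp.out.ne_zero
    field_simp
    linear_combination Pt r 1 0 * π₁_mul_π₂ hr hp
  rw [h6] at h5
  exact one_ne_zero (Pt_inj hr hp h5).1

lemma red_left (a : ZMod p) : Red B (Pt r a 0) ![0, -1, 1] := by
  rcases (sub_cyc hr hp (a := 1) (b := 0) (Or.inl one_ne_zero)).red_cases hp ι with h | h
  · have := h a
    rwa [cyc, mul_one, mul_zero] at this
  · exact absurd (rd_π₁ hp hr hω) (Sub.PP_rd_ne h)

lemma red_right {b : ZMod p} (hb : b ≠ 0) {u : Fin 3 → IsLocalRing.ResidueField B}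
    (hu : Red B (Pt r 0 b) u) : u 0 * u 1 * u 2 ≠ 0 := by
  rcases (sub_cyc hr hp (a := 0) (b := 1) (Or.inr one_ne_zero)).red_cases hp ι with h | h
  · exact absurd (Sub.PP_rd hp h) (rd_π₂ hp hr hω)
  · exact h b hb u (by rwa [cyc, mul_one, mul_zero])

lemma red_add (a : ZMod p) {b : ZMod p} {u : Fin 3 → IsLocalRing.ResidueField B}
    (hu : Red B (Pt r 0 b) u) : Red B (Pt r a b) u := by
  have := hu.add_O (three_ne_zero_res hp ι) (red_left hp hr hω a)
  refine this.congr ?_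
  have := Pt_add r a 0 0 b
  rw [add_zero, zero_add] at this
  convert neg_mem this using 1; ring

end PlaceTorsion

section ResidueConstants
open CubeSum.Sub

variable {p : ℕ} [hpp : Fact p.Prime] {B : ValuationSubring ℂ}

/-- A cube root of `1 - lam c`. -/
noncomputable def AA {p : ℕ} [NeZero p] (c : ZMod p → ℂ) : ℂ := 3 ^ ((p - 1) / 3) * κ c

lemma AA_cube (hp : p % 3 = 1) (c : ZMod p → ℂ) : AA c ^ 3 = 1 - lam c := by
  rw [AA, lam, mul_pow, ← pow_mul, show (p - 1) / 3 * 3 = p - 1 by omega]; ring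

lemma pow_card_eq_one (ι : ZMod p →+* IsLocalRing.ResidueField B) {x : ZMod p} (hx : x ≠ 0) :
    ι x ^ (p - 1) = 1 := by
  rw [← map_pow, ZMod.pow_card_sub_one_eq_one hx, map_one]

lemma card_erase_zero : (Finset.univ.erase (0 : ZMod p)).card = p - 1 := by
  rw [Finset.card_erase_of_mem (Finset.mem_univ _), Finset.card_univ, ZMod.card]

variable (hp : p % 3 = 1) {ι : ZMod p →+* IsLocalRing.ResidueField B}
  {r : ZMod p} (hr : r ^ 2 + r + 1 = 0) (hω : Rd B ω (ι r))
  {c c' : ZMod p → ℂ}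

include hr in
lemma map_root : ι r ^ 2 + ι r + 1 = 0 := by
  rw [← map_pow, ← map_add, ← map_one ι, ← map_add, hr, map_zero]

include hp hr hω in
lemma rd_κ (h : ∀ i ≠ 0, ∃ u, Red B (c i) u ∧ Red B (c' i) u ∧ u 0 * u 1 * u 2 ≠ 0) :
    ∃ a, a ≠ 0 ∧ Rd B (κ c) a ∧ Rd B (κ c') a := by
  choose! u h1 h2 h3 using h
  have h2' : ∀ i ≠ 0, u i 2 ≠ 0 := fun i hi => right_ne_zero_of_mul (h3 i hi)
  have hf : ∀ i ≠ 0, ι r * (u i 0 / u i 2) + ι r ^ 2 * (u i 1 / u i 2) + 1 ≠ 0 := fun i hi h0 => by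
    have hw := map_root (ι := ι) hr
    have cu := (h1 i hi).curve
    have := h2' i hi
    have h0' : ι r * u i 0 + ι r ^ 2 * u i 1 + u i 2 = 0 := by
      field_simp at h0; linear_combination h0
    refine h3 i hi ((mul_eq_zero.1 (?_ : (3 : IsLocalRing.ResidueField B) * _ = 0)).resolve_left (three_ne_zero_res hp ι))
    generalize ι r = w at *
    generalize u i 0 = a at *
    generalize u i 1 = b at *
    generalize u i 2 = d at *
    clear h0
    grind
  refine ⟨∏ i ∈ Finset.univ.erase 0, (ι r * (u i 0 / u i 2) + ι r ^ 2 * (u i 1 / u i 2) + 1)⁻¹,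
    Finset.prod_ne_zero_iff.2 fun i hi => inv_ne_zero (hf i (Finset.ne_of_mem_erase hi)),
    Rd.prod fun i hi => ?_, Rd.prod fun i hi => ?_⟩
  · have hi' := Finset.ne_of_mem_erase hi
    have := (h1 i hi').st (h2' i hi')
    exact (((hω.mul this.2.1).add ((hω.pow 2).mul this.2.2)).add Rd.one).inv (hf i hi')
  · have hi' := Finset.ne_of_mem_erase hi
    have := (h2 i hi').st (h2' i hi')
    exact (((hω.mul this.2.1).add ((hω.pow 2).mul this.2.2)).add Rd.one).inv (hf i hi')

include hp hr hω in
lemma rd_AA (h : ∀ i ≠ 0, ∃ u, Red B (c i) u ∧ Red B (c' i) u ∧ u 0 * u 1 * u 2 ≠ 0) :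
    ∃ a, Rd B (AA c) a ∧ Rd B (AA c') a := by
  obtain ⟨a, -, h1, h2⟩ := rd_κ hp hr hω h
  exact ⟨_, ((Rd.natCast 3).pow _).mul h1, ((Rd.natCast 3).pow _).mul h2⟩

include hω in
lemma rd_EE (h : ∀ i ≠ 0, ∃ u, Red B (c i) u ∧ Red B (c' i) u ∧ u 2 ≠ 0) :
    ∃ a, Rd B (EE c ω) a ∧ Rd B (EE c' ω) a := by
  choose! u h1 h2 h3 using h
  refine ⟨∏ i ∈ Finset.univ.erase 0, ((u i 0 / u i 2) ^ 3 + ι r * (u i 1 / u i 2) ^ 3 + ι r ^ 2),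
    Rd.prod fun i hi => ?_, Rd.prod fun i hi => ?_⟩
  · have hi' := Finset.ne_of_mem_erase hi
    have := (h1 i hi').st (h3 i hi')
    exact ((this.2.1.pow 3).add (hω.mul (this.2.2.pow 3))).add (hω.pow 2)
  · have hi' := Finset.ne_of_mem_erase hi
    have := (h2 i hi').st (h3 i hi')
    exact ((this.2.1.pow 3).add (hω.mul (this.2.2.pow 3))).add (hω.pow 2)

include hp in
lemma rd_mu_cube (hc : Sub p c) (hl : Rd B (lam c) 0) : Rd B (mu c ^ 3) (-1) := by
  have := (hl.pow 3).sub Rd.one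
  rw [(hc.lam_mu hp).2]
  simpa using this

include hp in
lemma mu_mul (hc : Sub p c) : mu c * (3 * EE c ω) = (-3) ^ p := by
  rw [mu, div_mul_cancel₀]
  exact mul_ne_zero three_ne_zero (hc.EE_ne hp)

include hp hω in
lemma rd_mu (hc : Sub p c) (hc' : Sub p c') (hl : Rd B (lam c) 0) (hl' : Rd B (lam c') 0)
    (h : ∀ i ≠ 0, ∃ u, Red B (c i) u ∧ Red B (c' i) u ∧ u 2 ≠ 0) :
    ∃ a, Rd B (mu c) a ∧ Rd B (mu c') a := by
  obtain ⟨m, hm⟩ := Rd.mk (Rd.of_pow three_ne_zero (rd_mu_cube hp hc hl))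
  obtain ⟨m', hm'⟩ := Rd.mk (Rd.of_pow three_ne_zero (rd_mu_cube hp hc' hl'))
  obtain ⟨e, he, he'⟩ := rd_EE hω h
  have h3 : Rd B 3 3 := Rd.natCast 3
  have e1 := (mu_mul hp hc ▸ hm.mul (h3.mul he)).unique (h3.neg.pow p)
  have e2 := (mu_mul hp hc' ▸ hm'.mul (h3.mul he')).unique (h3.neg.pow p)
  have hn : m * (3 * e) ≠ 0 := by
    rw [e1]; exact pow_ne_zero _ (neg_ne_zero.2 (three_ne_zero_res hp ι))
  have : m = m' := mul_right_cancel₀ (right_ne_zero_of_mul hn) (e1.trans e2.symm)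
  exact ⟨m, hm, this ▸ hm'⟩

lemma pow_ne_one_of_not_cube (hp : p % 3 = 1) (h : ¬ ∃ x : ZMod p, x ^ 3 = 3) :
    (3 : ZMod p) ^ ((p - 1) / 3) ≠ 1 := fun h1 => by
  obtain ⟨g, hg⟩ := IsCyclic.exists_monoid_generator (α := (ZMod p)ˣ)
  have ho : orderOf g = p - 1 := by
    rw [orderOf_eq_card_of_forall_mem_powers hg, Nat.card_eq_fintype_card, ZMod.card_units]
  have h2 := hpp.out.two_le
  obtain ⟨n, hn⟩ := hg (Units.mk0 3 (three_ne_zero_zmod hp))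
  have hn' : (g : ZMod p) ^ n = 3 := by
    have := congrArg Units.val hn
    simpa using this
  have h4 : g ^ (n * ((p - 1) / 3)) = 1 := Units.ext (by
    rw [Units.val_pow_eq_pow_val, pow_mul, hn', h1, Units.val_one])
  have h5 := orderOf_dvd_of_pow_eq_one h4
  rw [ho, show p - 1 = 3 * ((p - 1) / 3) by omega, show 3 * ((p - 1) / 3) / 3 = (p - 1) / 3 by omega] at h5
  obtain ⟨k, rfl⟩ := Nat.dvd_of_mul_dvd_mul_right (by omega) h5
  exact h ⟨(g : ZMod p) ^ k, by rw [← pow_mul, mul_comm, hn']⟩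

section Special
include hp hr hω

omit hω in
lemma AA_right : AA (cyc r 0 1) ^ 3 = 1 := by
  rw [AA_cube hp, (sub_cyc hr hp (Or.inr one_ne_zero)).lam_stable hp (omega_cyc_right hr), sub_zero]

lemma st_left (i : ZMod p) : Rd B (s (cyc r 1 0 i)) 0 ∧ Rd B (t (cyc r 1 0 i)) (-1) := by
  have h := red_left hp hr hω (i * 1)
  have := (h.st one_ne_zero).2
  rw [cyc, mul_zero]
  simpa using this

lemma AA_left_ne (h : ¬ ∃ x : ZMod p, x ^ 3 = 3) : AA (cyc r 1 0) ≠ 1 := fun h1 => by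
  have hw := map_root (ι := ι) hr
  have hx : 1 - r ^ 2 ≠ 0 := fun h0 => two_mul_r_add_one_ne hr hp (by
    have h1 : r = -2 := by linear_combination hr + h0
    have := three_ne_zero_zmod hp (by rw [h1] at hr; linear_combination hr)
    exact this.elim)
  have hx' : ι (1 - r ^ 2) ≠ 0 := (map_ne_zero ι).2 hx
  have hκ : Rd B (κ (cyc r 1 0)) 1 := by
    have := Rd.prod (B := B) (S := Finset.univ.erase 0)
      (f := fun i => (ω * s (cyc r 1 0 i) + ω ^ 2 * t (cyc r 1 0 i) + 1)⁻¹) (g := fun i => (ι (1 - r ^ 2))⁻¹)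
      fun i _ => by
        have h := st_left hp hr hω i
        refine Rd.inv ?_ hx'
        convert ((hω.mul h.1).add ((hω.pow 2).mul h.2)).add Rd.one using 1
        rw [map_sub, map_one, map_pow]; ring
    rw [Finset.prod_const, card_erase_zero, inv_pow, pow_card_eq_one ι hx, inv_one] at this
    exact this
  have h2 : Rd B (AA (cyc r 1 0)) _ := ((Rd.natCast 3).pow _).mul hκ
  rw [h1] at h2
  refine pow_ne_one_of_not_cube hp h (ι.injective ?_)
  have := h2.unique Rd.one
  rw [mul_one] at this
  rw [map_pow, map_one, map_ofNat]; exact_mod_cast this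

lemma mu_left : mu (cyc r 1 0) = -1 := by
  have hc := sub_cyc hr hp (a := 1) (b := 0) (Or.inl one_ne_zero)
  have hl := hc.lam_stable hp (omega_cyc_left hr)
  have hw := map_root (ι := ι) hr
  have h3 : mu (cyc r 1 0) ^ 3 = -1 := by rw [(hc.lam_mu hp).2, hl]; ring
  have hx : r ^ 2 - r ≠ 0 := fun h0 => two_mul_r_add_one_ne hr hp (by linear_combination hr - h0)
  have hE : Rd B (EE (cyc r 1 0) ω) 1 := by
    have := Rd.prod (B := B) (S := Finset.univ.erase 0)
      (f := fun i => aa ω (cyc r 1 0 i)) (g := fun i => ι (r ^ 2 - r))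
      fun i _ => by
        have h := st_left hp hr hω i
        have e : ι (r ^ 2 - r) = 0 ^ 3 + ι r * (-1) ^ 3 + ι r ^ 2 := by rw [map_sub, map_pow]; ring
        rw [e]
        exact ((h.1.pow 3).add (hω.mul (h.2.pow 3))).add (hω.pow 2)
    rw [Finset.prod_const, card_erase_zero, pow_card_eq_one ι hx] at this
    exact this
  obtain ⟨m, hm⟩ := Rd.mk (Rd.of_pow three_ne_zero (h3 ▸ Rd.one.neg))
  have h3' : Rd B 3 3 := Rd.natCast 3
  have e1 := (mu_mul hp hc ▸ hm.mul (h3'.mul hE)).unique (h3'.neg.pow p)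
  have e2 : (-3 : IsLocalRing.ResidueField B) ^ p = -3 := by
    have := congrArg ι (ZMod.pow_card (-3 : ZMod p))
    rwa [map_pow, map_neg, map_ofNat] at this
  have e3 : m = -1 := mul_right_cancel₀ (three_ne_zero_res hp ι) (by linear_combination e1 + e2)
  have hcases : (mu (cyc r 1 0) + 1) * ((mu (cyc r 1 0) + ω) * (mu (cyc r 1 0) + ω ^ 2)) = 0 := by
    have := omega_sq
    generalize mu (cyc r 1 0) = x at *
    clear * - h3 this
    grind
  have hwne : ι r ≠ 1 := fun h => three_ne_zero_res hp ι (by rw [h] at hw; linear_combination hw)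
  have hwne2 : ι r ^ 2 ≠ 1 := fun h => three_ne_zero_res hp ι (by
    have h1 : ι r = -2 := by linear_combination hw - h
    rw [h1] at hw; linear_combination hw)
  rcases mul_eq_zero.1 hcases with h | h
  · linear_combination h
  rcases mul_eq_zero.1 h with h | h
  · have := (hm.add hω).unique (h ▸ Rd.zero)
    exact absurd (by linear_combination this - e3) hwne
  · have := (hm.add (hω.pow 2)).unique (h ▸ Rd.zero)
    exact absurd (by linear_combination this - e3) hwne2

end Special
end ResidueConstants

section Galois
open CubeSum.Sub

/-- `φ w` is the conjugate of `φ z` by `σ`. -/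
def Sg (σ : ℂ ≃+* ℂ) (z w : ℂ) : Prop := Cr (fun i => σ (φ z i)) (φ w)

variable {σ : ℂ ≃+* ℂ} {z w z' w' : ℂ}

lemma map_φ_ne (σ : ℂ ≃+* ℂ) (z : ℂ) : (fun i => σ (φ z i)) ≠ 0 := fun h =>
  φ_ne_zero z (funext fun i => by simpa using congrFun h i)

lemma map_isSum (σ : ℂ ≃+* ℂ) {u v x : Fin 3 → ℂ} (h : IsSum u v x) :
    IsSum (fun i => σ (u i)) (fun i => σ (v i)) (fun i => σ (x i)) := by
  have e1 : F1 (fun i => σ (u i)) (fun i => σ (v i)) = fun i => σ (F1 u v i) := by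
    ext i; fin_cases i <;> simp [F1]
  have e2 : F2 (fun i => σ (u i)) (fun i => σ (v i)) = fun i => σ (F2 u v i) := by
    ext i; fin_cases i <;> simp [F2, F1]
  rw [IsSum, e1, e2]
  refine ⟨fun i j => ?_, fun i j => ?_⟩
  · simp only [← map_mul]; rw [h.1 i j]
  · simp only [← map_mul]; rw [h.2 i j]

namespace Sg

lemma congr_right (h : Sg σ z w) (hw : w - w' ∈ Λ) : Sg σ z w' := by rwa [Sg, ← φ_congr hw]

lemma congr_left (h : Sg σ z w) (hz : z - z' ∈ Λ) : Sg σ z' w := by rwa [Sg, ← φ_congr hz]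

lemma unique (h : Sg σ z w) (h' : Sg σ z w') : w - w' ∈ Λ :=
  φ_cr.1 (h.symm.trans h' (map_φ_ne σ z))

lemma zero (σ : ℂ ≃+* ℂ) : Sg σ 0 0 := by
  have : (fun i => σ (φ 0 i)) = φ 0 := by
    rw [φ_zero]; ext i; fin_cases i <;> simp
  rw [Sg, this]; exact cr_refl _

lemma add (h : Sg σ z w) (h' : Sg σ z' w') : Sg σ (z + z') (w + w') := by
  obtain ⟨a, ha, e⟩ := h.exists_smul (map_φ_ne σ z) (φ_ne_zero w)
  obtain ⟨b, hb, e'⟩ := h'.exists_smul (map_φ_ne σ z') (φ_ne_zero w')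
  have := map_isSum σ (isSum_φ z z')
  rw [e, e', ← one_smul ℂ (fun i => σ (φ (z + z') i)), isSum_smul ha hb one_ne_zero] at this
  exact IsSum.unique three_ne_zero (φ_ne_zero w) (φ_ne_zero w') (φ_curve w) (φ_curve w') this
    (isSum_φ w w')

lemma nsmul (h : Sg σ z w) (n : ℕ) : Sg σ (n * z) (n * w) := by
  induction n with
  | zero => simpa using zero σ
  | succ n ih =>
    rw [show ((n + 1 : ℕ) : ℂ) * z = n * z + z by push_cast; ring,
      show ((n + 1 : ℕ) : ℂ) * w = n * w + w by push_cast; ring]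
    exact ih.add h

lemma sum {ι : Type*} {S : Finset ι} {f g : ι → ℂ} (h : ∀ i ∈ S, Sg σ (f i) (g i)) :
    Sg σ (∑ i ∈ S, f i) (∑ i ∈ S, g i) := by
  classical
  induction S using Finset.induction_on with
  | empty => simpa using zero σ
  | insert i S hi ih =>
    rw [Finset.sum_insert hi, Finset.sum_insert hi]
    exact (h i (Finset.mem_insert_self i S)).add (ih fun j hj => h j (Finset.mem_insert_of_mem hj))

lemma mem (h : Sg σ z w) (hz : z ∈ Λ) : w ∈ Λ := by
  have := (h.congr_left (z' := 0) (by simpa using hz)).unique (zero σ)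
  simpa using this

lemma mem' (h : Sg σ z w) (hw : w ∈ Λ) : z ∈ Λ := by
  have h0 : Sg σ z 0 := h.congr_right (by simpa using hw)
  have : Cr (φ z) (φ 0) := fun i j => σ.injective (by
    have e := h0.trans (zero σ).symm (φ_ne_zero 0) i j
    rw [map_mul, map_mul]; exact e)
  simpa using φ_cr.1 this

lemma st (h : Sg σ z w) (hz : Reg z) : Reg w ∧ s w = σ (s z) ∧ t w = σ (t z) := by
  have := st_of_cr (map_φ_ne σ z) h.symm
  refine ⟨this.1.2 ((map_ne_zero σ).2 hz), ?_, ?_⟩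
  · rw [this.2.1, s, map_div₀]
  · rw [this.2.2, t, map_div₀]

lemma of_st (hz : Reg z) (hw : Reg w) (h1 : s w = σ (s z)) (h2 : t w = σ (t z)) : Sg σ z w := by
  have e : (fun i => σ (φ z i)) = σ (φ z 2) • ![s w, t w, 1] := by
    conv_lhs => rw [φ_eq hz]
    ext i; fin_cases i <;> simp [h1, h2]
  have hz' : σ (φ z 2) ≠ 0 := (map_ne_zero σ).2 hz
  rw [Sg, e, cr_smul_left hz', φ_eq hw, cr_smul_right hw]
  exact cr_refl _

lemma exists_of_reg (σ : ℂ ≃+* ℂ) (hz : Reg z) : ∃ w, Sg σ z w := by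
  have c : σ (s z) ^ 3 + σ (t z) ^ 3 + 1 = 0 := by
    rw [← map_pow, ← map_pow, ← map_add, ← map_one σ, ← map_add, curve hz, map_zero]
  obtain ⟨w, h1, h2, h3⟩ := exists_st c
  exact ⟨w, of_st hz h1 h2 h3⟩

lemma omega (h : Sg σ z w) (hσ : σ ω = ω) : Sg σ (ω * z) (ω * w) := by
  have h' : Cr (fun i => σ (φ z i)) (φ w) := h
  rw [Sg, φ_omega, φ_omega]
  have e : (fun i => σ ((![ω * φ z 0, φ z 1, φ z 2] : Fin 3 → ℂ) i)) =
    ![ω * σ (φ z 0), σ (φ z 1), σ (φ z 2)] := by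
    ext i; fin_cases i <;> simp [hσ]
  rw [e]
  have a := h' 0 1
  have b := h' 0 2
  have d := h' 1 2
  simp only at a b d
  intro i j
  fin_cases i <;> fin_cases j <;> simp <;> grind

lemma omega' (h : Sg σ z w) (hσ : σ ω = ω ^ 2) : Sg σ (ω * z) (ω ^ 2 * w) := by
  have h' : Cr (fun i => σ (φ z i)) (φ w) := h
  rw [Sg, φ_omega, pow_two, mul_assoc, φ_omega, φ_omega]
  have e : (fun i => σ ((![ω * φ z 0, φ z 1, φ z 2] : Fin 3 → ℂ) i)) =
    ![ω ^ 2 * σ (φ z 0), σ (φ z 1), σ (φ z 2)] := by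
    ext i; fin_cases i <;> simp [hσ]
  rw [e]
  have a := h' 0 1
  have b := h' 0 2
  have d := h' 1 2
  simp only at a b d
  intro i j
  fin_cases i <;> fin_cases j <;> simp <;> grind

end Sg

lemma map_omega (σ : ℂ ≃+* ℂ) : σ ω = ω ∨ σ ω = ω ^ 2 := by
  have h : (σ ω) ^ 3 = 1 := by rw [← map_pow, omega_cube, map_one]
  rcases cube_root_cases h with h | h | h
  · exact absurd (σ.injective (h.trans (map_one σ).symm)) omega_ne_one
  · exact Or.inl h
  · exact Or.inr h

variable {p : ℕ} [hpp : Fact p.Prime] {c c' : ZMod p → ℂ}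

lemma κ_symm (hc : Sub p c) (hp : p % 3 = 1) :
    κ c = ∏ i ∈ Finset.univ.erase 0, (ω ^ 2 * s (c i) + ω * t (c i) + 1)⁻¹ := by
  have h1 : κ c = ∏ i ∈ Finset.univ.erase 0, (ω * s (c (-i)) + ω ^ 2 * t (c (-i)) + 1)⁻¹ := by
    rw [κ]
    refine Finset.prod_equiv (Equiv.neg _) (fun i => by simp) fun i _ => by simp
  have h2 : ∏ i ∈ Finset.univ.erase (0 : ZMod p), t (c i) = 1 := prod_involution hp fun i hi => by
    rw [(hc.st_neg_c hp i).2, mul_inv_cancel₀ (hc.nf hp hi).t_ne]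
  have h3 : ∏ i ∈ Finset.univ.erase (0 : ZMod p), ω = 1 := by
    rw [Finset.prod_const, card_erase_zero, show p - 1 = 3 * ((p - 1) / 3) by omega, pow_mul, omega_cube, one_pow]
  have h4 : ∏ i ∈ Finset.univ.erase (0 : ZMod p), (ω ^ 2 * s (c i) + ω * t (c i) + 1)⁻¹ =
      ∏ i ∈ Finset.univ.erase (0 : ZMod p), ((ω ^ 2 * s (c i) + ω * t (c i) + 1)⁻¹ * t (c i) * ω) := by
    rw [Finset.prod_mul_distrib, Finset.prod_mul_distrib, h2, h3, mul_one, mul_one]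
  rw [h1, h4]
  refine Finset.prod_congr rfl fun i hi => ?_
  have ht := (hc.nf hp (Finset.ne_of_mem_erase hi)).t_ne
  have e : ω * s (c (-i)) + ω ^ 2 * t (c (-i)) + 1 = (ω ^ 2 * s (c i) + ω * t (c i) + 1) * (t (c i) * ω)⁻¹ := by
    rw [(hc.st_neg_c hp i).1, (hc.st_neg_c hp i).2]
    have := omega_ne_zero
    have h3 := omega_cube
    field_simp
    linear_combination h3
  rw [e, mul_inv, inv_inv, mul_assoc]

section Equivariance
variable (hc : Sub p c) (hc' : Sub p c') (hp : p % 3 = 1) (h : ∀ i, Sg σ (c i) (c' i))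
include hc hc' hp h

lemma map_κ : σ (κ c) = κ c' := by
  have h' := fun i => (h i).st (hc.reg hp i)
  rw [κ, map_prod]
  rcases map_omega σ with e | e
  · rw [κ]
    refine Finset.prod_congr rfl fun i _ => ?_
    simp [(h' i).2.1, (h' i).2.2, e]
  · rw [κ_symm hc' hp]
    refine Finset.prod_congr rfl fun i _ => ?_
    simp [(h' i).2.1, (h' i).2.2, e, ← pow_mul, omega_pow_four]

lemma map_AA : σ (AA c) = AA c' := by
  rw [AA, AA, map_mul, map_pow, map_ofNat, map_κ hc hc' hp h]

lemma map_lam : σ (lam c) = lam c' := by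
  rw [lam, lam, map_sub, map_mul, map_pow, map_pow, map_ofNat, map_one, map_κ hc hc' hp h]

lemma map_mu : σ (mu c) = mu c' := by
  have h' := fun i => (h i).st (hc.reg hp i)
  have e : σ (EE c ω) = EE c' ω := by
    rcases map_omega σ with e | e
    · rw [EE, EE, map_prod]
      refine Finset.prod_congr rfl fun i _ => ?_
      simp [aa, (h' i).2.1, (h' i).2.2, e]
    · rw [← EE_symm hc' hp, EE, EE, map_prod]
      refine Finset.prod_congr rfl fun i _ => ?_
      simp [aa, (h' i).2.1, (h' i).2.2, e]
  rw [mu, mu, map_div₀, map_mul, map_pow, map_neg, map_ofNat, e]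

end Equivariance

section TorsionAction
variable {r : ZMod p}

lemma Pt_nsmul (r a b : ZMod p) (n : ℕ) : Pt r (n * a) (n * b) - n * Pt r a b ∈ Λ := by
  induction n with
  | zero => simp [Pt]
  | succ n ih =>
    have := add_mem (Pt_add r (n * a) (n * b) a b) ih
    convert this using 1; push_cast; rw [add_mul, one_mul, add_mul, one_mul]; ring

lemma Pt_smul (r a b k : ZMod p) : Pt r (k * a) (k * b) - k.val * Pt r a b ∈ Λ := by
  have := Pt_nsmul r a b k.val
  rwa [ZMod.natCast_val, ZMod.cast_id', id] at this

variable (hr : r ^ 2 + r + 1 = 0) (hp : p % 3 = 1)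
include hr hp

lemma Pt_inj' {a b a' b' : ZMod p} (h : Pt r a b - Pt r a' b' ∈ Λ) : a = a' ∧ b = b' := by
  have := add_mem (Pt_sub r a b a' b') h
  rw [sub_add_cancel] at this
  have := Pt_inj hr hp this
  exact ⟨sub_eq_zero.1 this.1, sub_eq_zero.1 this.2⟩

lemma reg_Pt (a b : ZMod p) : Reg (Pt r a b) := by
  by_cases h : a ≠ 0 ∨ b ≠ 0
  · have := (sub_cyc hr hp h).reg hp 1
    rwa [cyc, one_mul, one_mul] at this
  · push Not at h
    rw [h.1, h.2, show Pt r 0 0 = 0 by simp [Pt]]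
    exact reg_zero

lemma exists_Sg_Pt (σ : ℂ ≃+* ℂ) (a b : ZMod p) : ∃ a' b', Sg σ (Pt r a b) (Pt r a' b') := by
  obtain ⟨w, hw⟩ := Sg.exists_of_reg σ (reg_Pt hr hp a b)
  obtain ⟨a', b', h⟩ := exists_Pt hr hp ((hw.nsmul p).mem (p_mul_Pt hr hp a b))
  exact ⟨a', b', hw.congr_right h⟩

lemma eigen {a b a' b' k : ZMod p} (h : Sg σ (Pt r a b) (Pt r a' b'))
    (hk : ω * Pt r a b - Pt r (k * a) (k * b) ∈ Λ) :
    (σ ω = ω → r * a' = k * a' ∧ r ^ 2 * b' = k * b') ∧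
    (σ ω = ω ^ 2 → r ^ 2 * a' = k * a' ∧ r * b' = k * b') := by
  have h1 := ((h.nsmul k.val).congr_left (z' := ω * Pt r a b) (by
    have := add_mem hk (Pt_smul r a b k)
    convert neg_mem this using 1; ring)).congr_right (by
    have := neg_mem (Pt_smul r a' b' k); rwa [neg_sub] at this)
  refine ⟨fun e => ?_, fun e => ?_⟩
  · exact Pt_inj' hr hp (((h.omega e).congr_right (omega_mul_Pt hr _ _)).unique h1)
  · have h2 := ((h.omega' e).congr_right (w' := Pt r (r * (r * a')) (r ^ 2 * (r ^ 2 * b'))) (by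
      have := add_mem (omega_mul_mem_hex.2 (omega_mul_Pt hr a' b')) (omega_mul_Pt hr (r * a') (r ^ 2 * b'))
      convert this using 1; ring)).unique h1
    have := Pt_inj' hr hp h2
    have r3 : r ^ 3 = 1 := by linear_combination (r - 1) * hr
    exact ⟨by rw [← this.1]; ring, by rw [← this.2]; linear_combination -r * b' * r3⟩

lemma exists_action (σ : ℂ ≃+* ℂ) : ∃ x y : ZMod p, x ≠ 0 ∧ y ≠ 0 ∧
    ((σ ω = ω ∧ ∀ a b, Sg σ (Pt r a b) (Pt r (x * a) (y * b))) ∨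
     (σ ω = ω ^ 2 ∧ ∀ a b, Sg σ (Pt r a b) (Pt r (y * b) (x * a)))) := by
  obtain ⟨a, b, h⟩ := exists_Sg_Pt hr hp σ (1 : ZMod p) 0
  obtain ⟨a', b', h'⟩ := exists_Sg_Pt hr hp σ (0 : ZMod p) 1
  have k1 := eigen hr hp h (k := r) (by simpa using omega_mul_Pt hr 1 0)
  have k2 := eigen hr hp h' (k := r ^ 2) (by simpa using omega_mul_Pt hr 0 1)
  have hne : r ^ 2 - r ≠ 0 := fun h0 => two_mul_r_add_one_ne hr hp (by linear_combination hr - h0)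
  have hsplit : ∀ a b : ZMod p, Pt r a b - (a.val * Pt r 1 0 + b.val * Pt r 0 1) ∈ Λ := fun a b => by
    have h1 := Pt_smul r 1 0 a
    have h2 := Pt_smul r 0 1 b
    have h3 := Pt_add r a 0 0 b
    simp only [mul_one, mul_zero, add_zero, zero_add] at h1 h2 h3
    convert add_mem (add_mem h1 h2) h3 using 1; ring
  have hgen : ∀ u v : ZMod p, Sg σ (Pt r u v) (u.val * Pt r a b + v.val * Pt r a' b') := fun u v =>
    ((h.nsmul u.val).add (h'.nsmul v.val)).congr_left (by
      have := neg_mem (hsplit u v); rwa [neg_sub] at this)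
  rcases map_omega σ with e | e
  · have hb : b = 0 := (mul_eq_zero.1 (show (r ^ 2 - r) * b = 0 by linear_combination (k1.1 e).2)).resolve_left hne
    have ha : a' = 0 := (mul_eq_zero.1 (show (r ^ 2 - r) * a' = 0 by linear_combination -(k2.1 e).1)).resolve_left hne
    subst hb ha
    refine ⟨a, b', ?_, ?_, Or.inl ⟨e, fun u v => (hgen u v).congr_right ?_⟩⟩
    · rintro rfl
      exact one_ne_zero (Pt_inj hr hp (h.mem' (by simp [Pt]))).1
    · rintro rfl
      exact one_ne_zero (Pt_inj hr hp (h'.mem' (by simp [Pt]))).2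
    · have h1 := Pt_smul r a 0 u
      have h2 := Pt_smul r 0 b' v
      have h3 := Pt_add r (u * a) 0 0 (v * b')
      simp only [mul_zero, add_zero, zero_add] at h1 h2 h3
      rw [mul_comm a u, mul_comm b' v]
      convert neg_mem (add_mem (add_mem h1 h2) h3) using 1; ring
  · have hb : a = 0 := (mul_eq_zero.1 (show (r ^ 2 - r) * a = 0 by linear_combination (k1.2 e).1)).resolve_left hne
    have ha : b' = 0 := (mul_eq_zero.1 (show (r ^ 2 - r) * b' = 0 by linear_combination -(k2.2 e).2)).resolve_left hne
    subst hb ha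
    refine ⟨b, a', ?_, ?_, Or.inr ⟨e, fun u v => (hgen u v).congr_right ?_⟩⟩
    · rintro rfl
      exact one_ne_zero (Pt_inj hr hp (h.mem' (by simp [Pt]))).1
    · rintro rfl
      exact one_ne_zero (Pt_inj hr hp (h'.mem' (by simp [Pt]))).2
    · have h1 := Pt_smul r 0 b u
      have h2 := Pt_smul r a' 0 v
      have h3 := Pt_add r (v * a') 0 0 (u * b)
      simp only [mul_zero, add_zero, zero_add] at h1 h2 h3
      rw [mul_comm a' v, mul_comm b u]
      convert neg_mem (add_mem (add_mem h1 h2) h3) using 1; ring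

end TorsionAction
end Galois

open Cardinal in
lemma exists_equiv_extending (R K L : Type) [CommRing R] [Nontrivial R] [Countable R] [Field K] [Field L]
    [Algebra R K] [Algebra R L] [FaithfulSMul R K] [FaithfulSMul R L] [IsAlgClosed K] [IsAlgClosed L]
    (hK : ℵ₀ < Cardinal.mk K) (hKL : Cardinal.mk K = Cardinal.mk L) : ∃ e : K ≃+* L, ∀ a : R, e (algebraMap R K a) = algebraMap R L a := by
  obtain ⟨s, hs⟩ := exists_isTranscendenceBasis R K
  obtain ⟨t, ht⟩ := exists_isTranscendenceBasis R L
  have h : Cardinal.mk s = Cardinal.mk t := by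
    rw [← IsAlgClosed.cardinal_eq_cardinal_transcendence_basis_of_aleph0_lt' _ hs (mk_le_aleph0) hK,
      ← IsAlgClosed.cardinal_eq_cardinal_transcendence_basis_of_aleph0_lt' _ ht (mk_le_aleph0) (hKL ▸ hK), hKL]
  obtain ⟨e⟩ := Cardinal.eq.1 h
  let := IsAlgClosed.isAlgClosure_of_transcendence_basis _ hs
  let := IsAlgClosed.isAlgClosure_of_transcendence_basis _ ht
  let e' : Algebra.adjoin R (Set.range ((↑) : s → K)) ≃ₐ[R] Algebra.adjoin R (Set.range ((↑) : t → L)) :=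
    (hs.1.aevalEquiv.symm.trans (MvPolynomial.renameEquiv R e)).trans ht.1.aevalEquiv
  refine ⟨IsAlgClosure.equivOfEquiv K L e'.toRingEquiv, fun a => ?_⟩
  rw [IsScalarTower.algebraMap_apply R (Algebra.adjoin R (Set.range ((↑) : s → K))) K,
    IsAlgClosure.equivOfEquiv_algebraMap, IsScalarTower.algebraMap_apply R (Algebra.adjoin R (Set.range ((↑) : t → L))) L]
  congr 1
  exact e'.commutes a

lemma exists_automorphism {R : Type} [CommRing R] [Nontrivial R] [Countable R] {f g : R →+* ℂ}
    (hf : Function.Injective f) (hg : Function.Injective g) : ∃ σ : ℂ ≃+* ℂ, ∀ a, σ (f a) = g a :=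
  @exists_equiv_extending R ℂ ℂ _ _ _ _ _ f.toAlgebra g.toAlgebra
    (@FaithfulSMul.mk _ _ (_) (fun h => hf (by
      have := h 1
      simp only [Algebra.smul_def, mul_one] at this
      exact this)))
    (@FaithfulSMul.mk _ _ (_) (fun h => hg (by
      have := h 1
      simp only [Algebra.smul_def, mul_one] at this
      exact this)))
    _ _ (by rw [Cardinal.mk_complex]; exact Cardinal.aleph0_lt_continuum) rfl

open Polynomial in
lemma countable_polynomial : Countable ℚ[X] := by
  rw [← Cardinal.mk_le_aleph0_iff]
  exact Polynomial.cardinalMk_le_max.trans (by simp)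

open Polynomial in
lemma exists_rat_of_fixed {x : ℂ} (h : ∀ σ : ℂ ≃+* ℂ, σ x = x) : ∃ q : ℚ, (q : ℂ) = x := by
  have := countable_polynomial
  by_cases hx : IsAlgebraic ℚ x
  · by_contra hq
    have hi := hx.isIntegral
    have hn : x ∉ (⊥ : Subalgebra ℚ ℂ) := fun hm => hq (by
      obtain ⟨q, hq⟩ := Algebra.mem_bot.1 hm
      exact ⟨q, hq⟩)
    obtain ⟨y, hy, hc⟩ := (notMem_iff_exists_ne_and_isConjRoot (minpoly.irreducible hi).separable
      (IsAlgClosed.splits _)).1 hn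
    have : Fact (Irreducible (minpoly ℚ x)) := ⟨minpoly.irreducible hi⟩
    have : Countable (AdjoinRoot (minpoly ℚ x)) := AdjoinRoot.mk_surjective.countable
    have hx0 : (minpoly ℚ x).eval₂ (algebraMap ℚ ℂ) x = 0 := minpoly.aeval ℚ x
    have hy0 : (minpoly ℚ x).eval₂ (algebraMap ℚ ℂ) y = 0 := by
      rw [hc]; exact minpoly.aeval ℚ y
    obtain ⟨σ, hσ⟩ := exists_automorphism
      (f := AdjoinRoot.lift (algebraMap ℚ ℂ) x hx0) (g := AdjoinRoot.lift (algebraMap ℚ ℂ) y hy0)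
      (RingHom.injective _) (RingHom.injective _)
    have e := hσ (AdjoinRoot.root _)
    rw [AdjoinRoot.lift_root, AdjoinRoot.lift_root, h σ] at e
    exact hy e
  · have hx' : Transcendental ℚ (x + 1) := fun h1 => hx (by
      have := h1.sub isAlgebraic_one
      rwa [add_sub_cancel_right] at this)
    obtain ⟨σ, hσ⟩ := exists_automorphism
      (f := (aeval x : ℚ[X] →ₐ[ℚ] ℂ).toRingHom) (g := (aeval (x + 1) : ℚ[X] →ₐ[ℚ] ℂ).toRingHom)
      (transcendental_iff_injective.1 hx) (transcendental_iff_injective.1 hx')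
    have e := hσ Polynomial.X
    simp [h σ] at e

open CubeSum.Sub

section Family
variable {p : ℕ} [hpp : Fact p.Prime] {c c' : ZMod p → ℂ}

lemma prod_reindex {f f' : ZMod p → ℂ} (u : ZMod p ≃ ZMod p) (hu : u 0 = 0) (h : ∀ i, f' i = f (u i)) :
    ∏ i ∈ Finset.univ.erase 0, f' i = ∏ i ∈ Finset.univ.erase 0, f i :=
  Finset.prod_equiv u (fun i => by simp [← u.apply_eq_iff_eq (x := i) (y := 0), hu]) fun i _ => h i

lemma AA_congr (u : ZMod p ≃ ZMod p) (hu : u 0 = 0) (h : ∀ i, c' i - c (u i) ∈ Λ) : AA c' = AA c := by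
  rw [AA, AA, κ, κ]
  congr 1
  exact prod_reindex u hu fun i => by rw [s_congr (h i), t_congr (h i)]

lemma mu_congr (u : ZMod p ≃ ZMod p) (hu : u 0 = 0) (h : ∀ i, c' i - c (u i) ∈ Λ) : mu c' = mu c := by
  rw [mu, mu, EE, EE]
  congr 2
  exact prod_reindex u hu fun i => by rw [aa, aa, s_congr (h i), t_congr (h i)]

lemma mu_omega (c : ZMod p → ℂ) : mu (fun i => ω * c i) = mu c := by
  rw [mu, mu, EE, EE]
  congr 2
  refine Finset.prod_congr rfl fun i _ => ?_
  rw [aa, aa, s_omega, t_omega, mul_pow, omega_cube, one_mul]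

/-- The invariant `AA` of the subgroup generated by `Pt r 1 x`. -/
noncomputable def α (r x : ZMod p) : ℂ := AA (cyc r 1 x)
/-- The invariant `lam` of the subgroup generated by `Pt r 1 x`. -/
noncomputable def lm (r x : ZMod p) : ℂ := lam (cyc r 1 x)
/-- The invariant `mu` of the subgroup generated by `Pt r 1 x`. -/
noncomputable def mm (r x : ZMod p) : ℂ := mu (cyc r 1 x)

lemma cyc_scale (r a b e k : ZMod p) : cyc r (e * a) (e * b) k = cyc r a b (e * k) := by
  rw [cyc, cyc, ← mul_assoc, ← mul_assoc, mul_comm k e]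

lemma cyc_scale' (r : ZMod p) {a : ZMod p} (b : ZMod p) (ha : a ≠ 0) (k : ZMod p) :
    cyc r a b k - cyc r 1 (b / a) (Equiv.mulLeft₀ a ha k) ∈ Λ := by
  rw [show Equiv.mulLeft₀ a ha k = a * k from rfl, ← cyc_scale, mul_one, mul_div_cancel₀ _ ha, sub_self]
  exact zero_mem _

lemma AA_cyc (r : ZMod p) {a : ZMod p} (b : ZMod p) (ha : a ≠ 0) : AA (cyc r a b) = α r (b / a) :=
  AA_congr (Equiv.mulLeft₀ a ha) (by simp) (cyc_scale' r b ha)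
lemma lam_cyc (r : ZMod p) {a : ZMod p} (b : ZMod p) (ha : a ≠ 0) : lam (cyc r a b) = lm r (b / a) :=
  lam_congr (Equiv.mulLeft₀ a ha) (by simp) (cyc_scale' r b ha)
lemma mu_cyc (r : ZMod p) {a : ZMod p} (b : ZMod p) (ha : a ≠ 0) : mu (cyc r a b) = mm r (b / a) :=
  mu_congr (Equiv.mulLeft₀ a ha) (by simp) (cyc_scale' r b ha)

lemma right_congr (r : ZMod p) {b : ZMod p} (hb : b ≠ 0) (k : ZMod p) :
    cyc r 0 b k - cyc r 0 1 (Equiv.mulLeft₀ b hb k) ∈ Λ := by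
  have := cyc_scale r 0 1 b k
  rw [mul_zero, mul_one] at this
  rw [show Equiv.mulLeft₀ b hb k = b * k from rfl, this, sub_self]
  exact zero_mem _

lemma α_cube (hp : p % 3 = 1) (r x : ZMod p) : α r x ^ 3 = 1 - lm r x := AA_cube hp _

variable {r : ZMod p} (hr : r ^ 2 + r + 1 = 0) (hp : p % 3 = 1)
include hr

omit hr in
lemma ne_zero_of_root (hr : r ^ 2 + r + 1 = 0) : r ≠ 0 := by
  rintro rfl; simp at hr

include hp

lemma lm_root (x : ZMod p) : lm r (r * x) = ω ^ 2 * lm r x := by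
  have h0 := ne_zero_of_root hr
  have h := lam_omega (sub_cyc hr hp (a := 1) (b := x) (Or.inl one_ne_zero)) hp
  rw [lam_congr (c := cyc r (r * 1) (r ^ 2 * x)) (Equiv.refl _) rfl (omega_cyc hr 1 x), mul_one, lam_cyc r _ h0] at h
  rwa [show r ^ 2 * x / r = r * x by field_simp] at h

omit hp in
lemma mm_root (x : ZMod p) : mm r (r * x) = mm r x := by
  have h0 := ne_zero_of_root hr
  have h := mu_omega (cyc r 1 x)
  rw [mu_congr (c := cyc r (r * 1) (r ^ 2 * x)) (Equiv.refl _) rfl (omega_cyc hr 1 x), mul_one, mu_cyc r _ h0] at h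
  rwa [show r ^ 2 * x / r = r * x by field_simp] at h

lemma lm_mm (x : ZMod p) : lm r x = lm r (-x) * mm r x ∧ mm r x ^ 3 = lm r x ^ 3 - 1 := by
  obtain ⟨h1, h2⟩ := lam_mu (sub_cyc hr hp (a := 1) (b := x) (Or.inl one_ne_zero)) hp
  refine ⟨?_, h2⟩
  have hr4 : r ^ 4 = r := by linear_combination (r ^ 2 - r) * hr
  have h0 : r ^ 2 - r ≠ 0 := fun h => two_mul_r_add_one_ne hr hp (by linear_combination hr - h)
  have e := lam_congr (c := cyc r (r ^ 2 - r) ((r - r ^ 2) * x)) (c' := fun i => (ω ^ 2 - ω) * cyc r 1 x i)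
    (Equiv.refl _) rfl fun i => by
      have e1 := omega_cyc hr 1 x i
      have e2 := omega_cyc hr (r * 1) (r ^ 2 * x) i
      have e3 := omega_mul_mem_hex.2 e1
      have e4 := Pt_sub r (i * (r * (r * 1))) (i * (r ^ 2 * (r ^ 2 * x))) (i * (r * 1)) (i * (r ^ 2 * x))
      have e5 : cyc r (r ^ 2 - r) ((r - r ^ 2) * x) i = Pt r (i * (r * (r * 1)) - i * (r * 1))
          (i * (r ^ 2 * (r ^ 2 * x)) - i * (r ^ 2 * x)) := by
        rw [cyc]
        congr 1
        · ring
        · linear_combination -i * x * hr4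
      rw [Equiv.refl_apply, e5]
      convert sub_mem (sub_mem (add_mem e2 e3) e1) e4 using 1
      simp only [cyc]
      ring
  rw [lam_cyc r _ h0, show (r - r ^ 2) * x / (r ^ 2 - r) = -x by
    rw [div_eq_iff h0]; ring] at e
  rw [← e]
  exact h1

end Family

lemma conj_omega : starRingAut ω = ω ^ 2 := by
  rw [omega_sq]
  apply Complex.ext <;> simp [ω, starRingAut]
  ring

section Special
variable {p : ℕ} [hpp : Fact p.Prime] {B : ValuationSubring ℂ}
  {ι : ZMod p →+* IsLocalRing.ResidueField B} {r : ZMod p}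
variable (hr : r ^ 2 + r + 1 = 0) (hp : p % 3 = 1)
include hr hp

lemma conj_left : starRingAut (AA (cyc r 1 0)) = AA (cyc r 0 1) ∧ starRingAut (mu (cyc r 1 0)) = mu (cyc r 0 1) := by
  obtain ⟨x, y, hx, hy, ⟨h, -⟩ | ⟨-, h⟩⟩ := exists_action hr hp starRingAut
  · rw [conj_omega] at h
    exact absurd (mul_right_cancel₀ omega_ne_zero (by rw [← pow_two, one_mul, h]) : ω = 1) omega_ne_one
  · have h' : ∀ i, Sg starRingAut (cyc r 1 0 i) (cyc r 0 x i) := fun i => by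
      have := h (i * 1) (i * 0)
      rw [mul_zero, mul_zero, mul_one, mul_comm x] at this
      rwa [cyc, cyc, mul_one, mul_zero]
    have hc := sub_cyc hr hp (a := 1) (b := 0) (Or.inl one_ne_zero)
    have hc' := sub_cyc hr hp (a := 0) (b := x) (Or.inr hx)
    rw [map_AA hc hc' hp h', map_mu hc hc' hp h', AA_congr (Equiv.mulLeft₀ x hx) (by simp) (right_congr r hx),
      mu_congr (Equiv.mulLeft₀ x hx) (by simp) (right_congr r hx)]
    exact ⟨rfl, rfl⟩

lemma α_residue (hω : Rd B ω (ι r)) (h3 : ¬ ∃ x : ZMod p, x ^ 3 = 3) :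
    ∃ e : IsLocalRing.ResidueField B, e ^ 3 = 1 ∧ e ≠ 1 ∧ ∀ x ≠ 0, Rd B (α r x) e ∧ Rd B (lm r x) 0 ∧ Rd B (mm r x) (-1) := by
  obtain ⟨c1, c2⟩ := conj_left hr hp
  have hA := AA_right hp hr
  obtain ⟨e, he⟩ := Rd.mk (B := B) (Rd.of_pow three_ne_zero (hA ▸ Rd.one))
  have hred : ∀ x ≠ 0, ∀ i ≠ 0, ∃ u, Red B (cyc r 0 1 i) u ∧ Red B (cyc r x⁻¹ 1 i) u ∧ u 0 * u 1 * u 2 ≠ 0 :=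
    fun x hx i hi => by
      obtain ⟨u, hu⟩ := Red.exists' (B := B) (Pt r 0 (i * 1))
      refine ⟨u, by rwa [cyc, mul_zero], red_add hp hr hω _ hu, red_right hp hr hω (by simpa using hi) hu⟩
  have hα : ∀ x ≠ 0, Rd B (α r x) e := fun x hx => by
    obtain ⟨a, h1, h2⟩ := rd_AA hp hr hω (hred x hx)
    rw [AA_cyc r _ (inv_ne_zero hx), one_div, inv_inv] at h2
    rwa [he.unique h1]
  have he3 : e ^ 3 = 1 := (he.pow 3).unique (hA ▸ Rd.one)
  have hl : ∀ x ≠ 0, Rd B (lm r x) 0 := fun x hx => by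
    have := Rd.one.sub ((hα x hx).pow 3)
    rwa [he3, sub_self, α_cube hp, sub_sub_cancel] at this
  refine ⟨e, he3, ?_, fun x hx => ⟨hα x hx, hl x hx, ?_⟩⟩
  · rintro rfl
    have h1 : AA (cyc r 0 1) ≠ 1 := fun h => AA_left_ne hp hr hω h3 (starRingAut.injective (by rw [c1, h, map_one]))
    have h2 : AA (cyc r 0 1) ^ 2 + AA (cyc r 0 1) + 1 = 0 :=
      (mul_eq_zero.1 (by linear_combination hA : (AA (cyc r 0 1) - 1) * (AA (cyc r 0 1) ^ 2 + AA (cyc r 0 1) + 1) = 0)).resolve_left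
        (sub_ne_zero.2 h1)
    have h4 := (((he.pow 2).add he).add Rd.one).unique (h2 ▸ Rd.zero)
    exact three_ne_zero_res hp ι (by linear_combination h4)
  · have hc := sub_cyc hr hp (a := 0) (b := 1) (Or.inr one_ne_zero)
    have hc' := sub_cyc hr hp (a := x⁻¹) (b := 1) (Or.inr one_ne_zero)
    have hl0 : Rd B (lam (cyc r 0 1)) 0 := by
      rw [hc.lam_stable hp (omega_cyc_right hr)]; exact Rd.zero
    have e1 : lam (cyc r x⁻¹ 1) = lm r x := by rw [lam_cyc r _ (inv_ne_zero hx), one_div, inv_inv]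
    obtain ⟨a, h1, h2⟩ := rd_mu hp hω hc hc' hl0 (e1 ▸ hl x hx) fun i hi => by
      obtain ⟨u, hu, hu', hn⟩ := hred x hx i hi
      exact ⟨u, hu, hu', right_ne_zero_of_mul hn⟩
    rw [← c2, mu_left hp hr hω, map_neg, map_one] at h1
    rw [mu_cyc r _ (inv_ne_zero hx), one_div, inv_inv, h1.unique Rd.one.neg] at h2
    exact h2

end Special

section Transversal
variable {G : Type*} [CommGroup G] {g : G} (hg : ∀ x, x ∈ Submonoid.powers g) {m : ℕ} {f : G → ℂ}
  (hf : ∀ x, f (g ^ m * x) = f x)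
include hg hf

/-- A product over a transversal of a cyclic group does not depend on the transversal. -/
lemma prod_transversal (x : G) : ∏ j ∈ Finset.range m, f (g ^ j * x) = ∏ j ∈ Finset.range m, f (g ^ j) := by
  obtain ⟨n, rfl⟩ := hg x
  induction n with
  | zero => simp
  | succ n ih =>
    rw [← ih]
    rcases m with _ | m
    · simp
    · rw [Finset.prod_range_succ, Finset.prod_range_succ']
      congr 1
      · refine Finset.prod_congr rfl fun j _ => ?_
        congr 1
        simp only [pow_succ]
        rw [mul_comm _ g, ← mul_assoc]
      · change f (g ^ m * g ^ (n + 1)) = f (g ^ 0 * g ^ n)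
        rw [pow_zero, one_mul, ← hf (g ^ n), ← pow_add, ← pow_add]
        congr 2
        ring

lemma prod_transversal_cube [Fintype G] (hm : Fintype.card G = 3 * m) :
    (∏ j ∈ Finset.range m, f (g ^ j)) ^ 3 = ∏ x, f x := by
  classical
  have hz : ∀ x, x ∈ Subgroup.zpowers g := fun x => by
    obtain ⟨n, rfl⟩ := hg x
    exact ⟨n, zpow_natCast g n⟩
  have ho := orderOf_eq_card_of_forall_mem_zpowers hz
  rw [← IsCyclic.image_range_card hz, Finset.prod_image, Nat.card_eq_fintype_card, hm,
    show 3 * m = m + m + m by ring, Finset.prod_range_add, Finset.prod_range_add]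
  · have e1 : ∀ j, f (g ^ (m + j)) = f (g ^ j) := fun j => by rw [pow_add, hf]
    have e2 : ∀ j, f (g ^ (m + m + j)) = f (g ^ j) := fun j => by rw [add_assoc, pow_add, hf, e1]
    simp only [e1, e2]
    ring
  · intro i hi j hj h
    simp only [Finset.coe_range, Set.mem_Iio] at hi hj
    exact pow_injOn_Iio_orderOf (by rw [ho]; exact hi) (by rw [ho]; exact hj) h

end Transversal

section Beta
variable {p : ℕ} [hpp : Fact p.Prime]

/-- The product of the first coordinates over a pair of eigen-subgroups. -/
noncomputable def bb (r : ZMod p) (x y k : (ZMod p)ˣ) : ℂ := s (Pt r (k * x) 0) * s (Pt r 0 (k * y))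

/-- A cube root of `p`, as a function on the units modulo `p`. -/
noncomputable def β (r : ZMod p) (g x y : (ZMod p)ˣ) : ℂ :=
  ∏ j ∈ Finset.range ((p - 1) / 3), bb r x y (g ^ j)

variable {ρ : (ZMod p)ˣ} (hr : (ρ : ZMod p) ^ 2 + ρ + 1 = 0) (hp : p % 3 = 1)
  {g : (ZMod p)ˣ} (hg : ∀ x, x ∈ Submonoid.powers g)

lemma bb_mul (r : ZMod p) (x y z k : (ZMod p)ˣ) : bb r (z * x) (z * y) k = bb r x y (k * z) := by
  simp only [bb, Units.val_mul, mul_assoc]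

include hr

lemma s_right (y : ZMod p) : s (Pt (ρ : ZMod p) 0 (ρ * y)) = ω ^ 2 * s (Pt (ρ : ZMod p) 0 y) := by
  have h1 := omega_mul_Pt hr 0 y
  have h2 := omega_mul_Pt hr 0 ((ρ : ZMod p) ^ 2 * y)
  rw [mul_zero] at h1 h2
  have e : (ρ : ZMod p) ^ 2 * ((ρ : ZMod p) ^ 2 * y) = ρ * y := by
    linear_combination y * ((ρ : ZMod p) ^ 2 - ρ) * hr
  rw [e] at h2
  rw [← s_congr h2, s_omega, ← s_congr h1, s_omega]
  ring

lemma s_left (x : ZMod p) : s (Pt (ρ : ZMod p) (ρ * x) 0) = ω * s (Pt (ρ : ZMod p) x 0) := by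
  have h1 := omega_mul_Pt hr x 0
  rw [mul_zero] at h1
  rw [← s_congr h1, s_omega]

lemma bb_root (x y k : (ZMod p)ˣ) : bb (ρ : ZMod p) x y (ρ * k) = bb (ρ : ZMod p) x y k := by
  rw [bb, bb, Units.val_mul, mul_assoc, mul_assoc, s_left hr, s_right hr]
  linear_combination s (Pt (ρ : ZMod p) (↑k * ↑x) 0) * s (Pt (ρ : ZMod p) 0 (↑k * ↑y)) * omega_cube

lemma bb_root' (x y k : (ZMod p)ˣ) : bb (ρ : ZMod p) x (ρ * y) k = ω ^ 2 * bb (ρ : ZMod p) x y k := by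
  rw [bb, bb, Units.val_mul, mul_left_comm, s_right hr]
  ring

lemma β_root (x y : (ZMod p)ˣ) : β (ρ : ZMod p) g x (ρ * y) = ω ^ (2 * ((p - 1) / 3)) * β (ρ : ZMod p) g x y := by
  simp only [β, bb_root' hr, Finset.prod_mul_distrib, Finset.prod_const, Finset.card_range, ← pow_mul]

include hp

lemma bb_pow (x y k : (ZMod p)ˣ) : bb (ρ : ZMod p) x y (g ^ ((p - 1) / 3) * k) = bb (ρ : ZMod p) x y k := by
  have h3 : ((g ^ ((p - 1) / 3) : (ZMod p)ˣ) : ZMod p) ^ 3 = 1 := by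
    rw [← Units.val_pow_eq_pow_val, ← pow_mul, show (p - 1) / 3 * 3 = p - 1 by omega, ZMod.units_pow_card_sub_one_eq_one,
      Units.val_one]
  set e := g ^ ((p - 1) / 3) with he
  have : (((e : ZMod p) - 1) * (e - ρ)) * (e - ρ ^ 2) = 0 := by
    linear_combination h3 + (-(e : ZMod p) ^ 2 + e * ρ + 1 - ρ) * hr
  rcases mul_eq_zero.1 this with h | h
  · rcases mul_eq_zero.1 h with h | h
    · rw [show e = 1 from Units.ext (sub_eq_zero.1 h), one_mul]
    · rw [show e = ρ from Units.ext (sub_eq_zero.1 h), bb_root hr]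
  · rw [show e = ρ * ρ from Units.ext (by rw [sub_eq_zero.1 h, Units.val_mul, pow_two]), mul_assoc, bb_root hr, bb_root hr]

include hg

lemma β_scale (x y z : (ZMod p)ˣ) : β (ρ : ZMod p) g (z * x) (z * y) = β (ρ : ZMod p) g x y := by
  simp only [β, bb_mul]
  exact prod_transversal hg (bb_pow hr hp x y) z

lemma β_cube (x y : (ZMod p)ˣ) : β (ρ : ZMod p) g x y ^ 3 = p := by
  have hc : Fintype.card (ZMod p)ˣ = 3 * ((p - 1) / 3) := by
    rw [ZMod.card_units]; have := hpp.out.two_le; omega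
  have key : ∀ (F : ZMod p → ℂ) (x : (ZMod p)ˣ), ∏ k : (ZMod p)ˣ, F (k * x) = ∏ i ∈ Finset.univ.erase 0, F i := fun F x => by
    refine Finset.prod_bij' (fun k _ => (k * x : ZMod p)) (fun i hi => Units.mk0 i (Finset.ne_of_mem_erase hi) * x⁻¹) ?_ ?_ ?_ ?_ ?_
    · intro k _; simp
    · intro i _; exact (Finset.mem_univ _)
    · intro k _; exact Units.ext (by rw [Units.val_mul, Units.val_mk0, mul_assoc, Units.mul_inv, mul_one])
    · intro i _
      change (Units.mk0 i _ * x⁻¹ : (ZMod p)ˣ) * (x : ZMod p) = i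
      rw [Units.val_mul, Units.val_mk0, mul_assoc, Units.inv_mul, mul_one]
    · intro k _; rfl
  rw [β, prod_transversal_cube hg (bb_pow hr hp x y) hc, ← π₁_mul_π₂ hr hp]
  simp only [bb, Finset.prod_mul_distrib]
  rw [key (fun i => s (Pt (ρ : ZMod p) i 0)), key (fun i => s (Pt (ρ : ZMod p) 0 i)), π₁, π₂, Sub.PP, Sub.PP]
  simp only [cyc, mul_one, mul_zero]

lemma β_eq (x y : (ZMod p)ˣ) : β (ρ : ZMod p) g x y = β (ρ : ZMod p) g 1 (x⁻¹ * y) := by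
  rw [← β_scale hr hp hg x y x⁻¹, inv_mul_cancel]

omit hg

lemma map_s_Pt {σ : ℂ ≃+* ℂ} {a b a' b' : ZMod p} (h : Sg σ (Pt (ρ : ZMod p) a b) (Pt (ρ : ZMod p) a' b')) :
    σ (s (Pt (ρ : ZMod p) a b)) = s (Pt (ρ : ZMod p) a' b') :=
  (h.st (reg_Pt hr hp a b)).2.1.symm

lemma map_family {σ : ℂ ≃+* ℂ} {x a b : (ZMod p)ˣ}
    (h : ∀ k, Sg σ (cyc (ρ : ZMod p) 1 x k) (cyc (ρ : ZMod p) a b k)) :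
    σ (α (ρ : ZMod p) x) = α (ρ : ZMod p) (a⁻¹ * b : (ZMod p)ˣ) ∧ σ (lm (ρ : ZMod p) x) = lm (ρ : ZMod p) (a⁻¹ * b : (ZMod p)ˣ) ∧
      σ (mm (ρ : ZMod p) x) = mm (ρ : ZMod p) (a⁻¹ * b : (ZMod p)ˣ) := by
  have hc := sub_cyc hr hp (a := 1) (b := x) (Or.inl one_ne_zero)
  have hc' := sub_cyc hr hp (a := a) (b := b) (Or.inl a.ne_zero)
  have e : ((a⁻¹ * b : (ZMod p)ˣ) : ZMod p) = b / a := by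
    rw [Units.val_mul, Units.val_inv_eq_inv_val, div_eq_inv_mul]
  rw [e, ← AA_cyc _ _ a.ne_zero, ← lam_cyc _ _ a.ne_zero, ← mu_cyc _ _ a.ne_zero]
  exact ⟨map_AA hc hc' hp h, map_lam hc hc' hp h, map_mu hc hc' hp h⟩

include hg

/-- Automorphisms act on the units indexing the families by translations or reflections. -/
lemma action (σ : ℂ ≃+* ℂ) : ∃ c : (ZMod p)ˣ,
    (σ ω = ω ∧ ∀ x : (ZMod p)ˣ, σ (β (ρ : ZMod p) g 1 x) = β (ρ : ZMod p) g 1 (c * x) ∧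
      σ (α (ρ : ZMod p) x) = α (ρ : ZMod p) (c * x : (ZMod p)ˣ) ∧
      σ (lm (ρ : ZMod p) x) = lm (ρ : ZMod p) (c * x : (ZMod p)ˣ) ∧
      σ (mm (ρ : ZMod p) x) = mm (ρ : ZMod p) (c * x : (ZMod p)ˣ)) ∨
    (σ ω = ω ^ 2 ∧ ∀ x : (ZMod p)ˣ, σ (β (ρ : ZMod p) g 1 x) = β (ρ : ZMod p) g 1 (c * x⁻¹) ∧
      σ (α (ρ : ZMod p) x) = α (ρ : ZMod p) (c * x⁻¹ : (ZMod p)ˣ) ∧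
      σ (lm (ρ : ZMod p) x) = lm (ρ : ZMod p) (c * x⁻¹ : (ZMod p)ˣ) ∧
      σ (mm (ρ : ZMod p) x) = mm (ρ : ZMod p) (c * x⁻¹ : (ZMod p)ˣ)) := by
  obtain ⟨a, b, ha, hb, h⟩ := exists_action hr hp σ
  obtain ⟨a, rfl⟩ : ∃ u : (ZMod p)ˣ, (u : ZMod p) = a := ⟨Units.mk0 a ha, rfl⟩
  obtain ⟨b, rfl⟩ : ∃ u : (ZMod p)ˣ, (u : ZMod p) = b := ⟨Units.mk0 b hb, rfl⟩
  rcases h with ⟨hω, h⟩ | ⟨hω, h⟩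
  · refine ⟨a⁻¹ * b, Or.inl ⟨hω, fun x => ⟨?_, ?_⟩⟩⟩
    · rw [mul_assoc, ← β_eq hr hp hg, β, map_prod, β]
      refine Finset.prod_congr rfl fun j _ => ?_
      rw [bb, map_mul, map_s_Pt hr hp (h _ _), map_s_Pt hr hp (h _ _), bb]
      congr 3
      · simp only [Units.val_one]; ring
      · ring
      · ring
      · simp only [Units.val_mul]; ring
    · rw [mul_assoc]
      refine map_family hr hp fun k => ?_
      have := h (k * 1) (k * x)
      rwa [cyc, cyc, Units.val_mul, mul_left_comm k, ← mul_one (k * (a : ZMod p)), mul_assoc, mul_left_comm k]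
  · refine ⟨b⁻¹ * a, Or.inr ⟨hω, fun x => ⟨?_, ?_⟩⟩⟩
    · rw [show b⁻¹ * a * x⁻¹ = (b * x)⁻¹ * a by rw [mul_inv]; exact mul_right_comm _ _ _, ← β_eq hr hp hg, β, map_prod, β]
      refine Finset.prod_congr rfl fun j _ => ?_
      rw [bb, map_mul, map_s_Pt hr hp (h _ _), map_s_Pt hr hp (h _ _), bb, mul_comm]
      congr 3
      · simp only [Units.val_mul]; ring
      · ring
      · ring
      · simp only [Units.val_one]; ring
    · rw [show b⁻¹ * a * x⁻¹ = (b * x)⁻¹ * a by rw [mul_inv]; exact mul_right_comm _ _ _]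
      refine map_family hr hp fun k => ?_
      have := h (k * 1) (k * x)
      rw [mul_one, mul_left_comm, mul_comm (a : ZMod p)] at this
      rwa [cyc, cyc, Units.val_mul, mul_one]

end Beta

lemma eq_of_cube_eq {θ x y : ℂ} (hθ : θ ^ 3 = 1) (h1 : θ ≠ 1) (h : x ^ 3 = y ^ 3) :
    x = y ∨ x = θ * y ∨ x = θ * (θ * y) := by
  have h2 : θ ^ 2 + θ + 1 = 0 :=
    (mul_eq_zero.1 (by linear_combination hθ : (θ - 1) * (θ ^ 2 + θ + 1) = 0)).resolve_left (sub_ne_zero.2 h1)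
  have : (x - y) * ((x - θ * y) * (x - θ * (θ * y))) = 0 := by
    linear_combination h + (-x ^ 2 * y + x * θ * y ^ 2 - y ^ 3 * (θ - 1)) * h2
  rcases mul_eq_zero.1 this with h | h
  · exact Or.inl (sub_eq_zero.1 h)
  · exact Or.inr ((mul_eq_zero.1 h).imp sub_eq_zero.1 sub_eq_zero.1)

section Descent
variable {G : Type*} [Fintype G] {β M : G → ℂ} {θ η P : ℂ} {j m : ℕ}
  {B : ValuationSubring ℂ} {a : IsLocalRing.ResidueField B}

open Classical in
/-- The sum of the values of `M` over a fibre of `β`. -/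
noncomputable def fibreSum (β M : G → ℂ) (b : ℂ) : ℂ := ∑ x ∈ Finset.univ.filter (fun x => β x = b), M x

lemma Sg.fibreSum {σ : ℂ ≃+* ℂ} {π : G ≃ G} (h : ∀ x, σ (β x) = β (π x) ∧ Sg σ (M x) (M (π x))) (b : ℂ) :
    Sg σ (fibreSum β M b) (fibreSum β M (σ b)) := by
  classical
  have := Sg.sum (σ := σ) (S := Finset.univ.filter (fun x => β x = b)) (f := M) (g := fun x => M (π x)) fun x _ => (h x).2
  rw [CubeSum.fibreSum, CubeSum.fibreSum]
  convert this using 1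
  refine (Finset.sum_equiv π (fun x => ?_) fun _ _ => rfl).symm
  simp [← (h x).1]

section Root
variable [CommGroup G] {ρ : G} (hθ : θ ^ 3 = 1) (hβ : ∀ x, β (ρ * x) = θ * β x)
include hθ hβ

lemma fibreSum_root (hM : ∀ x, M (ρ * x) - η * M x ∈ Λ) (b : ℂ) :
    fibreSum β M (θ * b) - η * fibreSum β M b ∈ Λ := by
  classical
  have h0 : θ ≠ 0 := by rintro rfl; simp at hθ
  have e : fibreSum β M (θ * b) = ∑ x ∈ Finset.univ.filter (fun x => β x = b), M (ρ * x) := by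
    rw [fibreSum]
    refine (Finset.sum_equiv (Equiv.mulLeft ρ) (fun x => ?_) fun _ _ => rfl).symm
    simp [hβ, h0]
  rw [e, fibreSum, Finset.mul_sum, ← Finset.sum_sub_distrib]
  exact sum_mem fun x _ => hM x

open Classical in
lemma card_fibre (h1 : θ ≠ 1) (hP : P ≠ 0) (h3 : ∀ x, β x ^ 3 = P) (hm : Fintype.card G = 3 * m) (x : G) :
    (Finset.univ.filter (fun y => β y = β x)).card = m := by
  have h0 : θ ≠ 0 := by rintro rfl; simp at hθ
  have hc : ∀ b, (Finset.univ.filter (fun y => β y = θ * b)).card = (Finset.univ.filter (fun y => β y = b)).card := fun b => by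
    refine (Finset.card_equiv (Equiv.mulLeft ρ) fun x => ?_).symm
    simp [hβ, h0]
  have hb : β x ≠ 0 := fun h => hP (by rw [← h3 x, h]; simp)
  have hmem : ∀ y ∈ (Finset.univ : Finset G), β y ∈ ({β x, θ * β x, θ * (θ * β x)} : Finset ℂ) := fun y _ => by
    simpa only [Finset.mem_insert, Finset.mem_singleton] using eq_of_cube_eq hθ h1 ((h3 y).trans (h3 x).symm)
  have := Finset.card_eq_sum_card_fiberwise hmem
  have n1 : β x ≠ θ * β x := fun h => h1 (mul_right_cancel₀ hb (by rw [one_mul, ← h]))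
  have n2 : θ * β x ≠ θ * (θ * β x) := fun h => n1 (mul_left_cancel₀ h0 h)
  have n3 : β x ≠ θ * (θ * β x) := fun h => n1 (by linear_combination -θ * h - β x * hθ)
  rw [Finset.sum_insert (by simp [n1, n3]), Finset.sum_insert (by simpa using n2), Finset.sum_singleton,
    Finset.card_univ, hm] at this
  simp only [hc] at this
  omega

end Root

/-- A Galois-equivariant family of points on the Fermat cubic gives a sum of two rational cubes. -/
lemma descent [CommGroup G] {ρ : G} {p : ℕ} (hp0 : p ≠ 0) (hθ : θ ^ 3 = 1) (h1 : θ ≠ 1) (hη : η = θ ^ j) (hηω : η = ω ∨ η = ω ^ 2)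
    (hβ : ∀ x, β (ρ * x) = θ * β x) (hM : ∀ x, M (ρ * x) - η * M x ∈ Λ)
    (hσ : ∀ σ : ℂ ≃+* ℂ, ∃ π : G ≃ G, ∀ x, σ (β x) = β (π x) ∧ Sg σ (M x) (M (π x)))
    (h3 : ∀ x, β x ^ 3 = p) (hm : Fintype.card G = 3 * m) (hm3 : ¬ 3 ∣ m)
    (hch : (3 : IsLocalRing.ResidueField B) ≠ 0)
    (ha : a ^ 3 = 1) (ha1 : a ≠ 1) (hred : ∀ x, Red B (M x) ![0, -a, 1]) :
    ∃ x y : ℚ, x ≠ 0 ∧ y ≠ 0 ∧ x ^ 3 + y ^ 3 = (p : ℚ) ^ j := by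
  have hP : (p : ℂ) ≠ 0 := Nat.cast_ne_zero.2 hp0
  have h0 : θ ≠ 0 := by rintro rfl; simp at hθ
  have hs : ∀ z, s (η * z) = η * s z ∧ t (η * z) = t z := by
    rcases hηω with rfl | rfl <;> intro z
    · exact ⟨s_omega z, t_omega z⟩
    · rw [pow_two, mul_assoc, s_omega, s_omega, t_omega, t_omega, mul_assoc]; exact ⟨rfl, rfl⟩
  set Q := fibreSum β M
  have hQ : ∀ b, s (Q (θ * b)) = θ ^ j * s (Q b) ∧ t (Q (θ * b)) = t (Q b) := fun b => by
    have := fibreSum_root hθ hβ hM b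
    rw [s_congr this, t_congr this, (hs _).1, (hs _).2, hη]
    exact ⟨rfl, rfl⟩
  set b := β 1
  have hb : b ≠ 0 := fun h => hP (by rw [← h3 1, show β 1 = 0 from h]; simp)
  have hQb : Red B (Q b) ![0, -a ^ m, 1] := by
    classical
    have := Red.sum_torsion hch (S := Finset.univ.filter (fun x => β x = b)) ha fun x _ => hred x
    rwa [card_fibre hθ hβ h1 hP h3 hm] at this
  obtain ⟨hreg, hrs, hrt⟩ := hQb.st one_ne_zero
  have am : a ^ m ≠ 1 := fun h => by
    have := orderOf_dvd_of_pow_eq_one h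
    rw [orderOf_eq_prime (p := 3) ha ha1] at this
    exact hm3 this
  have a0 : a ≠ 0 := by rintro rfl; simp at ha
  replace hrt : Rd B (t (Q b)) (-a ^ m) := by simpa using hrt
  have key : ∀ σ : ℂ ≃+* ℂ, σ (s (Q b)) / σ b ^ j = s (Q b) / b ^ j ∧ σ (t (Q b)) = t (Q b) := fun σ => by
    obtain ⟨π, hπ⟩ := hσ σ
    obtain ⟨-, e1, e2⟩ := (Sg.fibreSum hπ b).st hreg
    rw [← e1, ← e2]
    have hb3 : σ b ^ 3 = b ^ 3 := by rw [← map_pow, h3, map_natCast]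
    have step : ∀ b', s (Q (θ * b')) / (θ * b') ^ j = s (Q b') / b' ^ j ∧ t (Q (θ * b')) = t (Q b') := fun b' => by
      rw [(hQ b').1, mul_pow, mul_div_mul_left _ _ (pow_ne_zero _ h0)]
      exact ⟨rfl, (hQ b').2⟩
    rcases eq_of_cube_eq hθ h1 hb3 with h | h | h
    · rw [h]; exact ⟨rfl, rfl⟩
    · rw [h]; exact step b
    · rw [h]; exact ⟨(step _).1.trans (step b).1, (step _).2.trans (step b).2⟩
  obtain ⟨y, hy⟩ := exists_rat_of_fixed fun σ => (key σ).2
  obtain ⟨w, hw⟩ := exists_rat_of_fixed (x := s (Q b) / b ^ j) fun σ => by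
    rw [map_div₀, map_pow]; exact (key σ).1
  have hS : s (Q b) = w * b ^ j := by rw [hw, div_mul_cancel₀ _ (pow_ne_zero _ hb)]
  have hc := curve hreg
  have hbj : (b ^ j) ^ 3 = (p : ℂ) ^ j := by rw [← pow_mul, mul_comm, pow_mul, h3]
  rw [hS, ← hy, mul_pow, hbj] at hc
  have hc' : w ^ 3 * (p : ℚ) ^ j + y ^ 3 + 1 = 0 := by exact_mod_cast hc
  have hy0 : y ≠ 0 := by
    rintro rfl
    rw [← hy, Rat.cast_zero] at hrt
    exact neg_ne_zero.2 (pow_ne_zero _ a0) (hrt.unique Rd.zero)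
  have hw0 : w ≠ 0 := by
    rintro rfl
    have : (y + 1) * ((2 * y - 1) ^ 2 + 3) = 0 := by linear_combination 4 * hc'
    have : y = -1 := by
      rcases mul_eq_zero.1 this with h | h
      · linear_combination h
      · nlinarith [sq_nonneg (2 * y - 1)]
    rw [← hy, this, Rat.cast_neg, Rat.cast_one] at hrt
    exact am (neg_injective (hrt.unique Rd.one.neg))
  refine ⟨-(y / w), -(1 / w), neg_ne_zero.2 (div_ne_zero hy0 hw0), neg_ne_zero.2 (div_ne_zero one_ne_zero hw0), ?_⟩
  field_simp
  linear_combination -hc'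

end Descent

open Classical in
/-- A parameter of the point `(a, b)` of the affine Fermat cubic. -/
noncomputable def pnt (a b : ℂ) : ℂ := if h : a ^ 3 + b ^ 3 + 1 = 0 then (exists_st h).choose else 0

lemma pnt_spec {a b : ℂ} (h : a ^ 3 + b ^ 3 + 1 = 0) : Reg (pnt a b) ∧ s (pnt a b) = a ∧ t (pnt a b) = b := by
  rw [pnt, dif_pos h]; exact (exists_st h).choose_spec

lemma Sg.pnt (σ : ℂ ≃+* ℂ) {a b : ℂ} (h : a ^ 3 + b ^ 3 + 1 = 0) : Sg σ (pnt a b) (CubeSum.pnt (σ a) (σ b)) := by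
  have h' : σ a ^ 3 + σ b ^ 3 + 1 = 0 := by
    rw [← map_pow, ← map_pow, ← map_add, ← map_one σ, ← map_add, h, map_zero]
  obtain ⟨h1, h2, h3⟩ := pnt_spec h
  obtain ⟨h1', h2', h3'⟩ := pnt_spec h'
  exact Sg.of_st h1 h1' (by rw [h2, h2']) (by rw [h3, h3'])

lemma pnt_omega {a b : ℂ} (h : a ^ 3 + b ^ 3 + 1 = 0) : pnt (ω * a) b - ω * pnt a b ∈ Λ := by
  have h' : (ω * a) ^ 3 + b ^ 3 + 1 = 0 := by rw [mul_pow, omega_cube, one_mul, h]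
  obtain ⟨h1, h2, h3⟩ := pnt_spec h
  obtain ⟨h1', h2', h3'⟩ := pnt_spec h'
  exact cr_of_st h1' ((reg_omega _).2 h1) (by rw [s_omega, h2, h2']) (by rw [t_omega, h3, h3'])

lemma pnt_omega_sq {a b : ℂ} (h : a ^ 3 + b ^ 3 + 1 = 0) : pnt (ω ^ 2 * a) b - ω ^ 2 * pnt a b ∈ Λ := by
  have h' : (ω ^ 2 * a) ^ 3 + b ^ 3 + 1 = 0 := by rw [mul_pow, ← pow_mul, mul_comm 2 3, pow_mul, omega_cube, one_pow, one_mul, h]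
  obtain ⟨h1, h2, h3⟩ := pnt_spec h
  obtain ⟨h1', h2', h3'⟩ := pnt_spec h'
  rw [pow_two, mul_assoc, mul_assoc] at *
  exact cr_of_st h1' ((reg_omega _).2 ((reg_omega _).2 h1)) (by rw [s_omega, s_omega, h2, h2']) (by rw [t_omega, t_omega, h3, h3'])

section Families
variable {B : ValuationSubring ℂ} {G : Type*} [CommGroup G] [HasDistribNeg G] {A L μ : G → ℂ} {ρ : G}
  {e r : IsLocalRing.ResidueField B}

lemma eq_of_rd {a b : ℂ} {u : IsLocalRing.ResidueField B} (h3 : (3 : IsLocalRing.ResidueField B) ≠ 0)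
    (ha : Rd B a u) (hb : Rd B b u) (hu : u ≠ 0) (h : a ^ 3 = b ^ 3) : a = b := by
  have h1 : (a - b) * (a ^ 2 + a * b + b ^ 2) = 0 := by linear_combination h
  refine sub_eq_zero.1 ((mul_eq_zero.1 h1).resolve_right fun h2 => ?_)
  have := ((((ha.pow 2).add (ha.mul hb)).add (hb.pow 2))).unique (h2 ▸ Rd.zero)
  exact mul_ne_zero h3 (pow_ne_zero 2 hu) (by linear_combination this)

lemma trivial_identity {a a' l l' m : ℂ} (ha : a ^ 3 = 1 - l) (ha' : a' ^ 3 = 1 - l') (hl : l = l' * m)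
    (hm : m ^ 3 = l ^ 3 - 1) (hm0 : m ≠ 0) (h0 : m ^ 2 - m + 1 - l ^ 2 ≠ 0) :
    (l ^ 2 * (a * a' / (m ^ 2 - m + 1 - l ^ 2))) ^ 3 + (-((m ^ 2 - m + 1) * (a * a' / (m ^ 2 - m + 1 - l ^ 2)))) ^ 3 + 1 = 0 := by
  have h1 : (a * a') ^ 3 * m = (1 - l) * (m - l) := by rw [mul_pow, ha, ha', hl]; ring
  clear ha ha' hl
  generalize a * a' = c at *
  obtain ⟨d, hd⟩ : ∃ d, d = m ^ 2 - m + 1 - l ^ 2 := ⟨_, rfl⟩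
  obtain ⟨q, hq⟩ : ∃ q, q = m ^ 2 - m + 1 := ⟨_, rfl⟩
  rw [← hd] at h0 ⊢
  rw [← hq] at hd ⊢
  field_simp
  refine mul_left_cancel₀ hm0 ?_
  grind

lemma twisted_identity {w a a' l l' m : ℂ} (hw : w ^ 3 = 1) (ha : a ^ 3 = 1 - l) (ha' : a' ^ 3 = 1 - w ^ 2 * l') (hl : l = l' * m)
    (hm : m ^ 3 = l ^ 3 - 1) (h0 : 1 + w * m - l ≠ 0) :
    3 * (w * m) * (1 + w * m) * (a * a' / (1 + w * m - l)) ^ 3 = 1 := by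
  have h1 : (a * a') ^ 3 * (w * m) = (1 - l) * (w * m - l) := by
    rw [mul_pow, ha, ha', hl]; linear_combination -(1 - l' * m) * l' * m * hw
  have h2 : (w * m) ^ 3 = l ^ 3 - 1 := by rw [mul_pow, hw, hm, one_mul]
  generalize a * a' = c at *
  generalize w * m = n at *
  field_simp
  clear ha ha' hl
  grind

/-- The first family of points. -/
noncomputable def ptA (A L μ : G → ℂ) (x : G) : ℂ :=
  pnt (L x ^ 2 * (A x * A (-x) / (μ x ^ 2 - μ x + 1 - L x ^ 2)))
    (-((μ x ^ 2 - μ x + 1) * (A x * A (-x) / (μ x ^ 2 - μ x + 1 - L x ^ 2))))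

/-- A building block of the second family of points. -/
noncomputable def ptN (A L μ : G → ℂ) (w : ℂ) (τ x : G) : ℂ :=
  pnt (L x * (A x * A (τ * -x) / (1 + w * μ x - L x)))
    (-((1 + w * μ x) * (A x * A (τ * -x) / (1 + w * μ x - L x))))

/-- The second family of points. -/
noncomputable def ptB (A L μ : G → ℂ) (ρ x : G) : ℂ := ptN A L μ ω ρ x + ptN A L μ (ω ^ 2) ρ⁻¹ x

variable (hA : ∀ x, A x ^ 3 = 1 - L x) (hL : ∀ x, L x = L (-x) * μ x) (hμ : ∀ x, μ x ^ 3 = L x ^ 3 - 1)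
  (rA : ∀ x, Rd B (A x) e) (rL : ∀ x, Rd B (L x) 0) (rμ : ∀ x, Rd B (μ x) (-1))
  (he : e ^ 3 = 1) (h3 : (3 : IsLocalRing.ResidueField B) ≠ 0)
  (hLρ : ∀ x, L (ρ * x) = ω ^ 2 * L x) (hμρ : ∀ x, μ (ρ * x) = μ x)

omit [CommGroup G] [HasDistribNeg G] in
include rμ in
lemma mu_ne (x : G) : μ x ≠ 0 := (rμ x).ne (neg_ne_zero.2 one_ne_zero)

omit [CommGroup G] [HasDistribNeg G] in
include rμ in
lemma rd_q (x : G) : Rd B (μ x ^ 2 - μ x + 1) 3 := by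
  have := (((rμ x).pow 2).sub (rμ x)).add Rd.one
  convert this using 1; ring

omit [CommGroup G] [HasDistribNeg G] in
include rL rμ in
lemma rd_den (x : G) : Rd B (μ x ^ 2 - μ x + 1 - L x ^ 2) 3 := by
  have := (rd_q rμ x).sub ((rL x).pow 2)
  convert this using 1; ring

include hA hL hμ rL rμ h3 in
lemma ptA_curve (x : G) : (L x ^ 2 * (A x * A (-x) / (μ x ^ 2 - μ x + 1 - L x ^ 2))) ^ 3 +
    (-((μ x ^ 2 - μ x + 1) * (A x * A (-x) / (μ x ^ 2 - μ x + 1 - L x ^ 2)))) ^ 3 + 1 = 0 :=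
  trivial_identity (hA x) (hA (-x)) (hL x) (hμ x) (mu_ne rμ x) ((rd_den rL rμ x).ne h3)

include rA rL rμ h3 in
lemma rd_yA (x : G) : Rd B ((μ x ^ 2 - μ x + 1) * (A x * A (-x) / (μ x ^ 2 - μ x + 1 - L x ^ 2))) (e ^ 2) := by
  have := (rd_q rμ x).mul (((rA x).mul (rA (-x))).div (rd_den rL rμ x) h3)
  convert this using 1; field_simp

include hA hL hμ rA rL rμ h3 in
lemma ptA_red (x : G) : Red B (ptA A L μ x) ![0, -e ^ 2, 1] := by
  obtain ⟨h1, h2, h4⟩ := pnt_spec (ptA_curve hA hL hμ rL rμ h3 x)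
  refine Red.of_st h1 ?_ ?_
  · rw [ptA, h2]
    have := ((rL x).pow 2).mul (((rA x).mul (rA (-x))).div (rd_den rL rμ x) h3)
    convert this using 1; ring
  · rw [ptA, h4]; exact (rd_yA rA rL rμ h3 x).neg

include hA hL hμ rL rμ h3 in
lemma ptA_map {σ : ℂ ≃+* ℂ} {π : G → G} (hπ : ∀ x, π (-x) = -π x)
    (h : ∀ x, σ (A x) = A (π x) ∧ σ (L x) = L (π x) ∧ σ (μ x) = μ (π x)) (x : G) :
    Sg σ (ptA A L μ x) (ptA A L μ (π x)) := by
  have := Sg.pnt σ (ptA_curve hA hL hμ rL rμ h3 x)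
  rw [ptA, ptA]
  simpa only [map_neg, map_mul, map_div₀, map_sub, map_add, map_pow, map_one, h, hπ] using this

include hA hL hμ rA rL rμ he h3 hLρ hμρ in
lemma ptA_root (x : G) : ptA A L μ (ρ * x) - ω * ptA A L μ x ∈ Λ := by
  have c1 := ptA_curve hA hL hμ rL rμ h3 x
  have c2 := ptA_curve hA hL hμ rL rμ h3 (ρ * x)
  have e0 : e ≠ 0 := by rintro rfl; simp at he
  have r1 := rd_yA rA rL rμ h3 x
  have r2 := rd_yA rA rL rμ h3 (ρ * x)
  have hq := (rd_q rμ x).ne h3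
  have hd := (rd_den rL rμ x).ne h3
  have hd' := (rd_den rL rμ (ρ * x)).ne h3
  have key := pnt_omega c1
  rw [ptA, ptA]
  rw [hμρ, hLρ] at *
  have w3 := omega_cube
  generalize A x * A (-x) / (μ x ^ 2 - μ x + 1 - L x ^ 2) = g at *
  generalize A (ρ * x) * A (-(ρ * x)) / (μ x ^ 2 - μ x + 1 - (ω ^ 2 * L x) ^ 2) = g' at *
  have hgg : g' = g := mul_left_cancel₀ hq (eq_of_rd h3 r2 r1 (pow_ne_zero 2 e0) (by
    generalize μ x ^ 2 - μ x + 1 = q at *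
    clear key r1 r2 hLρ hμρ rA rL rμ hA hL hμ
    have c1' : (L x ^ 6 - q ^ 3) * g ^ 3 + 1 = 0 := by linear_combination c1
    have c2' : (L x ^ 6 - q ^ 3) * g' ^ 3 + 1 = 0 := by
      linear_combination c2 - L x ^ 6 * g' ^ 3 * (ω ^ 9 + ω ^ 6 + ω ^ 3 + 1) * w3
    have h7 : L x ^ 6 - q ^ 3 ≠ 0 := fun h => one_ne_zero (α := ℂ) (by linear_combination c1' - g ^ 3 * h)
    exact mul_left_cancel₀ h7 (by linear_combination q ^ 3 * (c2' - c1'))))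
  rw [hgg]
  convert key using 3
  linear_combination ω * L x ^ 2 * g * w3

variable {w : ℂ} {τ : G} {u : IsLocalRing.ResidueField B} (hw : w ^ 3 = 1) (hτ : ∀ x, L (τ * x) = w ^ 2 * L x)
  (ru : Rd B w u) (hu : 1 - u ≠ 0)

omit [CommGroup G] [HasDistribNeg G] in
include rL rμ ru in
lemma rd_denN (x : G) : Rd B (1 + w * μ x - L x) (1 - u) := by
  have := (Rd.one.add (ru.mul (rμ x))).sub (rL x)
  convert this using 1; ring

include hA hL hμ rL rμ hw hτ ru hu in
lemma ptN_identity (x : G) :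
    3 * (w * μ x) * (1 + w * μ x) * (A x * A (τ * -x) / (1 + w * μ x - L x)) ^ 3 = 1 :=
  twisted_identity hw (hA x) (by rw [hA, hτ]) (hL x) (hμ x) ((rd_denN rL rμ ru x).ne hu)

include hA hL hμ rL rμ hw hτ ru hu in
lemma ptN_curve (x : G) : (L x * (A x * A (τ * -x) / (1 + w * μ x - L x))) ^ 3 +
    (-((1 + w * μ x) * (A x * A (τ * -x) / (1 + w * μ x - L x)))) ^ 3 + 1 = 0 := by
  have h := ptN_identity hA hL hμ rL rμ hw hτ ru hu x
  have h2 : (w * μ x) ^ 3 = L x ^ 3 - 1 := by rw [mul_pow, hw, hμ, one_mul]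
  linear_combination -h - (A x * A (τ * -x) / (1 + w * μ x - L x)) ^ 3 * h2

include rA rL rμ ru hu in
lemma rd_gN (x : G) : Rd B (A x * A (τ * -x) / (1 + w * μ x - L x)) (e ^ 2 / (1 - u)) := by
  have := ((rA x).mul (rA (τ * -x))).div (rd_denN rL rμ ru x) hu
  rwa [← pow_two] at this

include hA hL hμ rA rL rμ hw hτ ru hu in
lemma ptN_red (x : G) : Red B (ptN A L μ w τ x) ![0, -e ^ 2, 1] := by
  obtain ⟨h1, h2, h4⟩ := pnt_spec (ptN_curve hA hL hμ rL rμ hw hτ ru hu x)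
  have hg := rd_gN (τ := τ) rA rL rμ ru hu x
  refine Red.of_st h1 ?_ ?_
  · rw [ptN, h2]
    simpa using (rL x).mul hg
  · rw [ptN, h4]
    have := ((Rd.one.add (ru.mul (rμ x))).mul hg).neg
    convert this using 1; field_simp; ring

include hA hL hμ rL rμ hw hτ ru hu in
lemma ptN_map {σ : ℂ ≃+* ℂ} {π : G → G} {w' : ℂ} {τ' : G} (hπ : ∀ x, π (τ * -x) = τ' * -π x) (hσ : σ w = w')
    (h : ∀ x, σ (A x) = A (π x) ∧ σ (L x) = L (π x) ∧ σ (μ x) = μ (π x)) (x : G) :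
    Sg σ (ptN A L μ w τ x) (ptN A L μ w' τ' (π x)) := by
  have := Sg.pnt σ (ptN_curve hA hL hμ rL rμ hw hτ ru hu x)
  rw [ptN, ptN]
  simpa only [map_neg, map_mul, map_div₀, map_sub, map_add, map_pow, map_one, h, hπ, hσ] using this

include hA hL hμ rA rL rμ hw hτ ru hu he h3 hLρ hμρ in
lemma ptN_root (x : G) : ptN A L μ w τ (ρ * x) - ω ^ 2 * ptN A L μ w τ x ∈ Λ := by
  have i1 := ptN_identity hA hL hμ rL rμ hw hτ ru hu x
  have i2 := ptN_identity hA hL hμ rL rμ hw hτ ru hu (ρ * x)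
  have r1 := rd_gN (τ := τ) rA rL rμ ru hu x
  have r2 := rd_gN (τ := τ) rA rL rμ ru hu (ρ * x)
  have e0 : e ≠ 0 := by rintro rfl; simp at he
  have key := pnt_omega_sq (ptN_curve hA hL hμ rL rμ hw hτ ru hu x)
  rw [ptN, ptN]
  rw [hμρ, hLρ] at *
  have hn : 3 * (w * μ x) * (1 + w * μ x) ≠ 0 := left_ne_zero_of_mul (i1.trans_ne one_ne_zero)
  rwa [eq_of_rd h3 r2 r1 (div_ne_zero (pow_ne_zero 2 e0) hu) (mul_left_cancel₀ hn (i2.trans i1.symm)), mul_assoc]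

variable (rω : Rd B ω r) (hr : r ^ 2 + r + 1 = 0)

omit [HasDistribNeg G] in
include hLρ in
lemma L_inv (x : G) : L (ρ⁻¹ * x) = (ω ^ 2) ^ 2 * L x := by
  have := hLρ (ρ⁻¹ * x)
  rw [mul_inv_cancel_left] at this
  rw [this]
  linear_combination -(ω ^ 3 + 1) * L (ρ⁻¹ * x) * omega_cube

include h3 hr in
omit [CommGroup G] [HasDistribNeg G] in
lemma root_ne : 1 - r ≠ 0 ∧ 1 - r ^ 2 ≠ 0 := by
  constructor <;> intro h <;> apply h3
  · linear_combination hr + (r + 2) * h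
  · have h1 : r = -2 := by linear_combination hr + h
    rw [h1] at hr
    linear_combination hr

include hA hL hμ rA rL rμ h3 hLρ rω hr he in
lemma ptB_red (x : G) : Red B (ptB A L μ ρ x) ![0, -e ^ 4, 1] := by
  obtain ⟨h1, h2⟩ := root_ne h3 hr
  have i1 := ptN_red hA hL hμ rA rL rμ omega_cube hLρ rω h1 x
  have i2 := ptN_red hA hL hμ rA rL rμ omega_sq_cube (L_inv hLρ) (rω.pow 2) h2 x
  have := i1.add h3 i2 (O_ne _) (isSum_torsion (a := e ^ 2) (b := e ^ 2) (by rw [← pow_mul, mul_comm, pow_mul, he, one_pow])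
    (by rw [← pow_mul, mul_comm, pow_mul, he, one_pow]))
  rwa [← pow_add] at this

include hA hL hμ rA rL rμ h3 hLρ hμρ rω hr he in
lemma ptB_root (x : G) : ptB A L μ ρ (ρ * x) - ω ^ 2 * ptB A L μ ρ x ∈ Λ := by
  obtain ⟨h1, h2⟩ := root_ne h3 hr
  have i1 := ptN_root hA hL hμ rA rL rμ he h3 hLρ hμρ omega_cube hLρ rω h1 x
  have i2 := ptN_root hA hL hμ rA rL rμ he h3 hLρ hμρ omega_sq_cube (L_inv hLρ) (rω.pow 2) h2 x
  convert add_mem i1 i2 using 1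
  rw [ptB, ptB]; ring

include hA hL hμ rL rμ h3 hLρ rω hr in
lemma ptB_map {σ : ℂ ≃+* ℂ} {c : G} (hσ : σ ω = ω)
    (h : ∀ x, σ (A x) = A (c * x) ∧ σ (L x) = L (c * x) ∧ σ (μ x) = μ (c * x)) (x : G) :
    Sg σ (ptB A L μ ρ x) (ptB A L μ ρ (c * x)) := by
  obtain ⟨h1, h2⟩ := root_ne h3 hr
  have i1 := ptN_map hA hL hμ rL rμ omega_cube hLρ rω h1 (σ := σ) (π := (c * ·)) (τ' := ρ)
    (fun x => by simp [mul_left_comm]) hσ h x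
  have i2 := ptN_map hA hL hμ rL rμ omega_sq_cube (L_inv hLρ) (rω.pow 2) h2 (σ := σ) (π := (c * ·)) (τ' := ρ⁻¹)
    (fun x => by simp [mul_left_comm]) (by rw [map_pow, hσ]) h x
  exact i1.add i2

include hA hL hμ rL rμ h3 hLρ rω hr in
lemma ptB_map_inv {σ : ℂ ≃+* ℂ} {c : G} (hσ : σ ω = ω ^ 2)
    (h : ∀ x, σ (A x) = A (c * x⁻¹) ∧ σ (L x) = L (c * x⁻¹) ∧ σ (μ x) = μ (c * x⁻¹)) (x : G) :
    Sg σ (ptB A L μ ρ x) (ptB A L μ ρ (c * x⁻¹)) := by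
  obtain ⟨h1, h2⟩ := root_ne h3 hr
  have i1 := ptN_map hA hL hμ rL rμ omega_cube hLρ rω h1 (σ := σ) (π := (c * ·⁻¹)) (τ' := ρ⁻¹)
    (fun x => by simp [mul_left_comm, mul_comm]) hσ h x
  have i2 := ptN_map hA hL hμ rL rμ omega_sq_cube (L_inv hLρ) (rω.pow 2) h2 (σ := σ) (π := (c * ·⁻¹)) (τ' := ρ) (w' := ω)
    (fun x => by simp [mul_left_comm, mul_comm]) (by rw [map_pow, hσ]; linear_combination ω * omega_cube) h x
  rw [ptB, ptB, add_comm (ptN A L μ ω ρ (c * x⁻¹))]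
  exact i1.add i2

end Families

section Final
variable {p : ℕ} [hpp : Fact p.Prime]

omit hpp in
lemma pow_eq_omega (hp : p % 9 = 4 ∨ p % 9 = 7) :
    p % 9 = 4 ∧ ω ^ (2 * ((p - 1) / 3)) = ω ^ 2 ∨ p % 9 = 7 ∧ ω ^ (2 * ((p - 1) / 3)) = ω := by
  rcases hp with h | h
  · refine Or.inl ⟨h, ?_⟩
    rw [show 2 * ((p - 1) / 3) = 3 * (2 * (p / 9)) + 2 by omega, pow_add, pow_mul, omega_cube, one_pow, one_mul]
  · refine Or.inr ⟨h, ?_⟩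
    rw [show 2 * ((p - 1) / 3) = 3 * (2 * (p / 9) + 1) + 1 by omega, pow_add, pow_mul, omega_cube, one_pow, one_mul, pow_one]

theorem exists_cube_sum (hp : p % 9 = 4 ∨ p % 9 = 7) (hc : ¬ ∃ x : ZMod p, x ^ 3 = 3) :
    (∃ x y : ℚ, x ≠ 0 ∧ y ≠ 0 ∧ x ^ 3 + y ^ 3 = (p : ℚ) ^ 1) ∧
      ∃ x y : ℚ, x ≠ 0 ∧ y ≠ 0 ∧ x ^ 3 + y ^ 3 = (p : ℚ) ^ 2 := by
  have hp3 : p % 3 = 1 := by omega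
  have hp0 := hpp.out.ne_zero
  obtain ⟨B, hB⟩ := exists_place p
  obtain ⟨ι⟩ := exists_hom hB
  obtain ⟨r, hr, hω⟩ := rd_omega_exists hp3 ι
  obtain ⟨ρ, rfl⟩ : ∃ ρ : (ZMod p)ˣ, (ρ : ZMod p) = r := ⟨Units.mk0 r (ne_zero_of_root hr), rfl⟩
  obtain ⟨g, hg⟩ := IsCyclic.exists_monoid_generator (α := (ZMod p)ˣ)
  obtain ⟨e, he, he1, hres⟩ := α_residue hr hp3 hω hc
  have h3 := three_ne_zero_res hp3 ι
  have hιr := map_root (ι := ι) hr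
  obtain ⟨A, dA⟩ : ∃ A : (ZMod p)ˣ → ℂ, ∀ x : (ZMod p)ˣ, A x = α (ρ : ZMod p) (x : ZMod p) := ⟨_, fun _ => rfl⟩
  obtain ⟨L, dL⟩ : ∃ L : (ZMod p)ˣ → ℂ, ∀ x : (ZMod p)ˣ, L x = lm (ρ : ZMod p) (x : ZMod p) := ⟨_, fun _ => rfl⟩
  obtain ⟨μ, dμ⟩ : ∃ μ : (ZMod p)ˣ → ℂ, ∀ x : (ZMod p)ˣ, μ x = mm (ρ : ZMod p) (x : ZMod p) := ⟨_, fun _ => rfl⟩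
  have hA : ∀ x, A x ^ 3 = 1 - L x := fun x => by
    rw [dA, dL]; exact α_cube hp3 _ _
  have hL : ∀ x, L x = L (-x) * μ x := fun x => by
    simpa only [dL, dμ, Units.val_neg] using (lm_mm hr hp3 x).1
  have hμ : ∀ x, μ x ^ 3 = L x ^ 3 - 1 := fun x => by
    rw [dL, dμ]; exact (lm_mm hr hp3 x).2
  have rA : ∀ x, Rd B (A x) e := fun x => by
    rw [dA]; exact (hres x x.ne_zero).1
  have rL : ∀ x, Rd B (L x) 0 := fun x => by
    rw [dL]; exact (hres x x.ne_zero).2.1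
  have rμ : ∀ x, Rd B (μ x) (-1) := fun x => by
    rw [dμ]; exact (hres x x.ne_zero).2.2
  have hLρ : ∀ x, L (ρ * x) = ω ^ 2 * L x := fun x => by
    simpa only [dL, Units.val_mul] using lm_root hr hp3 x
  have hμρ : ∀ x, μ (ρ * x) = μ x := fun x => by
    simpa only [dμ, Units.val_mul] using mm_root hr x
  have hθ3 : (ω ^ (2 * ((p - 1) / 3))) ^ 3 = 1 := by
    rw [← pow_mul, mul_comm, pow_mul, omega_cube, one_pow]
  have hθ := pow_eq_omega hp
  have hθ1 : ω ^ (2 * ((p - 1) / 3)) ≠ 1 := by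
    rcases hθ with ⟨-, h⟩ | ⟨-, h⟩ <;> rw [h]
    · intro h'
      exact omega_ne_one (by linear_combination omega_cube - ω * h')
    · exact omega_ne_one
  have hm : Fintype.card (ZMod p)ˣ = 3 * ((p - 1) / 3) := by
    rw [ZMod.card_units]; omega
  have hm3 : ¬ 3 ∣ (p - 1) / 3 := by omega
  have hact := action hr hp3 hg
  simp only [← dA, ← dL, ← dμ] at hact
  have hβ := β_root (g := g) hr 1
  have hβ3 := β_cube hr hp3 hg 1
  have hcA : ∀ j, ω = (ω ^ (2 * ((p - 1) / 3))) ^ j →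
      ∃ x y : ℚ, x ≠ 0 ∧ y ≠ 0 ∧ x ^ 3 + y ^ 3 = (p : ℚ) ^ j := fun j hj =>
    descent (B := B) (a := e ^ 2) (β := fun x => β (ρ : ZMod p) g 1 x) (M := ptA A L μ) hp0 hθ3 hθ1 hj (Or.inl rfl)
      hβ (ptA_root hA hL hμ rA rL rμ he h3 hLρ hμρ) (fun σ => by
        obtain ⟨c, ⟨-, h⟩ | ⟨-, h⟩⟩ := hact σ
        · exact ⟨Equiv.mulLeft c, fun x => ⟨(h x).1,
            ptA_map hA hL hμ rL rμ h3 (π := (c * ·)) (fun x => by simp) (fun x => (h x).2) x⟩⟩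
        · exact ⟨(Equiv.inv _).trans (Equiv.mulLeft c), fun x => ⟨(h x).1,
            ptA_map hA hL hμ rL rμ h3 (π := (c * ·⁻¹)) (fun x => by simp) (fun x => (h x).2) x⟩⟩)
      hβ3 hm hm3 h3
      (by rw [← pow_mul, mul_comm, pow_mul, he, one_pow])
      (fun h => he1 (by linear_combination he - e * h))
      (ptA_red hA hL hμ rA rL rμ h3)
  have hcB : ∀ j, ω ^ 2 = (ω ^ (2 * ((p - 1) / 3))) ^ j →
      ∃ x y : ℚ, x ≠ 0 ∧ y ≠ 0 ∧ x ^ 3 + y ^ 3 = (p : ℚ) ^ j := fun j hj =>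
    descent (B := B) (a := e ^ 4) (β := fun x => β (ρ : ZMod p) g 1 x) (M := ptB A L μ ρ) hp0 hθ3 hθ1 hj (Or.inr rfl)
      hβ (ptB_root hA hL hμ rA rL rμ he h3 hLρ hμρ hω hιr) (fun σ => by
        obtain ⟨c, ⟨hσ, h⟩ | ⟨hσ, h⟩⟩ := hact σ
        · exact ⟨Equiv.mulLeft c, fun x => ⟨(h x).1,
            ptB_map hA hL hμ rL rμ h3 hLρ hω hιr hσ (fun x => (h x).2) x⟩⟩
        · exact ⟨(Equiv.inv _).trans (Equiv.mulLeft c), fun x => ⟨(h x).1,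
            ptB_map_inv hA hL hμ rL rμ h3 hLρ hω hιr hσ (fun x => (h x).2) x⟩⟩)
      hβ3 hm hm3 h3
      (by rw [← pow_mul, mul_comm, pow_mul, he, one_pow])
      (fun h => he1 (by linear_combination h - e * he))
      (ptB_red hA hL hμ rA rL rμ he h3 hLρ hω hιr)
  rcases hθ with ⟨-, h⟩ | ⟨-, h⟩
  · exact ⟨hcB 1 (by rw [h, pow_one]), hcA 2 (by rw [h]; linear_combination -ω * omega_cube)⟩
  · exact ⟨hcA 1 (by rw [h, pow_one]), hcB 2 (by rw [h])⟩

end Final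

end CubeSum

theorem stmt_0 (p : ℕ) (hp : p.Prime) (hmod : p % 9 = 4 ∨ p % 9 = 7)
    (hcube : ¬ ∃ x : ℤ, (x : ZMod p) ^ 3 = 3) :
    IsCubeSum (p : ℚ) ∧ IsCubeSum ((p : ℚ) ^ 2) := by
  have := Fact.mk hp
  obtain ⟨h1, h2⟩ := CubeSum.exists_cube_sum hmod fun ⟨x, hx⟩ => by
    obtain ⟨y, rfl⟩ := ZMod.intCast_surjective x
    exact hcube ⟨y, hx⟩
  rw [pow_one] at h1
  exact ⟨h1, h2⟩
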